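/- Let A, B ∈ ℤ with |A| ≤ B and B ≥ 2, let M be a 2×2 integer matrix with characteristic polynomial x² + A·x + B, let v ∈ ℤ² be such that v and M·v are linearly independent over ℝ, and let T be the associated self-affine tile with digit set D = {0, v, 2v, …, (B−1)v}. If 2|A| − B ∈ {3, 4}, then: (a) T is connected and for every x ∈ T the set T ∖ {x} is preconnected (T has no cut point); (b) the interior of T is not preconnected; and (c) for every connected component U of the interior of T, the closure of U is homeomorphic to the closed unit disk {p ∈ ℝ² : ‖p‖ ≤ 1}. -/

import Mathlib

noncomputable section

open Set Metric Filter Topology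

/-- `f` admits a continuous logarithm on `K`. -/
def HasLogOn (K : Set ℂ) (f : ℂ → ℂ) : Prop :=
  ∃ g : ℂ → ℂ, ContinuousOn g K ∧ ∀ z ∈ K, Complex.exp (g z) = f z

theorem IsPreconnected.eq_of_forall_exists_int {X : Type*} [TopologicalSpace X] {s : Set X}
    (hs : IsPreconnected s) {f : X → ℂ} (hf : ContinuousOn f s) (h : ∀ x ∈ s, ∃ n : ℤ, f x = n)
    {x y : X} (hx : x ∈ s) (hy : y ∈ s) : f x = f y := by
  have htd : IsTotallyDisconnected (Set.range ((↑) : ℤ → ℝ)) :=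
    Int.isClosedEmbedding_coe_real.isEmbedding.isTotallyDisconnected_range.2 inferInstance
  have himg := hs.image (fun x => (f x).re) (Complex.continuous_re.comp_continuousOn hf)
  have := htd _ (by
    rintro _ ⟨z, hz, rfl⟩
    obtain ⟨n, hn⟩ := h z hz
    exact ⟨n, by simp [hn]⟩) himg ⟨x, hx, rfl⟩ ⟨y, hy, rfl⟩
  obtain ⟨n, hn⟩ := h x hx
  obtain ⟨m, hm⟩ := h y hy
  simp only [hn, hm] at this ⊢
  simpa using this

namespace HasLogOn

variable {K : Set ℂ} {f g : ℂ → ℂ}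

theorem mono {K' : Set ℂ} (h : HasLogOn K f) (hK : K' ⊆ K) : HasLogOn K' f := by
  obtain ⟨l, hl, he⟩ := h
  exact ⟨l, hl.mono hK, fun z hz => he z (hK hz)⟩

theorem congr (h : HasLogOn K f) (hfg : ∀ z ∈ K, f z = g z) : HasLogOn K g := by
  obtain ⟨l, hl, he⟩ := h
  exact ⟨l, hl, fun z hz => (he z hz).trans (hfg z hz)⟩

theorem mul (hf : HasLogOn K f) (hg : HasLogOn K g) : HasLogOn K fun z => f z * g z := by
  obtain ⟨l, hl, he⟩ := hf
  obtain ⟨m, hm, hme⟩ := hg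
  exact ⟨fun z => l z + m z, hl.add hm, fun z hz => by
    rw [Complex.exp_add, he z hz, hme z hz]⟩

theorem div (hf : HasLogOn K f) (hg : HasLogOn K g) : HasLogOn K fun z => f z / g z := by
  obtain ⟨l, hl, he⟩ := hf
  obtain ⟨m, hm, hme⟩ := hg
  exact ⟨fun z => l z - m z, hl.sub hm, fun z hz => by
    rw [Complex.exp_sub, he z hz, hme z hz]⟩

theorem const {c : ℂ} (hc : c ≠ 0) : HasLogOn K fun _ => c :=
  ⟨fun _ => Complex.log c, continuousOn_const, fun _ _ => Complex.exp_log hc⟩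

theorem of_slitPlane (hf : ContinuousOn f K) (hs : ∀ z ∈ K, f z ∈ Complex.slitPlane) :
    HasLogOn K f :=
  ⟨fun z => Complex.log (f z), hf.clog hs,
    fun z hz => Complex.exp_log (Complex.slitPlane_ne_zero (hs z hz))⟩

theorem of_norm_sub_one_lt (hf : ContinuousOn f K) (hs : ∀ z ∈ K, ‖f z - 1‖ < 1) :
    HasLogOn K f := by
  refine of_slitPlane hf fun z hz => ?_
  have := Complex.mem_slitPlane_of_norm_lt_one (hs z hz)
  simpa using this

/-- Moving the puncture of `z - w` by less than its distance to `K` preserves logarithms. -/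
theorem move {w w' : ℂ} {φ : ℂ → ℂ} (h : HasLogOn K fun z => (z - w) * φ z)
    (hw : ∀ z ∈ K, ‖w' - w‖ < ‖z - w‖) : HasLogOn K fun z => (z - w') * φ z := by
  have hne : ∀ z ∈ K, z - w ≠ 0 := fun z hz h0 => by
    have := hw z hz
    rw [h0, norm_zero] at this
    exact absurd this (not_lt.2 (norm_nonneg _))
  have h1 : HasLogOn K fun z => 1 - (w' - w) / (z - w) := by
    refine of_norm_sub_one_lt ?_ fun z hz => ?_
    · exact continuousOn_const.sub (continuousOn_const.div (by fun_prop) hne)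
    · rw [sub_sub_cancel_left, norm_neg, norm_div, div_lt_one (norm_pos_iff.2 (hne z hz))]
      exact hw z hz
  refine (h.mul h1).congr fun z hz => ?_
  have := hne z hz
  field_simp
  ring

/-- On a closed set, the existence of a logarithm is locally constant in the puncture. -/
theorem eventually_iff (hK : IsClosed K) {φ : ℂ → ℂ} {w : ℂ} (hw : w ∉ K) :
    ∀ᶠ w' in 𝓝 w, (HasLogOn K (fun z => (z - w') * φ z) ↔
      HasLogOn K fun z => (z - w) * φ z) := by
  obtain ⟨ε, hε, hb⟩ := Metric.isOpen_iff.1 hK.isOpen_compl w hw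
  refine Metric.eventually_nhds_iff.2 ⟨ε / 2, by positivity, fun w' hw' => ?_⟩
  rw [dist_eq_norm] at hw'
  have hd : ∀ z ∈ K, ε ≤ ‖z - w‖ := fun z hz => by
    by_contra! hlt
    exact hb (by rwa [mem_ball, dist_eq_norm]) hz
  refine ⟨fun h => h.move fun z hz => ?_, fun h => h.move fun z hz => ?_⟩
  · have h1 := hd z hz
    have h2 := norm_sub_le_norm_sub_add_norm_sub z w' w
    rw [norm_sub_rev w w']
    linarith
  · linarith [hd z hz]

theorem of_isPreconnected (hK : IsClosed K) {φ : ℂ → ℂ} {C : Set ℂ} (hC : IsPreconnected C)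
    (hCK : Disjoint C K) {w w' : ℂ} (hw : w ∈ C) (hw' : w' ∈ C)
    (h : HasLogOn K fun z => (z - w) * φ z) : HasLogOn K fun z => (z - w') * φ z := by
  by_contra hn
  let P : ℂ → Prop := fun w => HasLogOn K fun z => (z - w) * φ z
  have hU : IsOpen {w | w ∉ K ∧ P w} := by
    rw [isOpen_iff_eventually]
    rintro x ⟨hx, hPx⟩
    filter_upwards [hK.isOpen_compl.eventually_mem hx, eventually_iff hK (φ := φ) hx] with y h1 h2
    exact ⟨h1, h2.2 hPx⟩
  have hV : IsOpen {w | w ∉ K ∧ ¬ P w} := by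
    rw [isOpen_iff_eventually]
    rintro x ⟨hx, hPx⟩
    filter_upwards [hK.isOpen_compl.eventually_mem hx, eventually_iff hK (φ := φ) hx] with y h1 h2
    exact ⟨h1, fun h => hPx (h2.1 h)⟩
  have hd := fun x (hx : x ∈ C) => Set.disjoint_left.1 hCK hx
  obtain ⟨x, -, hx1, hx2⟩ := hC _ _ hU hV (fun x hx => by
      by_cases hp : P x
      exacts [Or.inl ⟨hd x hx, hp⟩, Or.inr ⟨hd x hx, hp⟩])
    ⟨w, hw, hd w hw, h⟩ ⟨w', hw', hd w' hw', hn⟩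
  exact hx2.2 hx1.2

/-- A set disjoint from a preconnected set containing `a` and `b` does not separate them. -/
theorem div_of_isPreconnected (hK : IsClosed K) {C : Set ℂ} (hC : IsPreconnected C)
    (hCK : Disjoint C K) {a b : ℂ} (ha : a ∈ C) (hb : b ∈ C) :
    HasLogOn K fun z => (z - a) / (z - b) := by
  have : HasLogOn K fun z => (z - b) * (z - b)⁻¹ := by
    refine (const (K := K) one_ne_zero).congr fun z hz => ?_
    rw [mul_inv_cancel₀]
    intro h
    exact Set.disjoint_left.1 hCK hb (by rwa [← sub_eq_zero.1 h])
  exact of_isPreconnected hK hC hCK hb ha this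

theorem sub_of_subset_ball {p w : ℂ} {ρ : ℝ} (hK : K ⊆ ball p ρ) (hw : ρ ≤ ‖w - p‖) :
    HasLogOn K fun z => z - w := by
  rcases K.eq_empty_or_nonempty with rfl | ⟨k, hk⟩
  · exact ⟨fun _ => 0, continuousOn_const, fun _ h => h.elim⟩
  have hρ : 0 < ρ := pos_of_mem_ball (hK hk)
  have hne : p - w ≠ 0 := by
    intro h
    rw [norm_sub_rev, h, norm_zero] at hw
    linarith
  have h1 : HasLogOn K fun z => 1 + (z - p) / (p - w) := by
    refine of_norm_sub_one_lt (by fun_prop) fun z hz => ?_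
    rw [add_sub_cancel_left, norm_div, div_lt_one (norm_pos_iff.2 hne), norm_sub_rev p w]
    have := hK hz
    rw [mem_ball, dist_eq_norm] at this
    linarith
  refine ((const hne).mul h1).congr fun z _ => ?_
  field_simp
  ring

/-- Two logarithms on closed sets with preconnected intersection can be glued. -/
theorem union {K₁ K₂ : Set ℂ} (h₁ : HasLogOn K₁ f) (h₂ : HasLogOn K₂ f) (hc₁ : IsClosed K₁)
    (hc₂ : IsClosed K₂) (hi : IsPreconnected (K₁ ∩ K₂)) : HasLogOn (K₁ ∪ K₂) f := by
  obtain ⟨l, hl, hle⟩ := h₁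
  obtain ⟨m, hm, hme⟩ := h₂
  have hn : ∀ z ∈ K₁ ∩ K₂, ∃ n : ℤ, l z = m z + n * (2 * Real.pi * Complex.I) := fun z hz =>
    Complex.exp_eq_exp_iff_exists_int.1 ((hle z hz.1).trans (hme z hz.2).symm)
  obtain ⟨n, hn⟩ : ∃ n : ℤ, ∀ z ∈ K₁ ∩ K₂, l z = m z + n * (2 * Real.pi * Complex.I) := by
    rcases (K₁ ∩ K₂).eq_empty_or_nonempty with he | ⟨x, hx⟩
    · exact ⟨0, fun z hz => by simp [he] at hz⟩
    choose! n hn using hn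
    refine ⟨n x, fun z hz => ?_⟩
    have hcont : ContinuousOn (fun z => (l z - m z) / (2 * Real.pi * Complex.I)) (K₁ ∩ K₂) :=
      ((hl.mono inter_subset_left).sub (hm.mono inter_subset_right)).div_const _
    have hval : ∀ z ∈ K₁ ∩ K₂, (l z - m z) / (2 * Real.pi * Complex.I) = n z := by
      intro z hz
      rw [hn z hz, add_sub_cancel_left, mul_div_assoc, div_self Complex.two_pi_I_ne_zero, mul_one]
    have hnz := hi.eq_of_forall_exists_int hcont (fun z hz => ⟨n z, hval z hz⟩) hz hx
    rw [hval z hz, hval x hx] at hnz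
    rw [hn z hz, Int.cast_injective hnz]
  classical
  refine ⟨fun z => if z ∈ K₁ then l z else m z + n * (2 * Real.pi * Complex.I), ?_, ?_⟩
  · refine ContinuousOn.union_of_isClosed ?_ ?_ hc₁ hc₂
    · exact hl.congr fun z hz => if_pos hz
    · have hm' : ContinuousOn (fun z => m z + n * (2 * Real.pi * Complex.I)) K₂ :=
        hm.add continuousOn_const
      refine hm'.congr fun z hz => ?_
      by_cases h : z ∈ K₁
      · simp only [h, if_true]
        exact hn z ⟨h, hz⟩
      · simp only [h, if_false]
  · intro z hz
    by_cases h : z ∈ K₁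
    · simp only [h, if_true]
      exact hle z h
    · simp only [h, if_false]
      rw [Complex.exp_add, hme z (hz.resolve_left h), Complex.exp_int_mul_two_pi_mul_I, mul_one]

end HasLogOn

theorem not_hasLogOn_sphere (a : ℂ) {R : ℝ} (hR : 0 < R) :
    ¬ HasLogOn (sphere a R) fun z => z - a := by
  rintro ⟨g, hg, he⟩
  let γ : ℝ → ℂ := fun t => a + R * Complex.exp (t * Complex.I)
  have hγ : ∀ t, γ t ∈ sphere a R := fun t => by
    simp [γ, Complex.norm_exp_ofReal_mul_I, abs_of_pos hR]
  have hγc : Continuous γ := by fun_prop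
  have hθ : Continuous fun t : ℝ => g (γ t) := hg.comp_continuous hγc hγ
  let q : ℝ → ℂ := fun t => (g (γ t) - t * Complex.I - Real.log R) / (2 * Real.pi * Complex.I)
  have hq : Continuous q :=
    ((hθ.sub (by fun_prop)).sub continuous_const).div_const _
  have hintg : ∀ t, ∃ n : ℤ, q t = n := fun t => by
    have : Complex.exp (g (γ t)) = Complex.exp (t * Complex.I + Real.log R) := by
      rw [he _ (hγ t), Complex.exp_add, ← Complex.ofReal_exp, Real.exp_log hR]
      simp only [γ]; ring
    obtain ⟨n, hn⟩ := Complex.exp_eq_exp_iff_exists_int.1 this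
    refine ⟨n, ?_⟩
    simp only [q, hn]
    rw [div_eq_iff Complex.two_pi_I_ne_zero]
    ring
  have hconst : ∀ s t, q s = q t := fun s t =>
    isPreconnected_univ.eq_of_forall_exists_int hq.continuousOn (fun x _ => hintg x)
      (mem_univ s) (mem_univ t)
  have h0 := hconst 0 (2 * Real.pi)
  have hper : γ (2 * Real.pi) = γ 0 := by
    simp only [γ]
    push_cast
    rw [Complex.exp_two_pi_mul_I]
    simp
  simp only [q, hper] at h0
  rw [div_left_inj' Complex.two_pi_I_ne_zero] at h0
  push_cast at h0
  have : (2 * Real.pi * Complex.I : ℂ) = 0 := by linear_combination h0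
  exact Complex.two_pi_I_ne_zero this

theorem hasLogOn_univ {f : ℂ → ℂ} (hf : Continuous f) (h0 : ∀ z, f z ≠ 0) :
    HasLogOn univ f := by
  obtain ⟨l, hl, he⟩ := Complex.exists_continuousOn_eqOn_exp_comp (X := ℂ) (U := univ)
    (show SimplyConnectedSpace (univ : Set ℂ) from
      have : ContractibleSpace (univ : Set ℂ) :=
        (convex_univ (𝕜 := ℝ) (E := ℂ)).contractibleSpace ⟨0, mem_univ _⟩
      inferInstance)
    isOpen_univ hf.continuousOn (by rintro ⟨z, -, hz⟩; exact h0 z hz)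
  exact ⟨l, hl, fun z hz => he hz⟩

/-- A closed set containing the frontier of a bounded set separates points inside from
points outside. -/
theorem not_hasLogOn_div {K O : Set ℂ} (hK : IsClosed K) (hOb : Bornology.IsBounded O)
    (hfr : frontier O ⊆ K) {a b : ℂ} (ha : a ∈ O) (hb : b ∉ O)
    (hbK : b ∉ K) : ¬ HasLogOn K fun z => (z - a) / (z - b) := by
  rintro ⟨g, hg, he⟩
  obtain ⟨G, hG⟩ := ContinuousMap.exists_restrict_eq hK
    (⟨K.domRestrict g, continuousOn_iff_continuous_domRestrict.1 hg⟩ : C(K, ℂ))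
  have hGe : ∀ z ∈ K, G z = g z := fun z hz => DFunLike.congr_fun hG ⟨z, hz⟩
  classical
  let φ : ℂ → ℂ := fun z => if z ∈ O then Complex.exp (G z) * (z - b) else z - a
  have hφ : Continuous φ := by
    refine Continuous.if ?_ (by fun_prop) (by fun_prop)
    intro z hz
    have hzK := hfr hz
    rw [hGe z hzK, he z hzK, div_mul_cancel₀]
    intro h
    exact hbK (by rwa [← sub_eq_zero.1 h])
  have hφ0 : ∀ z, φ z ≠ 0 := by
    intro z
    by_cases hz : z ∈ O
    · simp only [φ, hz, if_true]
      refine mul_ne_zero (Complex.exp_ne_zero _) fun h => hb ?_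
      rwa [← sub_eq_zero.1 h]
    · simp only [φ, hz, if_false]
      intro h
      exact hz (by rwa [sub_eq_zero.1 h])
  obtain ⟨R, hR⟩ := hOb.subset_ball a
  have hRpos : 0 < R := pos_of_mem_ball (hR ha)
  refine not_hasLogOn_sphere a hRpos (((hasLogOn_univ hφ hφ0).mono
    (subset_univ _)).congr fun z hz => ?_)
  have : z ∉ O := fun h => by
    have := hR h
    rw [mem_ball] at this
    rw [mem_sphere] at hz
    linarith
  simp only [φ, this, if_false]

/-- No nonempty compact subset of the complement of `V` can be added to `V` to yield an open
set. -/
def NoHole (V : Set ℂ) : Prop :=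
  ∀ C : Set ℂ, IsCompact C → Disjoint C V → IsOpen (C ∪ V) → C = ∅

theorem IsCompact.eq_empty_of_isOpen {C : Set ℂ} (hC : IsCompact C) (hO : IsOpen C) : C = ∅ := by
  rcases isClopen_iff.1 ⟨hC.isClosed, hO⟩ with h | h
  · exact h
  · exact absurd (h ▸ hC) (noncompact_univ ℂ)

theorem NoHole.hasLogOn_sub {V : Set ℂ} (hV : NoHole V) (hVo : IsOpen V) {K : Set ℂ}
    (hK : IsCompact K) (hKV : K ⊆ V) {w : ℂ} (hw : w ∉ V) : HasLogOn K fun z => z - w := by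
  let S : Set ℂ := {x | x ∉ K ∧ ¬ HasLogOn K fun z => z - x}
  have key : ∀ x ∉ K, ∀ᶠ y in 𝓝 x, y ∉ K ∧ (HasLogOn K (fun z => z - y) ↔
      HasLogOn K fun z => z - x) := fun x hx => by
    have := HasLogOn.eventually_iff hK.isClosed (φ := fun _ => 1) hx
    simp only [mul_one] at this
    exact (hK.isClosed.isOpen_compl.eventually_mem hx).and this
  have hSo : IsOpen S := by
    rw [isOpen_iff_eventually]
    rintro x ⟨hx, hl⟩
    filter_upwards [key x hx] with y hy
    exact ⟨hy.1, fun h => hl (hy.2.1 h)⟩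
  have hSKc : IsClosed (S ∪ K) := by
    rw [← isOpen_compl_iff, isOpen_iff_eventually]
    intro x hx
    simp only [S, mem_compl_iff, mem_union, mem_ofPred_eq, not_or, not_and, not_not] at hx
    filter_upwards [key x hx.2] with y hy
    simp only [S, mem_compl_iff, mem_union, mem_ofPred_eq, not_or, not_and, not_not]
    exact ⟨fun _ => hy.2.2 (hx.1 hx.2), hy.1⟩
  obtain ⟨R, hR⟩ := hK.isBounded.subset_ball 0
  have hb : Bornology.IsBounded (S ∪ K) := by
    refine (Metric.isBounded_ball (x := (0 : ℂ)) (r := R)).subset (union_subset ?_ hR)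
    intro x hx
    by_contra hxR
    refine hx.2 (HasLogOn.sub_of_subset_ball hR ?_)
    simpa [mem_ball] using hxR
  have hcpt : IsCompact ((S ∪ K) \ V) :=
    (Metric.isCompact_of_isClosed_isBounded hSKc hb).diff hVo
  have hemp := hV _ hcpt disjoint_sdiff_left (by
    rw [sdiff_union_self, union_assoc, union_eq_self_of_subset_left hKV]
    exact hSo.union hVo)
  by_contra hn
  have : w ∈ (S ∪ K) \ V := ⟨Or.inl ⟨fun h => hw (hKV h), hn⟩, hw⟩
  rw [hemp] at this
  exact this

/-- Images under homeomorphisms between open sets containing `V`. -/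
theorem NoHole.image {V D D' : Set ℂ} (hV : NoHole V) {φ ψ : ℂ → ℂ} (hVD : V ⊆ D) (hD : IsOpen D)
    (hφ : MapsTo φ D D') (hψ : MapsTo ψ D' D) (hφc : ContinuousOn φ D) (hψc : ContinuousOn ψ D')
    (h1 : LeftInvOn ψ φ D) (h2 : LeftInvOn φ ψ D')
    (hD' : ∀ C, IsCompact C → Disjoint C (φ '' V) → IsOpen (C ∪ φ '' V) → C ⊆ D') :
    NoHole (φ '' V) := by
  intro C hC hd hO
  have hCD := hD' C hC hd hO
  have himg : ∀ S ⊆ D', ψ '' S = D ∩ φ ⁻¹' S := fun S hS => by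
    ext x
    constructor
    · rintro ⟨y, hy, rfl⟩
      exact ⟨hψ (hS hy), by rwa [mem_preimage, h2 (hS hy)]⟩
    · rintro ⟨hx, hxS⟩
      exact ⟨φ x, hxS, h1 hx⟩
  have hψφ : ψ '' (φ '' V) = V := by
    rw [image_image]
    ext x
    constructor
    · rintro ⟨y, hy, rfl⟩
      simpa only [h1 (hVD hy)] using hy
    · exact fun hx => ⟨x, hx, h1 (hVD hx)⟩
  have := hV (ψ '' C) (hC.image_of_continuousOn (hψc.mono hCD)) (by
      rw [Set.disjoint_left]
      rintro _ ⟨y, hy, rfl⟩ hyV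
      exact Set.disjoint_left.1 hd hy ⟨ψ y, hyV, h2 (hCD hy)⟩) (by
      rw [← hψφ, ← image_union, himg _ (union_subset hCD ?_)]
      · exact hφc.isOpen_inter_preimage hD hO
      · rintro _ ⟨y, hy, rfl⟩
        exact hφ (hVD hy))
  exact image_eq_empty.1 this

theorem NoHole.subset_ball {V : Set ℂ} (hV : V ⊆ ball 0 1) {C : Set ℂ} (hC : IsCompact C)
    (hO : IsOpen (C ∪ V)) : C ⊆ ball 0 1 := by
  rcases C.eq_empty_or_nonempty with rfl | hne
  · exact empty_subset _
  obtain ⟨m, hm, hmax⟩ := hC.exists_isMaxOn hne continuous_norm.continuousOn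
  have hm1 : ‖m‖ < 1 := by
    by_contra! h1
    obtain ⟨ε, hε, hb⟩ := Metric.isOpen_iff.1 hO m (Or.inl hm)
    have hmem : m + (ε / 2 / ‖m‖ : ℝ) * m ∈ ball m ε := by
      rw [mem_ball, dist_eq_norm, add_sub_cancel_left, norm_mul, Complex.norm_real,
        Real.norm_of_nonneg (by positivity), div_mul_cancel₀ _ (by positivity)]
      linarith
    have hnorm : ‖m + (ε / 2 / ‖m‖ : ℝ) * m‖ = ‖m‖ + ε / 2 := by
      have : m + (ε / 2 / ‖m‖ : ℝ) * m = ((1 + ε / 2 / ‖m‖ : ℝ) : ℂ) * m := by push_cast; ring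
      rw [this, norm_mul, Complex.norm_real, Real.norm_of_nonneg (by positivity)]
      field_simp
    rcases hb hmem with h | h
    · have := hmax h
      simp only [mem_ofPred_eq, hnorm] at this
      linarith
    · have := hV h
      rw [mem_ball_zero_iff, hnorm] at this
      linarith
  intro z hz
  rw [mem_ball_zero_iff]
  exact (hmax hz).trans_lt hm1

/-- The disc automorphism sending `a` to `0`. -/
def mobius (a z : ℂ) : ℂ := (z - a) / (1 - (starRingEnd ℂ) a * z)

section mobius

variable {a z : ℂ}

theorem mobius_denom_ne_zero (ha : ‖a‖ < 1) (hz : ‖z‖ < 1) : 1 - (starRingEnd ℂ) a * z ≠ 0 := by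
  intro h
  have : ‖(starRingEnd ℂ) a * z‖ = 1 := by rw [← sub_eq_zero.1 h, norm_one]
  rw [norm_mul, RCLike.norm_conj] at this
  nlinarith [norm_nonneg a, norm_nonneg z]

theorem mobius_mem (ha : ‖a‖ < 1) (hz : ‖z‖ < 1) : ‖mobius a z‖ < 1 := by
  have hne := mobius_denom_ne_zero ha hz
  rw [mobius, norm_div, div_lt_one (norm_pos_iff.2 hne)]
  refine lt_of_pow_lt_pow_left₀ 2 (norm_nonneg _) ?_
  have h1 : ‖a‖ ^ 2 < 1 := by nlinarith [norm_nonneg a]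
  have h2 : ‖z‖ ^ 2 < 1 := by nlinarith [norm_nonneg z]
  rw [← Complex.normSq_eq_norm_sq] at h1 h2
  rw [← Complex.normSq_eq_norm_sq, ← Complex.normSq_eq_norm_sq]
  simp only [Complex.normSq_apply, Complex.sub_re, Complex.sub_im, Complex.mul_re, Complex.mul_im,
    Complex.conj_re, Complex.conj_im, Complex.one_re, Complex.one_im] at *
  nlinarith [mul_pos (sub_pos.2 h1) (sub_pos.2 h2)]

theorem mobius_neg_mobius (ha : ‖a‖ < 1) (hz : ‖z‖ < 1) : mobius (-a) (mobius a z) = z := by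
  have hne := mobius_denom_ne_zero ha hz
  have hne2 := mobius_denom_ne_zero (a := -a) (by simpa using ha) (mobius_mem ha hz)
  rw [mobius, div_eq_iff hne2]
  simp only [mobius, map_neg]
  have hne' : 1 - z * (starRingEnd ℂ) a ≠ 0 := by rwa [mul_comm]
  field_simp
  ring

theorem mobius_mobius_neg (ha : ‖a‖ < 1) (hz : ‖z‖ < 1) : mobius a (mobius (-a) z) = z := by
  have := mobius_neg_mobius (a := -a) (by simpa using ha) hz
  rwa [neg_neg] at this

theorem hasDerivAt_mobius (ha : ‖a‖ < 1) (hz : ‖z‖ < 1) :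
    HasDerivAt (mobius a) ((1 - (‖a‖ : ℂ) ^ 2) / (1 - (starRingEnd ℂ) a * z) ^ 2) z := by
  have hne := mobius_denom_ne_zero ha hz
  have := ((hasDerivAt_id z).sub_const a).div
    (((hasDerivAt_id z).const_mul ((starRingEnd ℂ) a)).const_sub 1) hne
  refine this.congr_deriv ?_
  rw [← Complex.conj_mul']
  simp only [id]
  ring

theorem differentiableOn_mobius (ha : ‖a‖ < 1) : DifferentiableOn ℂ (mobius a) (ball 0 1) :=
  fun _ hz =>
    (hasDerivAt_mobius ha (mem_ball_zero_iff.1 hz)).differentiableAt.differentiableWithinAt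

theorem NoHole.mobius {V : Set ℂ} (hV : NoHole V) (hVb : V ⊆ ball 0 1) (ha : ‖a‖ < 1) :
    NoHole (mobius a '' V) := by
  have ha' : ‖-a‖ < 1 := by simpa using ha
  have hm : ∀ {b : ℂ}, ‖b‖ < 1 → MapsTo (_root_.mobius b) (ball 0 1) (ball 0 1) := fun hb z hz =>
    mem_ball_zero_iff.2 (mobius_mem hb (mem_ball_zero_iff.1 hz))
  refine hV.image (ψ := _root_.mobius (-a)) (D := ball 0 1) (D' := ball 0 1) hVb isOpen_ball
    (hm ha) (hm ha') (differentiableOn_mobius ha).continuousOn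
    (differentiableOn_mobius ha').continuousOn
    (fun z hz => mobius_neg_mobius ha (mem_ball_zero_iff.1 hz))
    (fun z hz => mobius_mobius_neg ha (mem_ball_zero_iff.1 hz)) fun C hC _ hO => ?_
  exact NoHole.subset_ball (((hm ha).mono_left hVb).image_subset) hC hO

end mobius

/-- A holomorphic square root on an open set without holes avoiding the origin. -/
theorem NoHole.exists_sqrt {V : Set ℂ} (hV : NoHole V) (hVo : IsOpen V) (h0 : (0 : ℂ) ∉ V) :
    ∃ s : ℂ → ℂ, ContinuousOn s V ∧ ∀ z ∈ V, s z ^ 2 = z := by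
  have hloc : LocallyCompactSpace V := hVo.locallyCompactSpace
  let K : CompactExhaustion V := default
  have hs : ∀ n, ∃ s : ℂ → ℂ, ContinuousOn s ((↑) '' K n : Set ℂ) ∧
      ∀ z ∈ ((↑) '' K n : Set ℂ), s z ^ 2 = z := fun n => by
    obtain ⟨l, hl, he⟩ := hV.hasLogOn_sub hVo ((K.isCompact n).image continuous_subtype_val)
      (by rintro _ ⟨x, -, rfl⟩; exact x.2) h0
    refine ⟨fun z => Complex.exp (l z / 2), (hl.div_const 2).cexp, fun z hz => ?_⟩
    rw [← Complex.exp_nat_mul]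
    have := he z hz
    simp only [sub_zero] at this
    conv_rhs => rw [← this]
    congr 1
    push_cast
    ring
  choose s hsc hsq using hs
  let U : Ultrafilter ℕ := hyperfilter ℕ
  have hU : ∀ {p : ℕ → Prop}, (∀ᶠ n in atTop, p n) → ∀ᶠ n in (U : Filter ℕ), p n := fun h =>
    (by rw [← Nat.cofinite_eq_atTop] at h; exact hyperfilter_le_cofinite h)
  have hball : ∀ z ∈ V, ∃ r > 0, ball z r ⊆ V ∧ ∀ᶠ n in (U : Filter ℕ),
      ball z r ⊆ ((↑) '' K n : Set ℂ) := fun z hz => by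
    obtain ⟨n, hn⟩ := K.exists_mem_nhds ⟨z, hz⟩
    have : ((↑) '' K n : Set ℂ) ∈ 𝓝 z := by
      rw [← map_nhds_subtype_coe_eq_nhds hz (hVo.mem_nhds hz)]
      exact image_mem_map hn
    obtain ⟨r, hr, hb⟩ := Metric.mem_nhds_iff.1 this
    refine ⟨r, hr, fun x hx => ?_, hU ?_⟩
    · obtain ⟨y, -, rfl⟩ := hb hx
      exact y.2
    · filter_upwards [eventually_ge_atTop n] with m hm
      exact hb.trans (image_mono (K.subset hm))
  have hc : ∀ z ∈ V, ∃ c : ℂ, ∀ᶠ n in (U : Filter ℕ), s n z = c ∧ c ^ 2 = z := fun z hz => by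
    obtain ⟨r, hr, -, hb⟩ := hball z hz
    have hsq' : ∀ᶠ n in (U : Filter ℕ), s n z ^ 2 = z := by
      filter_upwards [hb] with n hn
      exact hsq n z (hn (mem_ball_self hr))
    obtain ⟨m, hm⟩ := hsq'.exists
    rcases U.em fun n => s n z = s m z with h | h
    · exact ⟨s m z, h.mono fun n hn => ⟨hn, hm⟩⟩
    · refine ⟨-s m z, ?_⟩
      filter_upwards [h, hsq'] with n hn hn2
      exact ⟨(sq_eq_sq_iff_eq_or_eq_neg.1 (hn2.trans hm.symm)).resolve_left hn, by
        rw [neg_sq, hm]⟩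
  choose! c hc using hc
  refine ⟨c, fun z hz => ContinuousAt.continuousWithinAt ?_, fun z hz =>
    (hc z hz).exists.choose_spec.2⟩
  obtain ⟨r, hr, hbV, hb⟩ := hball z hz
  obtain ⟨m, hm⟩ := hb.exists
  have hne : ∀ x ∈ ball z r, s m x ≠ 0 := fun x hx h => by
    have := hsq m x (hm hx)
    rw [h, zero_pow two_ne_zero] at this
    exact h0 (this ▸ hbV hx)
  have hquot : ∀ x ∈ ball z r, c x = c z / s m z * s m x := fun x hx => by
    have hz' := mem_ball_self (x := z) hr
    obtain ⟨n, hn, hnx, hnz⟩ := (hb.and ((hc x (hbV hx)).and (hc z hz))).exists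
    have := (convex_ball z r).isPreconnected.eq_of_forall_exists_int (f := fun y => s n y / s m y)
      (((hsc n).mono hn).div ((hsc m).mono hm) hne) (fun y hy => by
        rcases sq_eq_sq_iff_eq_or_eq_neg.1 ((hsq n y (hn hy)).trans (hsq m y (hm hy)).symm)
          with h | h
        · exact ⟨1, by simp only [h, div_self (hne y hy), Int.cast_one]⟩
        · exact ⟨-1, by simp only [h, neg_div, div_self (hne y hy), Int.cast_neg, Int.cast_one]⟩)
      hx hz'
    simp only [hnx.1, hnz.1] at this
    rw [← this, div_mul_cancel₀ _ (hne x hx)]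
  have hcont : ContinuousAt (fun x => c z / s m z * s m x) z :=
    continuousAt_const.mul (((hsc m).mono hm).continuousAt (ball_mem_nhds z hr))
  refine hcont.congr ?_
  filter_upwards [ball_mem_nhds z hr] with x hx
  exact (hquot x hx).symm

theorem isOpenMap_sq : IsOpenMap fun z : ℂ => z ^ 2 := by
  have : AnalyticOnNhd ℂ (fun z : ℂ => z ^ 2) univ := fun z _ => by fun_prop
  rcases this.is_constant_or_isOpen isPreconnected_univ with ⟨w, hw⟩ | h
  · have h0 := hw 0 (mem_univ _)
    have h1 := hw 1 (mem_univ _)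
    norm_num at h0 h1
    rw [← h0] at h1
    norm_num at h1
  · exact fun s hs => h s (subset_univ _) hs

/-- The image of an open set under a branch of the square root is open and has no holes. -/
theorem NoHole.image_sqrt {V : Set ℂ} (hV : NoHole V) (hVo : IsOpen V) (hVc : IsPreconnected V)
    (h0 : (0 : ℂ) ∉ V) {s : ℂ → ℂ} (hs : ContinuousOn s V) (hsq : ∀ z ∈ V, s z ^ 2 = z) :
    IsOpen (s '' V) ∧ NoHole (s '' V) := by
  have hs0 : ∀ z ∈ V, s z ≠ 0 := fun z hz h => by
    have := hsq z hz
    rw [h, zero_pow two_ne_zero] at this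
    exact h0 (this ▸ hz)
  have hWo : IsOpen (s '' V) := by
    have hE : IsOpen {q : ℂ | q ^ 2 ∈ V} := hVo.preimage (by fun_prop)
    have hcont : ContinuousOn (fun q : ℂ => ‖s (q ^ 2) + q‖) {q : ℂ | q ^ 2 ∈ V} :=
      ((hs.comp (continuous_pow 2).continuousOn fun q hq => hq).add continuousOn_id).norm
    have := hcont.isOpen_inter_preimage hE isOpen_Ioi (t := Ioi 0)
    convert this using 1
    ext q
    constructor
    · rintro ⟨z, hz, rfl⟩
      refine ⟨by simpa only [mem_ofPred_eq, hsq z hz] using hz, ?_⟩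
      simp only [mem_preimage, hsq z hz, mem_Ioi, norm_pos_iff]
      rw [← two_mul]
      exact mul_ne_zero two_ne_zero (hs0 z hz)
    · rintro ⟨hq, hpos⟩
      simp only [mem_preimage, mem_Ioi, norm_pos_iff] at hpos
      refine ⟨q ^ 2, hq, ?_⟩
      rcases sq_eq_sq_iff_eq_or_eq_neg.1 (hsq _ hq) with h | h
      · exact h
      · exact absurd (by rw [h, neg_add_cancel]) hpos
  refine ⟨hWo, fun C hC hd hO => ?_⟩
  have hnegc : IsPreconnected ((fun z => -s z) '' V) := hVc.image _ hs.neg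
  have hnegd : Disjoint ((fun z => -s z) '' V) (s '' V) := by
    rw [Set.disjoint_left]
    rintro _ ⟨z, hz, rfl⟩ ⟨w, hw, hwz⟩
    have : z = w := by rw [← hsq z hz, ← hsq w hw, hwz, neg_sq]
    subst this
    exact hs0 z hz (self_eq_neg.1 hwz)
  have hneg : (fun z => -s z) '' V = Neg.neg '' (s '' V) := by rw [image_image]
  by_cases hdC : Disjoint C ((fun z => -s z) '' V)
  · have hCV : Disjoint ((fun z => z ^ 2) '' C) V := by
      rw [Set.disjoint_left]
      rintro _ ⟨q, hq, rfl⟩ hqV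
      rcases sq_eq_sq_iff_eq_or_eq_neg.1 (hsq _ hqV) with h | h
      · exact Set.disjoint_left.1 hd hq ⟨_, hqV, h⟩
      · exact Set.disjoint_left.1 hdC hq ⟨_, hqV, by simp only [h, neg_neg]⟩
    have hVW : (fun z : ℂ => z ^ 2) '' (s '' V) = V := by
      rw [image_image]
      ext x
      constructor
      · rintro ⟨y, hy, rfl⟩
        simpa only [hsq y hy] using hy
      · exact fun hx => ⟨x, hx, hsq x hx⟩
    have := hV _ (hC.image (by fun_prop)) hCV (by
      have := isOpenMap_sq _ hO
      rwa [image_union, hVW] at this)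
    exact image_eq_empty.1 this
  · obtain ⟨x, hxC, hxN⟩ := Set.not_disjoint_iff.1 hdC
    have hsub : (fun z => -s z) '' V ⊆ C := by
      intro y hy
      by_contra hyC
      obtain ⟨p, hp, hp1, hp2⟩ := hnegc Cᶜ (C ∪ s '' V) hC.isClosed.isOpen_compl hO
        (fun p _ => by by_cases h : p ∈ C <;> simp [h]) ⟨y, hy, hyC⟩ ⟨x, hxN, Or.inl hxC⟩
      exact hp2.elim hp1 (Set.disjoint_left.1 hnegd hp)
    have hsub' : s '' V ⊆ Neg.neg '' C := by
      rintro _ ⟨z, hz, rfl⟩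
      exact ⟨-s z, hsub ⟨z, hz, rfl⟩, neg_neg _⟩
    have hOn : IsOpen (Neg.neg '' (C ∪ s '' V)) := (Homeomorph.neg ℂ).isOpenMap _ hO
    have htot : C ∪ Neg.neg '' C = (C ∪ s '' V) ∪ Neg.neg '' (C ∪ s '' V) := by
      rw [image_union, ← hneg]
      ext p
      constructor
      · rintro (h | h)
        exacts [Or.inl (Or.inl h), Or.inr (Or.inl h)]
      · rintro ((h | h) | (h | h))
        exacts [Or.inl h, Or.inr (hsub' h), Or.inr h, Or.inl (hsub h)]
    have := (hC.union (hC.image continuous_neg)).eq_empty_of_isOpen (htot ▸ hO.union hOn)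
    exact (union_empty_iff.1 this).1

theorem isOpen_image_mobius {a : ℂ} (ha : ‖a‖ < 1) {V : Set ℂ} (hV : IsOpen V)
    (hVb : V ⊆ ball 0 1) : IsOpen (mobius a '' V) := by
  have ha' : ‖-a‖ < 1 := by simpa using ha
  have : mobius a '' V = ball 0 1 ∩ mobius (-a) ⁻¹' V := by
    ext x
    constructor
    · rintro ⟨y, hy, rfl⟩
      have hy1 := mem_ball_zero_iff.1 (hVb hy)
      exact ⟨mem_ball_zero_iff.2 (mobius_mem ha hy1), by
        rwa [mem_preimage, mobius_neg_mobius ha hy1]⟩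
    · rintro ⟨hx, hxV⟩
      exact ⟨_, hxV, mobius_mobius_neg ha (mem_ball_zero_iff.1 hx)⟩
  rw [this]
  exact (differentiableOn_mobius ha').continuousOn.isOpen_inter_preimage isOpen_ball hV

/-- Biholomorphic maps `f : U → V`, with inverse `g`, onto subsets of the unit disc
without holes. -/
structure IsDiscChart (U : Set ℂ) (z₀ : ℂ) (f g : ℂ → ℂ) (V : Set ℂ) : Prop where
  isOpen : IsOpen V
  subset : V ⊆ ball 0 1
  noHole : NoHole V
  diff : DifferentiableOn ℂ f U
  diff_inv : DifferentiableOn ℂ g V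
  mapsTo : MapsTo f U V
  mapsTo_inv : MapsTo g V U
  left_inv : LeftInvOn g f U
  right_inv : LeftInvOn f g V
  map_zero : f z₀ = 0

theorem IsDiscChart.image_eq {U V : Set ℂ} {z₀ : ℂ} {f g : ℂ → ℂ} (h : IsDiscChart U z₀ f g V) :
    f '' U = V := by
  ext x
  constructor
  · rintro ⟨y, hy, rfl⟩
    exact h.mapsTo hy
  · exact fun hx => ⟨g x, h.mapsTo_inv hx, h.right_inv hx⟩

/-- The Koebe step of the Riemann mapping theorem. -/
theorem IsDiscChart.koebe {U V : Set ℂ} {z₀ : ℂ} {f g : ℂ → ℂ} (h : IsDiscChart U z₀ f g V)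
    (hUo : IsOpen U) (hU : IsPreconnected U) (hz₀ : z₀ ∈ U) {w : ℂ} (hw : ‖w‖ < 1) (hwV : w ∉ V) :
    ∃ f' g' V', IsDiscChart U z₀ f' g' V' ∧
      ‖deriv f' z₀‖ = (1 + ‖w‖) / (2 * √‖w‖) * ‖deriv f z₀‖ := by
  have hw' : ‖-w‖ < 1 := by simpa using hw
  have hVball : ∀ {x}, x ∈ V → ‖x‖ < 1 := fun hx => mem_ball_zero_iff.1 (h.subset hx)
  have hVc : IsPreconnected V := h.image_eq ▸ hU.image f h.diff.continuousOn
  have hV0 : (0 : ℂ) ∈ V := by simpa [h.map_zero] using h.mapsTo hz₀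
  have hw0 : w ≠ 0 := fun h0 => hwV (h0 ▸ hV0)
  set V₁ := mobius w '' V with hV₁
  have hV₁o : IsOpen V₁ := isOpen_image_mobius hw h.isOpen h.subset
  have hV₁b : V₁ ⊆ ball 0 1 := by
    rintro _ ⟨x, hx, rfl⟩
    exact mem_ball_zero_iff.2 (mobius_mem hw (hVball hx))
  have hV₁c : IsPreconnected V₁ :=
    hVc.image _ ((differentiableOn_mobius hw).continuousOn.mono h.subset)
  have hV₁n : NoHole V₁ := h.noHole.mobius h.subset hw
  have hV₁0 : (0 : ℂ) ∉ V₁ := by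
    rintro ⟨x, hx, hx0⟩
    rw [mobius, div_eq_zero_iff] at hx0
    rcases hx0 with hx0 | hx0
    · exact hwV (by rwa [← sub_eq_zero.1 hx0])
    · exact mobius_denom_ne_zero hw (hVball hx) hx0
  obtain ⟨s, hs, hsq⟩ := hV₁n.exists_sqrt hV₁o hV₁0
  obtain ⟨hV₂o, hV₂n⟩ := hV₁n.image_sqrt hV₁o hV₁c hV₁0 hs hsq
  have hs1 : ∀ z ∈ V₁, ‖s z‖ < 1 := fun z hz => by
    have h1 := mem_ball_zero_iff.1 (hV₁b hz)
    rw [← hsq z hz, norm_pow] at h1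
    nlinarith [norm_nonneg (s z)]
  have hs0 : ∀ z ∈ V₁, s z ≠ 0 := fun z hz h0 => by
    have := hsq z hz
    rw [h0, zero_pow two_ne_zero] at this
    exact hV₁0 (this ▸ hz)
  have hsd : ∀ z ∈ V₁, HasDerivAt s (2 * s z)⁻¹ z := fun z hz => by
    refine HasDerivAt.of_local_left_inverse (hs.continuousAt (hV₁o.mem_nhds hz)) ?_
      (mul_ne_zero two_ne_zero (hs0 z hz)) (f := fun q => q ^ 2) ?_
    · simpa using hasDerivAt_pow 2 (s z)
    · filter_upwards [hV₁o.mem_nhds hz] with x hx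
      exact hsq x hx
  have hV₂b : s '' V₁ ⊆ ball 0 1 := by
    rintro _ ⟨x, hx, rfl⟩
    exact mem_ball_zero_iff.2 (hs1 x hx)
  have hmob0 : mobius w 0 = -w := by simp [mobius]
  have hnwV₁ : -w ∈ V₁ := ⟨0, hV0, hmob0⟩
  set b := s (-w) with hb
  have hb1 : ‖b‖ < 1 := hs1 _ hnwV₁
  have hb1' : ‖-b‖ < 1 := by simpa using hb1
  have hbsq : ‖b‖ ^ 2 = ‖w‖ := by rw [← norm_pow, hb, hsq _ hnwV₁, norm_neg]
  have hb0 : b ≠ 0 := hs0 _ hnwV₁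
  have hm1 : ∀ z ∈ U, mobius w (f z) ∈ V₁ := fun z hz => ⟨_, h.mapsTo hz, rfl⟩
  have hder : ∀ z ∈ U, DifferentiableAt ℂ f z := fun z hz =>
    h.diff.differentiableAt (hUo.mem_nhds hz)
  have hderf : ∀ z ∈ U, HasDerivAt (fun z => mobius b (s (mobius w (f z))))
      ((1 - (‖b‖ : ℂ) ^ 2) / (1 - (starRingEnd ℂ) b * s (mobius w (f z))) ^ 2 *
        ((2 * s (mobius w (f z)))⁻¹ *
          ((1 - (‖w‖ : ℂ) ^ 2) / (1 - (starRingEnd ℂ) w * f z) ^ 2 * deriv f z))) z := fun z hz =>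
    HasDerivAt.comp z (h₂ := mobius b) (hasDerivAt_mobius hb1 (hs1 _ (hm1 z hz)))
      (HasDerivAt.comp z (h₂ := s) (hsd _ (hm1 z hz))
        (HasDerivAt.comp z (h₂ := mobius w) (hasDerivAt_mobius hw (hVball (h.mapsTo hz)))
          (hder z hz).hasDerivAt))
  have hback : ∀ x ∈ mobius b '' (s '' V₁), ∃ y ∈ V, x = mobius b (s (mobius w y)) ∧
      mobius (-w) (mobius (-b) x ^ 2) = y ∧ ‖x‖ < 1 := by
    rintro _ ⟨_, ⟨_, ⟨y, hy, rfl⟩, rfl⟩, rfl⟩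
    refine ⟨y, hy, rfl, ?_, mobius_mem hb1 (hs1 _ ⟨y, hy, rfl⟩)⟩
    rw [mobius_neg_mobius hb1 (hs1 _ ⟨y, hy, rfl⟩), hsq _ ⟨y, hy, rfl⟩,
      mobius_neg_mobius hw (hVball hy)]
  refine ⟨fun z => mobius b (s (mobius w (f z))), fun x => g (mobius (-w) (mobius (-b) x ^ 2)),
    mobius b '' (s '' V₁), ⟨isOpen_image_mobius hb1 hV₂o hV₂b, ?_, hV₂n.mobius hV₂b hb1, ?_, ?_,
    ?_, ?_, ?_, ?_, ?_⟩, ?_⟩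
  · rintro _ ⟨x, hx, rfl⟩
    exact mem_ball_zero_iff.2 (mobius_mem hb1 (mem_ball_zero_iff.1 (hV₂b hx)))
  · exact fun z hz => (hderf z hz).differentiableAt.differentiableWithinAt
  · have hd1 : DifferentiableOn ℂ (fun x => mobius (-b) x ^ 2) (ball 0 1) :=
      (differentiableOn_mobius hb1').pow 2
    have hd2 : DifferentiableOn ℂ (fun x => mobius (-w) (mobius (-b) x ^ 2)) (ball 0 1) :=
      (differentiableOn_mobius hw').comp hd1 fun x hx => by
        have := mobius_mem hb1' (mem_ball_zero_iff.1 hx)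
        rw [mem_ball_zero_iff, norm_pow]
        nlinarith [norm_nonneg (mobius (-b) x)]
    refine h.diff_inv.comp (hd2.mono ?_) ?_
    · intro x hx
      obtain ⟨y, -, -, -, h1⟩ := hback x hx
      exact mem_ball_zero_iff.2 h1
    · intro x hx
      obtain ⟨y, hy, -, h1, -⟩ := hback x hx
      simpa only [h1] using hy
  · exact fun z hz => ⟨_, ⟨_, hm1 z hz, rfl⟩, rfl⟩
  · intro x hx
    obtain ⟨y, hy, -, h1, -⟩ := hback x hx
    simp only [h1]
    exact h.mapsTo_inv hy
  · intro z hz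
    simp only
    rw [mobius_neg_mobius hb1 (hs1 _ (hm1 z hz)), hsq _ (hm1 z hz),
      mobius_neg_mobius hw (hVball (h.mapsTo hz)), h.left_inv hz]
  · intro x hx
    obtain ⟨y, hy, h0, h1, -⟩ := hback x hx
    simp only [h1]
    rw [h.right_inv hy, h0]
  · simp only [h.map_zero, hmob0]
    rw [← hb, mobius, sub_self, zero_div]
  · rw [(hderf z₀ hz₀).deriv]
    simp only [h.map_zero, hmob0, ← hb, norm_mul, mul_zero, sub_zero, one_pow, div_one]
    rw [Complex.conj_mul', norm_div, norm_inv, norm_mul, norm_pow]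
    have h2 : (1 - (‖b‖ : ℂ) ^ 2) = ((1 - ‖w‖ : ℝ) : ℂ) := by
      rw [← hbsq]; push_cast; ring
    have h3 : (1 - (‖w‖ : ℂ) ^ 2) = ((1 - ‖w‖ ^ 2 : ℝ) : ℂ) := by push_cast; ring
    have hbn : √‖w‖ = ‖b‖ := by rw [← hbsq, Real.sqrt_sq (norm_nonneg _)]
    have h4 : 0 < 1 - ‖w‖ := by linarith
    have h5 : 0 ≤ 1 - ‖w‖ ^ 2 := by nlinarith [norm_nonneg w]
    have h6 : 0 < ‖b‖ := norm_pos_iff.2 hb0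
    rw [h2, h3, Complex.norm_real, Complex.norm_real, Real.norm_of_nonneg h4.le,
      Real.norm_of_nonneg h5, hbn, Complex.norm_ofNat]
    field_simp
    ring

/-- Hurwitz's theorem: a zero of a nonconstant uniform limit is a limit of zeros. -/
theorem hurwitz {ι : Type*} {l : Filter ι} {G : ι → ℂ → ℂ} {g : ℂ → ℂ} {ζ p : ℂ} {r : ℝ}
    (hr : 0 < r) (hG : ∀ᶠ n in l, DifferentiableOn ℂ (G n) (ball ζ r))
    (hu : TendstoUniformlyOn G g l (ball ζ r)) (hg : DifferentiableOn ℂ g (ball ζ r))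
    (hp : g ζ = p) (hne : ∃ᶠ z in 𝓝 ζ, g z ≠ p) :
    ∀ᶠ n in l, ∃ w ∈ ball ζ r, G n w = p := by
  have han : AnalyticAt ℂ (fun z => g z - p) ζ :=
    (hg.analyticAt (ball_mem_nhds ζ hr)).sub analyticAt_const
  have hiso : ∀ᶠ z in 𝓝[≠] ζ, g z - p ≠ 0 := by
    refine han.eventually_eq_zero_or_eventually_ne_zero.resolve_left fun h => hne ?_
    filter_upwards [h] with z hz
    simpa [sub_eq_zero] using hz
  obtain ⟨ρ, hρ, hρ'⟩ := Metric.mem_nhds_iff.1 (mem_nhdsWithin_iff_exists_mem_nhds_inter.1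
    hiso).choose_spec.1
  have hiso' := (mem_nhdsWithin_iff_exists_mem_nhds_inter.1 hiso).choose_spec.2
  set δ := min ρ r / 2 with hδ
  have hδ0 : 0 < δ := by positivity
  have hδρ : δ < ρ := by
    have := min_le_left ρ r
    rw [hδ]; linarith [lt_min hρ hr]
  have hδr : δ < r := by
    have := min_le_right ρ r
    rw [hδ]; linarith [lt_min hρ hr]
  have hsub : closedBall ζ δ ⊆ ball ζ r := closedBall_subset_ball hδr
  have hcont : ContinuousOn (fun z => ‖g z - p‖) (sphere ζ δ) :=
    ((hg.continuousOn.mono (sphere_subset_closedBall.trans hsub)).sub continuousOn_const).norm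
  obtain ⟨z₁, hz₁, hmin⟩ := (isCompact_sphere ζ δ).exists_isMinOn
    (NormedSpace.sphere_nonempty.2 hδ0.le) hcont
  have hm : 0 < ‖g z₁ - p‖ := by
    refine norm_pos_iff.2 (hiso' ⟨hρ' ?_, ?_⟩)
    · rw [mem_ball, mem_sphere.1 hz₁]; exact hδρ
    · intro h
      rw [mem_singleton_iff.1 h, mem_sphere, dist_self] at hz₁
      exact hδ0.ne hz₁
  set m := ‖g z₁ - p‖
  filter_upwards [hG, Metric.tendstoUniformlyOn_iff.1 hu (m / 3) (by positivity)] with n hn hun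
  by_contra! hno
  have hdc : DiffContOnCl ℂ (fun z => (G n z - p)⁻¹) (ball ζ δ) := by
    refine DifferentiableOn.diffContOnCl ?_
    rw [closure_ball ζ hδ0.ne']
    exact ((hn.mono hsub).sub_const p).inv fun z hz => sub_ne_zero.2 (hno z (hsub hz))
  have hbd := Complex.norm_le_of_forall_mem_frontier_norm_le isBounded_ball hdc
    (C := (2 * m / 3)⁻¹) (fun z hz => by
      rw [frontier_ball ζ hδ0.ne'] at hz
      rw [norm_inv]
      refine inv_anti₀ (by positivity) ?_
      have h1 : m ≤ ‖g z - p‖ := hmin hz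
      have h2 := hun z (hsub (sphere_subset_closedBall hz))
      rw [dist_eq_norm] at h2
      have h3 : ‖g z - p‖ ≤ ‖g z - G n z‖ + ‖G n z - p‖ := norm_sub_le_norm_sub_add_norm_sub _ _ _
      linarith) (subset_closure (mem_ball_self hδ0))
  have h2 := hun ζ (mem_ball_self hr)
  rw [dist_eq_norm, hp, norm_sub_rev] at h2
  have hpos : 0 < ‖G n ζ - p‖ := norm_pos_iff.2 (sub_ne_zero.2 (hno ζ (mem_ball_self hr)))
  rw [norm_inv] at hbd
  have := (inv_le_inv₀ hpos (by positivity)).1 hbd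
  linarith

/-- Montel's theorem along an ultrafilter. -/
theorem montel {ι : Type*} {l : Ultrafilter ι} {F : ι → ℂ → ℂ} {O : Set ℂ} {M : ℝ}
    (h : ∀ z ∈ O, ∃ r > 0, ∀ᶠ n in (l : Filter ι), DifferentiableOn ℂ (F n) (ball z r) ∧
      ∀ w ∈ ball z r, ‖F n w‖ ≤ M) :
    ∃ f : ℂ → ℂ, ∀ z ∈ O, ∃ r > 0, DifferentiableOn ℂ f (ball z r) ∧
      TendstoUniformlyOn F f l (ball z r) ∧
      ∀ᶠ n in (l : Filter ι), DifferentiableOn ℂ (F n) (ball z r) := by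
  have hpt : ∀ z, (∃ r > 0, ∀ᶠ n in (l : Filter ι), ∀ w ∈ ball z r, ‖F n w‖ ≤ M) →
      ∃ c, Tendsto (fun n => F n z) l (𝓝 c) := by
    rintro z ⟨r, hr, hb⟩
    have : (l.map fun n => F n z : Filter ℂ) ≤ 𝓟 (closedBall 0 M) := by
      rw [le_principal_iff]
      exact (hb.mono fun n hn => by simpa using hn z (mem_ball_self hr) :
        ∀ᶠ n in (l : Filter ι), F n z ∈ closedBall 0 M)
    obtain ⟨c, -, hc⟩ := (isCompact_closedBall (0 : ℂ) M).ultrafilter_le_nhds (l.map fun n => F n z)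
      this
    exact ⟨c, hc⟩
  choose! f hf using hpt
  refine ⟨f, fun z hz => ?_⟩
  obtain ⟨r, hr, hb⟩ := h z hz
  have hft : ∀ w ∈ ball z r, Tendsto (fun n => F n w) l (𝓝 (f w)) := fun w hw => by
    obtain ⟨δ, hδ, hsub⟩ := Metric.isOpen_iff.1 isOpen_ball w hw
    exact hf w ⟨δ, hδ, hb.mono fun n hn x hx => hn.2 x (hsub hx)⟩
  have hM : 0 ≤ M := by
    obtain ⟨n, hn⟩ := hb.exists
    exact (norm_nonneg _).trans (hn.2 z (mem_ball_self hr))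
  -- equicontinuity from the Schwarz lemma
  have hlip : ∀ᶠ n in (l : Filter ι), ∀ x ∈ ball z (r / 2), ∀ y ∈ ball x (r / 2),
      dist (F n y) (F n x) ≤ (2 * M) / (r / 2) * dist y x := by
    filter_upwards [hb] with n hn x hx y hy
    have hsub : ball x (r / 2) ⊆ ball z r := ball_subset_ball' (by
      rw [mem_ball] at hx; linarith)
    refine Complex.dist_le_div_mul_dist_of_mapsTo_ball (hn.1.mono hsub) (fun u hu => ?_) hy
    rw [mem_closedBall, dist_eq_norm]
    refine (norm_sub_le _ _).trans ?_
    have h1 := hn.2 u (hsub hu)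
    have h2 := hn.2 x (hsub (mem_ball_self (by positivity)))
    linarith
  have hlipf : ∀ x ∈ ball z (r / 2), ∀ y ∈ ball z (r / 2), y ∈ ball x (r / 2) →
      dist (f y) (f x) ≤ (2 * M) / (r / 2) * dist y x := fun x hx y hy hyx => by
    have hsub : ball z (r / 2) ⊆ ball z r := ball_subset_ball (by linarith)
    refine le_of_tendsto ((hft y (hsub hy)).dist (hft x (hsub hx))) ?_
    filter_upwards [hlip] with n hn
    exact hn x hx y hyx
  set L := (2 * M) / (r / 2)
  have hL : 0 ≤ L := by positivity
  have hunif : TendstoUniformlyOn F f l (ball z (r / 2)) := by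
    rw [Metric.tendstoUniformlyOn_iff]
    intro ε hε
    set η := min (r / 2) (ε / (4 * (L + 1)))
    have hη : 0 < η := by positivity
    have hηL : L * η ≤ ε / 4 := by
      calc L * η ≤ (L + 1) * (ε / (4 * (L + 1))) := by
            gcongr
            · linarith
            · exact min_le_right _ _
        _ = ε / 4 := by field_simp
    obtain ⟨t, htsub, htfin, htc⟩ := Metric.finite_approx_of_totallyBounded
      ((isCompact_closedBall z (r / 2)).totallyBounded.subset ball_subset_closedBall) η hη
    have hall : ∀ᶠ n in (l : Filter ι), ∀ c ∈ t, dist (f c) (F n c) < ε / 4 := by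
      rw [eventually_all_finite htfin]
      intro c hc
      have := hft c (ball_subset_ball (by linarith) (htsub hc))
      filter_upwards [Metric.tendsto_nhds.1 this (ε / 4) (by positivity)] with n hn
      rwa [dist_comm]
    filter_upwards [hall, hlip] with n hn hln w hw
    obtain ⟨c, hc, hwc⟩ := mem_iUnion₂.1 (htc hw)
    have hwc' : w ∈ ball c (r / 2) := ball_subset_ball (min_le_left _ _) hwc
    have h1 := hlipf c (htsub hc) w hw hwc'
    have h2 := hn c hc
    have h3 := hln c (htsub hc) w hwc'
    have h4 : L * dist w c ≤ ε / 4 :=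
      (mul_le_mul_of_nonneg_left (mem_ball.1 hwc).le hL).trans hηL
    have h5 := dist_triangle4 (f w) (f c) (F n c) (F n w)
    rw [dist_comm (F n c)] at h5
    linarith
  have hdiff : ∀ᶠ n in (l : Filter ι), DifferentiableOn ℂ (F n) (ball z (r / 2)) :=
    hb.mono fun n hn => hn.1.mono (ball_subset_ball (by linarith))
  exact ⟨r / 2, by positivity, hunif.tendstoLocallyUniformlyOn.differentiableOn hdiff isOpen_ball,
    hunif, hdiff⟩

theorem TendstoUniformlyOn.tendsto_comp_ball {ι : Type*} {l : Filter ι} {F : ι → ℂ → ℂ} {f : ℂ → ℂ}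
    {z : ℂ} {r : ℝ} (hr : 0 < r) (h : TendstoUniformlyOn F f l (ball z r))
    (hf : DifferentiableOn ℂ f (ball z r)) {x : ι → ℂ} (hx : Tendsto x l (𝓝 z)) :
    Tendsto (fun n => F n (x n)) l (𝓝 (f z)) := by
  have hfc : ContinuousAt f z := (hf.differentiableAt (ball_mem_nhds z hr)).continuousAt
  rw [Metric.tendsto_nhds]
  intro ε hε
  filter_upwards [Metric.tendstoUniformlyOn_iff.1 h (ε / 2) (by positivity),
    hx.eventually (ball_mem_nhds z hr),
    hx.eventually (Metric.tendsto_nhds.1 hfc (ε / 2) (by positivity))] with n h1 h2 h3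
  have h4 := h1 _ h2
  have h5 := dist_triangle (F n (x n)) (f (x n)) (f z)
  rw [dist_comm (F n (x n)) (f (x n))] at h5
  linarith

theorem IsDiscChart.exists_of_isBounded {U : Set ℂ} {z₀ : ℂ} (hUo : IsOpen U) (hUn : NoHole U)
    (hUb : Bornology.IsBounded U) : ∃ f g V, IsDiscChart U z₀ f g V ∧ 0 < ‖deriv f z₀‖ := by
  obtain ⟨R, hR0, hR⟩ := hUb.subset_ball_lt 0 z₀
  have hRc : (R : ℂ) ≠ 0 := by exact_mod_cast hR0.ne'
  have himg : (fun z => (z - z₀) / R) '' U = (fun z => R * z + z₀) ⁻¹' U := by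
    ext x
    constructor
    · rintro ⟨y, hy, rfl⟩
      rw [mem_preimage, mul_div_cancel₀ _ hRc]
      simpa using hy
    · intro hx
      exact ⟨_, hx, by field_simp; ring⟩
  have hd : ∀ z, HasDerivAt (fun z : ℂ => (z - z₀) / R) (1 / R) z := fun z =>
    ((hasDerivAt_id z).sub_const z₀).div_const _
  refine ⟨fun z => (z - z₀) / R, fun z => R * z + z₀, (fun z => (z - z₀) / R) '' U,
    ⟨?_, ?_, ?_, ?_, ?_, mapsTo_image _ _, ?_, ?_, ?_, by simp⟩, ?_⟩
  · rw [himg]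
    exact hUo.preimage (by fun_prop)
  · rintro _ ⟨z, hz, rfl⟩
    have := mem_ball.1 (hR hz)
    rw [dist_eq_norm] at this
    rw [mem_ball_zero_iff, norm_div, Complex.norm_real, Real.norm_of_nonneg hR0.le,
      div_lt_one hR0]
    exact this
  · exact hUn.image (D := univ) (D' := univ) (subset_univ _) isOpen_univ (mapsTo_univ _ _)
      (mapsTo_univ (fun z => R * z + z₀) _) (by fun_prop) (by fun_prop)
      (fun z _ => by field_simp; ring) (fun z _ => by field_simp; ring)
      fun C _ _ _ => subset_univ C
  · exact fun z _ => (hd z).differentiableAt.differentiableWithinAt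
  · fun_prop
  · rw [himg]; exact fun z hz => hz
  · intro z _; simp only; field_simp; ring
  · intro z _; simp only; field_simp; ring
  · rw [(hd z₀).deriv]
    simpa using hR0.ne'

/-- The Riemann mapping theorem for bounded domains. -/
theorem riemann_mapping {U : Set ℂ} (hUo : IsOpen U) (hU : IsPreconnected U)
    (hUb : Bornology.IsBounded U) (hUn : NoHole U) {z₀ : ℂ} (hz₀ : z₀ ∈ U) :
    ∃ f g : ℂ → ℂ, DifferentiableOn ℂ f U ∧ DifferentiableOn ℂ g (ball 0 1) ∧
      MapsTo f U (ball 0 1) ∧ MapsTo g (ball 0 1) U ∧ LeftInvOn g f U ∧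
      LeftInvOn f g (ball 0 1) := by
  obtain ⟨f₀, g₀, V₀, h₀, hd₀⟩ := IsDiscChart.exists_of_isBounded (z₀ := z₀) hUo hUn hUb
  obtain ⟨r₀, hr₀, hr₀U⟩ := Metric.isOpen_iff.1 hUo z₀ hz₀
  set S : Set ℝ := {d | ∃ f g V, IsDiscChart U z₀ f g V ∧ ‖deriv f z₀‖ = d} with hS
  have hSb : BddAbove S := by
    refine ⟨1 / r₀, ?_⟩
    rintro _ ⟨f, g, V, h, rfl⟩
    refine Complex.norm_deriv_le_div_of_mapsTo_ball (h.diff.mono hr₀U) (fun z hz => ?_) hr₀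
    rw [h.map_zero]
    exact ball_subset_closedBall (h.subset (h.mapsTo (hr₀U hz)))
  set s := sSup S with hs
  have hs0 : 0 < s := hd₀.trans_le (le_csSup hSb ⟨_, _, _, h₀, rfl⟩)
  have hex : ∀ n : ℕ, ∃ f g V, IsDiscChart U z₀ f g V ∧ s * (1 - 1 / (n + 1)) < ‖deriv f z₀‖ := by
    intro n
    obtain ⟨_, ⟨f, g, V, h, rfl⟩, hlt⟩ := exists_lt_of_lt_csSup (s := S) ⟨_, _, _, _, h₀, rfl⟩
      (show s * (1 - 1 / ((n : ℝ) + 1)) < sSup S by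
        rw [← hs]
        have : 0 < 1 / ((n : ℝ) + 1) := by positivity
        nlinarith)
    exact ⟨f, g, V, h, hlt⟩
  choose F G V hch hder using hex
  have hlim : Tendsto (fun n : ℕ => s * (1 - 1 / ((n : ℝ) + 1))) atTop (𝓝 (s * (1 - 0))) :=
    (tendsto_one_div_add_atTop_nhds_zero_nat.const_sub 1).const_mul s
  have hball : ∀ ρ < 1, ∀ᶠ n in atTop, ball 0 ρ ⊆ V n := by
    intro ρ hρ
    rcases le_or_gt ρ 0 with hρ0 | hρ0
    · exact Eventually.of_forall fun n => by simp [ball_eq_empty.2 hρ0]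
    have hsq0 : 0 < √ρ := Real.sqrt_pos.2 hρ0
    have hsq1 : √ρ < 1 := by rw [Real.sqrt_lt' one_pos]; simpa using hρ
    have hsqs : √ρ ^ 2 = ρ := Real.sq_sqrt hρ0.le
    have hκ : s * (2 * √ρ / (1 + ρ)) < s * (1 - 0) := by
      rw [sub_zero]
      refine mul_lt_mul_of_pos_left ?_ hs0
      rw [div_lt_one (by linarith)]
      nlinarith [sq_pos_of_pos (sub_pos.2 hsq1)]
    filter_upwards [hlim.eventually (lt_mem_nhds hκ)] with n hn w hw
    by_contra hwV
    rw [mem_ball_zero_iff] at hw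
    have hV0 : (0 : ℂ) ∈ V n := by simpa [(hch n).map_zero] using (hch n).mapsTo hz₀
    have hw0 : 0 < ‖w‖ := norm_pos_iff.2 fun h => hwV (h ▸ hV0)
    obtain ⟨f', g', V', h', hd'⟩ := (hch n).koebe hUo hU hz₀ (hw.trans hρ) hwV
    have hle : (1 + ‖w‖) / (2 * √‖w‖) * ‖deriv (F n) z₀‖ ≤ s :=
      le_csSup hSb ⟨_, _, _, h', hd'⟩
    have h1 : s * (2 * √ρ / (1 + ρ)) < ‖deriv (F n) z₀‖ := hn.trans (hder n)
    have hw1 : 0 < √‖w‖ := Real.sqrt_pos.2 hw0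
    have hw2 : √‖w‖ < √ρ := Real.sqrt_lt_sqrt hw0.le hw
    have hw3 : √‖w‖ ^ 2 = ‖w‖ := Real.sq_sqrt hw0.le
    rw [← hw3] at hle
    rw [← hsqs] at h1
    rw [Real.sqrt_sq hw1.le] at hle
    rw [Real.sqrt_sq hsq0.le] at h1
    set x := √‖w‖
    set y := √ρ
    have h2 : (1 + y ^ 2) / (2 * y) ≤ (1 + x ^ 2) / (2 * x) := by
      rw [div_le_div_iff₀ (by positivity) (by positivity)]
      have : x * y ≤ 1 := by nlinarith
      nlinarith [mul_nonneg (sub_nonneg.2 hw2.le) (sub_nonneg.2 this)]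
    have h3 : (1 + y ^ 2) / (2 * y) * (s * (2 * y / (1 + y ^ 2))) = s := by field_simp
    have h4 : (1 + y ^ 2) / (2 * y) * (s * (2 * y / (1 + y ^ 2))) <
        (1 + y ^ 2) / (2 * y) * ‖deriv (F n) z₀‖ := by gcongr
    have h5 := mul_le_mul_of_nonneg_right h2 (norm_nonneg (deriv (F n) z₀))
    linarith
  set l := hyperfilter ℕ
  have hl : (l : Filter ℕ) ≤ atTop := Nat.hyperfilter_le_atTop
  obtain ⟨M, hM⟩ := hUb.exists_norm_le
  obtain ⟨f, hf⟩ := montel (l := l) (F := F) (O := U) (M := 1) fun z hz => by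
    obtain ⟨r, hr, hrU⟩ := Metric.isOpen_iff.1 hUo z hz
    exact ⟨r, hr, Eventually.of_forall fun n => ⟨(hch n).diff.mono hrU, fun w hw =>
      (mem_ball_zero_iff.1 ((hch n).subset ((hch n).mapsTo (hrU hw)))).le⟩⟩
  have hnear : ∀ z ∈ ball (0 : ℂ) 1, ∃ r > 0, ∀ᶠ n in (l : Filter ℕ), ball z r ⊆ V n :=
    fun z hz => by
    rw [mem_ball_zero_iff] at hz
    refine ⟨(1 - ‖z‖) / 2, by linarith, ?_⟩
    filter_upwards [hl (hball ((1 + ‖z‖) / 2) (by linarith))] with n hn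
    refine (ball_subset_ball' ?_).trans hn
    rw [dist_zero_right]
    linarith
  obtain ⟨g, hg⟩ := montel (l := l) (F := G) (O := ball 0 1) (M := M) fun z hz => by
    obtain ⟨r, hr, hrV⟩ := hnear z hz
    refine ⟨r, hr, hrV.mono fun n hn => ⟨(hch n).diff_inv.mono hn, fun w hw => ?_⟩⟩
    exact hM _ ((hch n).mapsTo_inv (hn hw))
  have hfU : DifferentiableOn ℂ f U := fun z hz => by
    obtain ⟨r, hr, hd, -⟩ := hf z hz
    exact (hd.differentiableAt (ball_mem_nhds z hr)).differentiableWithinAt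
  have hgD : DifferentiableOn ℂ g (ball 0 1) := fun z hz => by
    obtain ⟨r, hr, hd, -⟩ := hg z hz
    exact (hd.differentiableAt (ball_mem_nhds z hr)).differentiableWithinAt
  have hfl : ∀ z ∈ U, Tendsto (fun n => F n z) l (𝓝 (f z)) := fun z hz => by
    obtain ⟨r, hr, -, hu, -⟩ := hf z hz
    exact hu.tendsto_at (mem_ball_self hr)
  have hgl : ∀ z ∈ ball (0 : ℂ) 1, Tendsto (fun n => G n z) l (𝓝 (g z)) := fun z hz => by
    obtain ⟨r, hr, -, hu, -⟩ := hg z hz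
    exact hu.tendsto_at (mem_ball_self hr)
  have hf1 : ∀ z ∈ U, ‖f z‖ ≤ 1 := fun z hz =>
    le_of_tendsto (hfl z hz).norm (Eventually.of_forall fun n =>
      (mem_ball_zero_iff.1 ((hch n).subset ((hch n).mapsTo hz))).le)
  have hf0 : f z₀ = 0 := tendsto_nhds_unique (hfl z₀ hz₀) (by
    simp only [fun n => (hch n).map_zero]; exact tendsto_const_nhds)
  have hfm : MapsTo f U (ball 0 1) := fun z hz => by
    rw [mem_ball_zero_iff]
    refine (hf1 z hz).lt_of_ne fun h => ?_
    have := Complex.norm_eqOn_of_isPreconnected_of_isMaxOn hU hUo hfU hz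
      (fun x hx => by simpa [h] using hf1 x hx) hz₀
    simp [hf0, h] at this
  have hgf : LeftInvOn g f U := fun z hz => by
    obtain ⟨r, hr, hd, hu, -⟩ := hg (f z) (hfm hz)
    refine tendsto_nhds_unique (hu.tendsto_comp_ball hr hd (hfl z hz)) ?_
    simp only [fun n => (hch n).left_inv hz]
    exact tendsto_const_nhds
  have hgm : MapsTo g (ball 0 1) U := fun ζ hζ => by
    by_contra hp
    obtain ⟨r, hr, hd, hu, hdn⟩ := hg ζ hζ
    obtain ⟨r', hr', hV⟩ := hnear ζ hζ
    have hsub : ball ζ (min r r') ⊆ ball ζ r := ball_subset_ball (min_le_left _ _)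
    have hne : ∃ᶠ z in 𝓝 ζ, g z ≠ g ζ := by
      intro hc
      simp only [not_not] at hc
      have hEq := (hgD.analyticOnNhd isOpen_ball).eqOn_of_preconnected_of_eventuallyEq
        (analyticOnNhd_const (v := g ζ)) (convex_ball (0 : ℂ) 1).isPreconnected hζ hc
      have h1 : g (f z₀) = g ζ := hEq (hfm hz₀)
      exact hp (by rw [← h1, hgf hz₀]; exact hz₀)
    have := hurwitz (lt_min hr hr') (hdn.mono fun n hn => hn.mono hsub) (hu.mono hsub)
      (hd.mono hsub) rfl hne
    obtain ⟨n, ⟨w, hw, hwp⟩, hn⟩ := (this.and hV).exists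
    refine hp (hwp ▸ (hch n).mapsTo_inv (hn (ball_subset_ball (min_le_right _ _) hw)))
  refine ⟨f, g, hfU, hgD, hfm, hgm, hgf, fun ζ hζ => ?_⟩
  obtain ⟨r, hr, hd, hu, -⟩ := hf (g ζ) (hgm hζ)
  refine tendsto_nhds_unique (hu.tendsto_comp_ball hr hd (hgl ζ hζ)) ?_
  obtain ⟨r', hr', hV⟩ := hnear ζ hζ
  refine tendsto_const_nhds.congr' (hV.mono fun n hn => ?_)
  exact ((hch n).right_inv (hn (mem_ball_self hr'))).symm

open MeasureTheory in
/-- The area of the image of an injective holomorphic map. -/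
theorem lintegral_norm_deriv_sq {g : ℂ → ℂ} {O : Set ℂ} (hO : IsOpen O)
    (hg : DifferentiableOn ℂ g O) (hi : InjOn g O) :
    ∫⁻ z in O, ENNReal.ofReal (‖deriv g z‖ ^ 2) = volume (g '' O) := by
  rw [← lintegral_abs_det_fderiv_eq_addHaar_image volume hO.measurableSet
    (f' := fun z => (fderiv ℂ g z).restrictScalars ℝ) (fun z hz =>
      ((hg.differentiableAt (hO.mem_nhds hz)).hasFDerivAt.restrictScalars ℝ).hasFDerivWithinAt) hi]
  refine setLIntegral_congr_fun hO.measurableSet fun z hz => ?_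
  congr 1
  simp [ContinuousLinearMap.det, LinearMap.det_restrictScalars, Algebra.norm_complex_eq,
    Complex.normSq_eq_norm_sq]

theorem norm_sub_one_lt_one_iff {r θ : ℝ} (hr : 0 < r) :
    ‖(r : ℂ) * Complex.exp (θ * Complex.I) - 1‖ < 1 ↔ r / 2 < Real.cos θ := by
  have h : ‖(r : ℂ) * Complex.exp (θ * Complex.I) - 1‖ ^ 2 = r ^ 2 - 2 * r * Real.cos θ + 1 := by
    have h1 : (r : ℂ) * Complex.exp (θ * Complex.I) - 1 =
        ((r * Real.cos θ - 1 : ℝ) : ℂ) + ((r * Real.sin θ : ℝ) : ℂ) * Complex.I := by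
      rw [Complex.exp_mul_I]
      push_cast
      ring
    rw [← Complex.normSq_eq_norm_sq, h1, Complex.normSq_add_mul_I]
    nlinarith [Real.sin_sq_add_cos_sq θ]
  rw [← sq_lt_one_iff₀ (norm_nonneg _), h]
  constructor
  · intro h
    have : r * (r / 2) < r * Real.cos θ := by linarith
    exact lt_of_mul_lt_mul_left this hr.le
  · intro h
    nlinarith

/-- Two points of an arc whose images are far apart force the mean square of the derivative to be
large. -/
theorem le_integral_of_arc {g : ℂ → ℂ} (hg : DifferentiableOn ℂ g (ball 1 1)) {r ε θ₁ θ₂ : ℝ}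
    (hr : 0 < r) (hε : 0 < ε) (h12 : θ₁ ≤ θ₂) (h1 : -(Real.pi / 2) ≤ θ₁) (h2 : θ₂ ≤ Real.pi / 2)
    (hc1 : r / 2 < Real.cos θ₁) (hc2 : r / 2 < Real.cos θ₂)
    (hd : ε ≤ ‖g (r * Complex.exp (θ₂ * Complex.I)) - g (r * Complex.exp (θ₁ * Complex.I))‖) :
    ε ^ 2 / (Real.pi * r ^ 2) ≤
      ∫ θ in θ₁..θ₂, ‖deriv g (r * Complex.exp (θ * Complex.I))‖ ^ 2 := by
  have hcos : ∀ θ ∈ Icc θ₁ θ₂, r / 2 < Real.cos θ := by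
    intro θ hθ
    rcases le_total 0 θ with h0 | h0
    · exact hc2.trans_le (Real.cos_le_cos_of_nonneg_of_le_pi h0 (by linarith [Real.pi_pos]) hθ.2)
    · have := Real.cos_le_cos_of_nonneg_of_le_pi (x := -θ) (y := -θ₁) (by linarith)
        (by linarith [Real.pi_pos]) (by linarith [hθ.1])
      rw [Real.cos_neg, Real.cos_neg] at this
      linarith
  set γ : ℝ → ℂ := fun θ => r * Complex.exp (θ * Complex.I) with hγ
  have hγc : Continuous γ := by fun_prop
  have hγm : ∀ θ ∈ Icc θ₁ θ₂, γ θ ∈ ball (1 : ℂ) 1 := fun θ hθ => by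
    rw [mem_ball, dist_eq_norm]
    exact (norm_sub_one_lt_one_iff hr).2 (hcos θ hθ)
  have hdc : ContinuousOn (fun θ => deriv g (γ θ)) (Icc θ₁ θ₂) :=
    ((hg.deriv isOpen_ball).continuousOn).comp hγc.continuousOn hγm
  have hγd : ∀ θ : ℝ, HasDerivAt γ (r * (Complex.exp (θ * Complex.I) * Complex.I)) θ := fun θ => by
    have h := ((Complex.ofRealCLM.hasDerivAt (x := θ)).mul_const Complex.I).cexp.const_mul (r : ℂ)
    simpa [hγ] using h
  have hder : ∀ θ ∈ uIcc θ₁ θ₂, HasDerivAt (fun θ => g (γ θ))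
      (r * (Complex.exp (θ * Complex.I) * Complex.I) * deriv g (γ θ)) θ := fun θ hθ => by
    rw [uIcc_of_le h12] at hθ
    have := (hg.differentiableAt (isOpen_ball.mem_nhds (hγm θ hθ))).hasDerivAt
    exact HasDerivAt.scomp θ this (hγd θ)
  have hintg : IntervalIntegrable (fun θ : ℝ =>
      (r : ℂ) * (Complex.exp (θ * Complex.I) * Complex.I) * deriv g (γ θ))
      MeasureTheory.volume θ₁ θ₂ := by
    refine ContinuousOn.intervalIntegrable ?_
    rw [uIcc_of_le h12]
    exact ContinuousOn.mul (by fun_prop) hdc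
  have hint1 : IntervalIntegrable (fun θ : ℝ => r * ‖deriv g (γ θ)‖)
      MeasureTheory.volume θ₁ θ₂ := by
    refine ContinuousOn.intervalIntegrable ?_
    rw [uIcc_of_le h12]
    exact ContinuousOn.mul (by fun_prop) hdc.norm
  have hint2 : IntervalIntegrable (fun θ : ℝ => ‖deriv g (γ θ)‖ ^ 2)
      MeasureTheory.volume θ₁ θ₂ := by
    refine ContinuousOn.intervalIntegrable ?_
    rw [uIcc_of_le h12]
    exact hdc.norm.pow 2
  have hle : ε ≤ ∫ θ in θ₁..θ₂, r * ‖deriv g (γ θ)‖ := by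
    refine hd.trans ?_
    have := intervalIntegral.integral_eq_sub_of_hasDerivAt hder hintg
    simp only [hγ] at this ⊢
    rw [← this]
    refine (intervalIntegral.norm_integral_le_integral_norm h12).trans (le_of_eq ?_)
    refine intervalIntegral.integral_congr fun θ _ => ?_
    simp [Complex.norm_exp_ofReal_mul_I, abs_of_pos hr]
  set I := ∫ θ in θ₁..θ₂, ‖deriv g (γ θ)‖ ^ 2 with hI
  have hpi := Real.pi_pos
  have hle2 : ∫ θ in θ₁..θ₂, r * ‖deriv g (γ θ)‖ ≤
      ∫ θ in θ₁..θ₂, (Real.pi * r ^ 2 / (2 * ε) * ‖deriv g (γ θ)‖ ^ 2 + ε / (2 * Real.pi)) := by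
    refine intervalIntegral.integral_mono_on h12 hint1 ((hint2.const_mul _).add
      intervalIntegrable_const) fun θ _ => ?_
    set x := ‖deriv g (γ θ)‖
    have : Real.pi * r ^ 2 / (2 * ε) * x ^ 2 + ε / (2 * Real.pi) - r * x =
        (Real.pi * r * x - ε) ^ 2 / (2 * ε * Real.pi) := by
      field_simp
      ring
    have h3 : 0 ≤ (Real.pi * r * x - ε) ^ 2 / (2 * ε * Real.pi) := by positivity
    linarith
  set J := ∫ θ in θ₁..θ₂, r * ‖deriv g (γ θ)‖ with hJ
  rw [intervalIntegral.integral_add (hint2.const_mul _) intervalIntegrable_const,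
    intervalIntegral.integral_const_mul, intervalIntegral.integral_const, ← hI, smul_eq_mul] at hle2
  have h4 : (θ₂ - θ₁) * (ε / (2 * Real.pi)) ≤ ε / 2 := by
    calc (θ₂ - θ₁) * (ε / (2 * Real.pi)) ≤ Real.pi * (ε / (2 * Real.pi)) := by
          gcongr; linarith
      _ = ε / 2 := by field_simp
  have h5 : ε / 2 ≤ Real.pi * r ^ 2 / (2 * ε) * I := by linarith
  rw [div_le_iff₀ (by positivity)]
  have h6 : ε * (2 * ε) / 2 ≤ Real.pi * r ^ 2 / (2 * ε) * I * (2 * ε) := by nlinarith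
  have h7 : Real.pi * r ^ 2 / (2 * ε) * I * (2 * ε) = I * (Real.pi * r ^ 2) := by field_simp
  rw [h7] at h6
  linarith

open MeasureTheory in
/-- The length-area principle. -/
theorem exists_arc_small {g : ℂ → ℂ} (hg : DifferentiableOn ℂ g (ball 1 1))
    (hi : InjOn g (ball 1 1)) (hb : Bornology.IsBounded (g '' ball 1 1)) {ε δ : ℝ} (hε : 0 < ε)
    (hδ : 0 < δ) : ∃ r ∈ Ioo 0 δ,
      ∀ z ∈ sphere (0 : ℂ) r ∩ ball 1 1, ∀ w ∈ sphere (0 : ℂ) r ∩ ball 1 1,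
      ‖g z - g w‖ < ε := by
  by_contra! hno
  set Φ : ℂ → ENNReal := (ball 1 1).indicator fun z => ENNReal.ofReal (‖deriv g z‖ ^ 2) with hΦ
  have hΦm : Measurable Φ :=
    (((measurable_deriv g).norm.pow_const 2).ennreal_ofReal).indicator measurableSet_ball
  have hfin : ∫⁻ z, Φ z < ⊤ := by
    rw [hΦ, lintegral_indicator measurableSet_ball, lintegral_norm_deriv_sq isOpen_ball hg hi]
    exact hb.measure_lt_top
  have hpolar : ∀ r θ : ℝ, (Complex.polarCoord.symm (r, θ) : ℂ) =
      r * Complex.exp (θ * Complex.I) := fun r θ => by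
    rw [Complex.polarCoord_symm_apply, Complex.exp_mul_I]
    simp
  have hcm : Measurable fun p : ℝ × ℝ =>
      ENNReal.ofReal p.1 • Φ (p.1 * Complex.exp (p.2 * Complex.I)) := by
    refine Measurable.smul (measurable_fst.ennreal_ofReal) (hΦm.comp ?_)
    fun_prop
  rw [← Complex.lintegral_comp_polarCoord_symm, polarCoord_target, Measure.volume_eq_prod,
    ← Measure.prod_restrict] at hfin
  rw [lintegral_congr (g := fun p : ℝ × ℝ =>
      ENNReal.ofReal p.1 • Φ (p.1 * Complex.exp (p.2 * Complex.I)))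
      (fun p => by rw [← hpolar p.1 p.2]), lintegral_prod _ hcm.aemeasurable] at hfin
  have key : ∀ r ∈ Ioo 0 δ, ENNReal.ofReal (ε ^ 2 / Real.pi * r⁻¹) ≤
      ∫⁻ θ in Ioo (-Real.pi) Real.pi,
        ENNReal.ofReal r • Φ (r * Complex.exp (θ * Complex.I)) := by
    intro r hr
    have hr0 : 0 < r := hr.1
    have hmain : ∃ θ₁ θ₂, θ₁ ≤ θ₂ ∧ -(Real.pi / 2) ≤ θ₁ ∧ θ₂ ≤ Real.pi / 2 ∧ r / 2 < Real.cos θ₁ ∧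
        r / 2 < Real.cos θ₂ ∧
        ε ≤ ‖g (r * Complex.exp (θ₂ * Complex.I)) - g (r * Complex.exp (θ₁ * Complex.I))‖ := by
      obtain ⟨z, ⟨hz, hz1⟩, w, ⟨hw, hw1⟩, hzw⟩ := hno r hr
      have harg : ∀ z : ℂ, z ∈ sphere (0 : ℂ) r → z ∈ ball (1 : ℂ) 1 →
          z = r * Complex.exp (z.arg * Complex.I) ∧ r / 2 < Real.cos z.arg ∧
            |z.arg| ≤ Real.pi / 2 := fun z hz hz1 => by
        have hzr : ‖z‖ = r := by simpa using hz
        have h1 : z = r * Complex.exp (z.arg * Complex.I) := by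
          rw [← hzr, Complex.norm_mul_exp_arg_mul_I]
        have h2 : r / 2 < Real.cos z.arg := by
          rw [mem_ball, dist_eq_norm, h1] at hz1
          exact (norm_sub_one_lt_one_iff hr0).1 hz1
        refine ⟨h1, h2, ?_⟩
        by_contra! h
        have := Real.cos_nonpos_of_pi_div_two_le_of_le h.le
          (by linarith [Complex.abs_arg_le_pi z, Real.pi_pos])
        rw [Real.cos_abs] at this
        linarith
      obtain ⟨hz2, hz3, hz4⟩ := harg z hz hz1
      obtain ⟨hw2, hw3, hw4⟩ := harg w hw hw1
      rw [abs_le] at hz4 hw4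
      rcases le_total z.arg w.arg with h | h
      · exact ⟨_, _, h, hz4.1, hw4.2, hz3, hw3, by rwa [← hz2, ← hw2, norm_sub_rev]⟩
      · exact ⟨_, _, h, hw4.1, hz4.2, hw3, hz3, by rwa [← hz2, ← hw2]⟩
    obtain ⟨θ₁, θ₂, h12, h1, h2, hc1, hc2, hd⟩ := hmain
    have hle := le_integral_of_arc hg hr0 hε h12 h1 h2 hc1 hc2 hd
    have hpi := Real.pi_pos
    have hcos : ∀ θ ∈ Icc θ₁ θ₂, r / 2 < Real.cos θ := by
      intro θ hθ
      rcases le_total 0 θ with h0 | h0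
      · exact hc2.trans_le (Real.cos_le_cos_of_nonneg_of_le_pi h0 (by linarith [Real.pi_pos]) hθ.2)
      · have := Real.cos_le_cos_of_nonneg_of_le_pi (x := -θ) (y := -θ₁) (by linarith)
          (by linarith [Real.pi_pos]) (by linarith [hθ.1])
        rw [Real.cos_neg, Real.cos_neg] at this
        linarith
    have hmem : ∀ θ ∈ Icc θ₁ θ₂, (r : ℂ) * Complex.exp (θ * Complex.I) ∈ ball (1 : ℂ) 1 :=
      fun θ hθ => by
        rw [mem_ball, dist_eq_norm]
        exact (norm_sub_one_lt_one_iff hr0).2 (hcos θ hθ)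
    have hIc : ContinuousOn (fun θ : ℝ => ‖deriv g (r * Complex.exp (θ * Complex.I))‖ ^ 2)
        (Icc θ₁ θ₂) :=
      (((hg.deriv isOpen_ball).continuousOn.comp (by fun_prop) hmem).norm).pow 2
    calc ENNReal.ofReal (ε ^ 2 / Real.pi * r⁻¹)
        = ENNReal.ofReal r * ENNReal.ofReal (ε ^ 2 / (Real.pi * r ^ 2)) := by
          rw [← ENNReal.ofReal_mul hr0.le]
          congr 1
          field_simp
      _ ≤ ENNReal.ofReal r * ENNReal.ofReal
          (∫ θ in θ₁..θ₂, ‖deriv g (r * Complex.exp (θ * Complex.I))‖ ^ 2) := by gcongr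
      _ = ENNReal.ofReal r * ∫⁻ θ in Ioc θ₁ θ₂, Φ (r * Complex.exp (θ * Complex.I)) := by
          rw [intervalIntegral.integral_of_le h12, ofReal_integral_eq_lintegral_ofReal
            ((hIc.integrableOn_Icc).mono_set Ioc_subset_Icc_self)
            (Eventually.of_forall fun θ => by positivity)]
          congr 1
          refine setLIntegral_congr_fun measurableSet_Ioc fun θ hθ => ?_
          rw [hΦ, indicator_of_mem (hmem θ (Ioc_subset_Icc_self hθ))]
      _ ≤ ENNReal.ofReal r *
          ∫⁻ θ in Ioo (-Real.pi) Real.pi, Φ (r * Complex.exp (θ * Complex.I)) := by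
          gcongr
          exact fun θ hθ => ⟨by linarith [hθ.1], by linarith [hθ.2]⟩
      _ = _ := by
          rw [← lintegral_const_mul']
          · rfl
          · exact ENNReal.ofReal_ne_top
  have htop : ∫⁻ r in Ioo 0 δ, ENNReal.ofReal (ε ^ 2 / Real.pi * r⁻¹) < ⊤ := by
    refine lt_of_le_of_lt ?_ hfin
    refine (setLIntegral_mono' measurableSet_Ioo key).trans ?_
    exact lintegral_mono_set fun r hr => hr.1
  have hpi := Real.pi_pos
  have hintg : IntegrableOn (fun r : ℝ => ε ^ 2 / Real.pi * r⁻¹) (Ioo 0 δ) := by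
    refine ⟨by fun_prop, ?_⟩
    rw [hasFiniteIntegral_iff_ofReal]
    · exact htop
    · refine (ae_restrict_iff' measurableSet_Ioo).2 (Eventually.of_forall fun r hr => ?_)
      have := hr.1
      simp only [Pi.zero_apply]
      positivity
  have hii : IntervalIntegrable (fun r : ℝ => r⁻¹) volume 0 δ := by
    rw [intervalIntegrable_iff_integrableOn_Ioo_of_le hδ.le]
    have := hintg.const_mul (Real.pi / ε ^ 2)
    refine this.congr (Eventually.of_forall fun r => ?_)
    simp only
    field_simp
  rw [intervalIntegrable_inv_iff] at hii
  rcases hii with h | h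
  · exact hδ.ne h
  · exact h (by simp)

/-- A bounded domain `U` whose boundary lies in an unbounded closed set `X` disjoint from `U`,
where `X` is connected without cut points and uniformly locally connected. -/
structure IsTameDomain (X U : Set ℂ) : Prop where
  isClosed : IsClosed X
  isPreconnected : IsPreconnected X
  not_isBounded : ¬ Bornology.IsBounded X
  isPreconnected_diff : ∀ p, IsPreconnected (X \ {p})
  exists_isPreconnected : ∀ ε > 0, ∃ δ > 0, ∀ p ∈ X, ∃ B, IsClosed B ∧ IsPreconnected B ∧
    X ∩ ball p δ ⊆ B ∧ B ⊆ X ∩ ball p ε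
  isOpen : IsOpen U
  isPreconnected_dom : IsPreconnected U
  isBounded : Bornology.IsBounded U
  disjoint : Disjoint U X
  frontier_subset : frontier U ⊆ X

/-- A biholomorphic map `φ` from the unit disc onto `U`, with inverse `ψ`. -/
structure IsDiscParam (U : Set ℂ) (φ ψ : ℂ → ℂ) : Prop where
  diff : DifferentiableOn ℂ φ (ball 0 1)
  diff_inv : DifferentiableOn ℂ ψ U
  mapsTo : MapsTo φ (ball 0 1) U
  mapsTo_inv : MapsTo ψ U (ball 0 1)
  left_inv : LeftInvOn ψ φ (ball 0 1)
  right_inv : LeftInvOn φ ψ U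

namespace IsTameDomain

variable {X U : Set ℂ} {φ ψ : ℂ → ℂ}

theorem noHole (h : IsTameDomain X U) : NoHole U := by
  intro C hC hd hO
  have h1 : X ⊆ Cᶜ := by
    rcases isPreconnected_iff_subset_of_disjoint.1 h.isPreconnected (C ∪ U) Cᶜ hO
      hC.isClosed.isOpen_compl (fun x _ => by by_cases hx : x ∈ C <;> simp [hx]) (by
        ext x
        simp only [mem_inter_iff, mem_union, mem_compl_iff, mem_empty_iff_false, iff_false]
        rintro ⟨hx, hx1 | hx1, hx2⟩
        · exact hx2 hx1
        · exact disjoint_left.1 h.disjoint hx1 hx) with h1 | h1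
    · refine absurd (hC.isBounded.subset fun x hx => ?_) h.not_isBounded
      exact (h1 hx).resolve_right fun hxU => disjoint_left.1 h.disjoint hxU hx
    · exact h1
  have h2 : C = (C ∪ U) ∩ (closure U)ᶜ := by
    ext x
    constructor
    · intro hx
      refine ⟨Or.inl hx, fun hxU => ?_⟩
      have hxU' : x ∉ U := disjoint_left.1 hd hx
      have : x ∈ frontier U := ⟨hxU, by rwa [h.isOpen.interior_eq]⟩
      exact h1 (h.frontier_subset this) hx
    · rintro ⟨hx | hx, hx'⟩
      · exact hx
      · exact absurd (subset_closure hx) hx'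
  refine hC.eq_empty_of_isOpen ?_
  rw [h2]
  exact hO.inter isClosed_closure.isOpen_compl

theorem exists_isDiscParam (h : IsTameDomain X U) (hne : U.Nonempty) :
    ∃ φ ψ, IsDiscParam U φ ψ := by
  obtain ⟨z, hz⟩ := hne
  obtain ⟨f, g, h1, h2, h3, h4, h5, h6⟩ := riemann_mapping h.isOpen h.isPreconnected_dom
    h.isBounded h.noHole hz
  exact ⟨g, f, h2, h1, h4, h3, h6, h5⟩

end IsTameDomain

namespace IsDiscParam

variable {X U : Set ℂ} {φ ψ : ℂ → ℂ}

theorem continuousAt_inv (hp : IsDiscParam U φ ψ) (hU : IsOpen U) {y : ℂ} (hy : y ∈ U) :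
    ContinuousAt ψ y := (hp.diff_inv.differentiableAt (hU.mem_nhds hy)).continuousAt

theorem continuousAt (hp : IsDiscParam U φ ψ) {z : ℂ} (hz : z ∈ ball (0 : ℂ) 1) :
    ContinuousAt φ z := (hp.diff.differentiableAt (isOpen_ball.mem_nhds hz)).continuousAt

theorem image_inter (hp : IsDiscParam U φ ψ) (W : Set ℂ) :
    φ '' (ball 0 1 ∩ W) = U ∩ ψ ⁻¹' W := by
  ext y
  constructor
  · rintro ⟨z, ⟨hz, hzW⟩, rfl⟩
    exact ⟨hp.mapsTo hz, by rwa [mem_preimage, hp.left_inv hz]⟩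
  · rintro ⟨hy, hyW⟩
    exact ⟨ψ y, ⟨hp.mapsTo_inv hy, hyW⟩, hp.right_inv hy⟩

theorem isOpen_image_inter (hp : IsDiscParam U φ ψ) (hU : IsOpen U) {W : Set ℂ} (hW : IsOpen W) :
    IsOpen (φ '' (ball 0 1 ∩ W)) := by
  rw [hp.image_inter]
  exact hp.diff_inv.continuousOn.isOpen_inter_preimage hU hW

theorem frontier_image_subset (hp : IsDiscParam U φ ψ) (hU : IsOpen U) {W : Set ℂ}
    (hW : IsOpen W) :
    frontier (φ '' (ball 0 1 ∩ W)) ⊆ frontier U ∪ φ '' (ball 0 1 ∩ (closure W \ W)) := by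
  intro y hy
  rw [(hp.isOpen_image_inter hU hW).frontier_eq] at hy
  obtain ⟨hyc, hyn⟩ := hy
  have hsub : φ '' (ball 0 1 ∩ W) ⊆ U := by rw [hp.image_inter]; exact inter_subset_left
  by_cases hyU : y ∈ U
  · right
    rw [hp.image_inter] at hyn hyc ⊢
    refine ⟨hyU, ?_, fun h => hyn ⟨hyU, h⟩⟩
    have := mem_closure_iff_nhdsWithin_neBot.1 hyc
    refine mem_closure_of_tendsto ((hp.continuousAt_inv hU hyU).mono_left
      (nhdsWithin_le_nhds (s := U ∩ ψ ⁻¹' W))) ?_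
    filter_upwards [self_mem_nhdsWithin] with x hx
    exact hx.2
  · left
    rw [hU.frontier_eq]
    exact ⟨closure_mono hsub hyc, hyU⟩

/-- Cluster values of `φ` at the unit circle lie outside `U`. -/
theorem notMem_of_tendsto (hp : IsDiscParam U φ ψ) (hU : IsOpen U) {l : Filter ℂ} [l.NeBot]
    {ζ y : ℂ} (hl : l ≤ 𝓝[ball 0 1] ζ) (hζ : ζ ∉ ball (0 : ℂ) 1) (hy : Tendsto φ l (𝓝 y)) :
    y ∉ U := by
  intro hyU
  have h1 : Tendsto (fun z => ψ (φ z)) l (𝓝 (ψ y)) := (hp.continuousAt_inv hU hyU).tendsto.comp hy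
  have h2 : Tendsto (fun z => ψ (φ z)) l (𝓝 ζ) := by
    refine Tendsto.congr' ?_ (tendsto_id.mono_left (hl.trans nhdsWithin_le_nhds))
    filter_upwards [hl self_mem_nhdsWithin] with z hz
    exact (hp.left_inv hz).symm
  exact hζ (tendsto_nhds_unique h1 h2 ▸ hp.mapsTo_inv hyU)

/-- Crosscuts of small diameter. -/
theorem exists_crosscut (hp : IsDiscParam U φ ψ) (hUb : Bornology.IsBounded U) {ζ : ℂ}
    (hζ : ‖ζ‖ = 1) {ε : ℝ} (hε : 0 < ε) : ∃ r ∈ Ioo (0 : ℝ) 1, ∀ z ∈ sphere ζ r ∩ ball 0 1,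
      ∀ w ∈ sphere ζ r ∩ ball 0 1, ‖φ z - φ w‖ < ε := by
  have hm : MapsTo (fun w => ζ * (1 - w)) (ball 1 1) (ball 0 1) := fun w hw => by
    rw [mem_ball, dist_eq_norm, norm_sub_rev] at hw
    rwa [mem_ball_zero_iff, norm_mul, hζ, one_mul]
  have hζ0 : ζ ≠ 0 := norm_pos_iff.1 (by rw [hζ]; exact one_pos)
  obtain ⟨r, hr, h⟩ := exists_arc_small (g := fun w => φ (ζ * (1 - w)))
    (hp.diff.comp (by fun_prop) hm) (by
      intro a ha b hb hab
      have := hp.left_inv.injOn (hm ha) (hm hb) hab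
      simpa using mul_left_cancel₀ hζ0 this) (hUb.subset (by
        rintro _ ⟨w, hw, rfl⟩
        exact hp.mapsTo (hm hw))) hε one_pos
  have key : ∀ z ∈ sphere ζ r ∩ ball 0 1, 1 - z / ζ ∈ sphere (0 : ℂ) r ∩ ball 1 1 ∧
      ζ * (1 - (1 - z / ζ)) = z := by
    rintro z ⟨hz, hz1⟩
    rw [mem_sphere, dist_eq_norm] at hz
    rw [mem_ball_zero_iff] at hz1
    refine ⟨⟨?_, ?_⟩, by field_simp; ring⟩
    · rw [mem_sphere_zero_iff_norm, one_sub_div hζ0, norm_div, hζ, div_one, norm_sub_rev, hz]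
    · rw [mem_ball, dist_eq_norm, sub_sub_cancel_left, norm_neg, norm_div, hζ, div_one]
      exact hz1
  refine ⟨r, hr, fun z hz w hw => ?_⟩
  have := h _ (key z hz).1 _ (key w hw).1
  simpa only [(key z hz).2, (key w hw).2] using this

/-- A crosscut accumulates outside of `U`. -/
theorem exists_mem_closure (hp : IsDiscParam U φ ψ) (hUb : Bornology.IsBounded U) {ζ : ℂ}
    (hζ : ‖ζ‖ = 1) {r : ℝ} (hr : r ∈ Ioo (0 : ℝ) 1) :
    ∃ p ∈ closure (φ '' (sphere ζ r ∩ ball 0 1)), p ∉ U := by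
  by_contra! hsub
  set K := closure (φ '' (sphere ζ r ∩ ball 0 1)) with hK
  have hKc : IsCompact K := by
    refine Metric.isCompact_of_isClosed_isBounded isClosed_closure (hUb.subset hsub)
  have hψK : IsCompact (ψ '' K) := hKc.image_of_continuousOn (hp.diff_inv.continuousOn.mono hsub)
  have h1 : sphere ζ r ⊆ ψ '' K := by
    rcases isPreconnected_iff_subset_of_disjoint.1 (isPreconnected_sphere
      (by rw [Complex.rank_real_complex]; norm_num) ζ r) (ball 0 1) (ψ '' K)ᶜ isOpen_ball
      hψK.isClosed.isOpen_compl (fun z hz => by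
        by_cases hzK : z ∈ ψ '' K
        · obtain ⟨y, hy, rfl⟩ := hzK
          exact Or.inl (hp.mapsTo_inv (hsub y hy))
        · exact Or.inr hzK) (by
        ext z
        simp only [mem_inter_iff, mem_compl_iff, mem_empty_iff_false, iff_false]
        rintro ⟨hz, hz1, hz2⟩
        exact hz2 ⟨φ z, subset_closure ⟨z, ⟨hz, hz1⟩, rfl⟩, hp.left_inv hz1⟩) with h1 | h1
    · intro z hz
      exact ⟨φ z, subset_closure ⟨z, ⟨hz, h1 hz⟩, rfl⟩, hp.left_inv (h1 hz)⟩
    · exfalso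
      have hz : ζ * (1 - r) ∈ sphere ζ r := by
        rw [mem_sphere, dist_eq_norm, show ζ * (1 - r) - ζ = -(ζ * r) by ring, norm_neg, norm_mul,
          hζ, Complex.norm_real, Real.norm_of_nonneg hr.1.le, one_mul]
      have hz1 : ζ * (1 - r) ∈ ball (0 : ℂ) 1 := by
        rw [mem_ball_zero_iff, norm_mul, hζ, one_mul]
        have : ((1 : ℂ) - r) = ((1 - r : ℝ) : ℂ) := by push_cast; rfl
        rw [this, Complex.norm_real, Real.norm_of_nonneg (by linarith [hr.2])]
        linarith [hr.1]
      exact h1 hz ⟨_, subset_closure ⟨_, ⟨hz, hz1⟩, rfl⟩, hp.left_inv hz1⟩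
  have hz : ζ * (1 + r) ∈ sphere ζ r := by
    rw [mem_sphere, dist_eq_norm, show ζ * (1 + r) - ζ = ζ * r by ring, norm_mul,
      hζ, Complex.norm_real, Real.norm_of_nonneg hr.1.le, one_mul]
  obtain ⟨y, hy, hyz⟩ := h1 hz
  have h2 := mem_ball_zero_iff.1 (hp.mapsTo_inv (hsub y hy))
  have : ((1 : ℂ) + r) = ((1 + r : ℝ) : ℂ) := by push_cast; rfl
  rw [hyz, norm_mul, hζ, one_mul, this, Complex.norm_real,
    Real.norm_of_nonneg (by linarith [hr.1])] at h2
  linarith [hr.1]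

end IsDiscParam

namespace IsTameDomain

variable {X U : Set ℂ} {φ ψ : ℂ → ℂ}

/-- Crosscuts of small diameter cut off domains of small diameter. -/
theorem exists_image_subset_ball (h : IsTameDomain X U) (hp : IsDiscParam U φ ψ) {ζ : ℂ}
    (hζ : ‖ζ‖ = 1) {ε : ℝ} (hε : 0 < ε) :
    ∃ r > 0, ∃ p, φ '' (ball 0 1 ∩ ball ζ r) ⊆ ball p ε := by
  have h0 : φ 0 ∈ U := hp.mapsTo (mem_ball_self one_pos)
  obtain ⟨η, hη, hηX⟩ := Metric.isOpen_iff.1 h.isClosed.isOpen_compl (φ 0)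
    (disjoint_left.1 h.disjoint h0)
  set ε' := min ε η with hε'
  have hε'0 : 0 < ε' := lt_min hε hη
  obtain ⟨δ₀, hδ₀, hloc⟩ := h.exists_isPreconnected ε' hε'0
  set δ := min δ₀ ε' with hδ
  have hδ0 : 0 < δ := lt_min hδ₀ hε'0
  obtain ⟨r, hr, hosc⟩ := hp.exists_crosscut h.isBounded hζ (half_pos hδ0)
  obtain ⟨p, hpc, hpU⟩ := hp.exists_mem_closure h.isBounded hζ hr
  set σ := φ '' (sphere ζ r ∩ ball 0 1) with hσ
  have hσU : σ ⊆ U := by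
    rintro _ ⟨z, hz, rfl⟩
    exact hp.mapsTo hz.2
  have hpX : p ∈ X := by
    refine h.frontier_subset ?_
    rw [h.isOpen.frontier_eq]
    exact ⟨closure_mono hσU hpc, hpU⟩
  have hσb : closure σ ⊆ ball p δ := by
    have h1 : σ ⊆ closedBall p (δ / 2) := by
      rintro _ ⟨z, hz, rfl⟩
      have : closure σ ⊆ closedBall (φ z) (δ / 2) := by
        refine closure_minimal ?_ isClosed_closedBall
        rintro _ ⟨w, hw, rfl⟩
        rw [mem_closedBall, dist_eq_norm]
        exact (hosc w hw z hz).le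
      rw [mem_closedBall, dist_comm]
      exact this hpc
    exact (closure_minimal h1 isClosed_closedBall).trans (closedBall_subset_ball (by linarith))
  obtain ⟨B, hBc, hBp, hB1, hB2⟩ := hloc p hpX
  refine ⟨r, hr.1, p, fun a ha => ?_⟩
  by_contra hap
  set O := φ '' (ball 0 1 ∩ ball ζ r) with hO
  have hOU : O ⊆ U := by
    rintro _ ⟨z, hz, rfl⟩
    exact hp.mapsTo hz.1
  have hfr : frontier O ⊆ (closure σ ∪ B) ∪ X := by
    refine (hp.frontier_image_subset h.isOpen isOpen_ball).trans ?_
    refine union_subset (h.frontier_subset.trans subset_union_right) ?_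
    refine Subset.trans ?_ (subset_closure.trans (subset_union_left.trans subset_union_left))
    rw [closure_ball _ hr.1.ne']
    refine image_mono fun z hz => ⟨?_, hz.1⟩
    have h1 := mem_closedBall.1 hz.2.1
    have h2 : ¬ dist z ζ < r := hz.2.2
    exact le_antisymm h1 (not_lt.1 h2)
  have hK₁ : closure σ ∪ B ⊆ ball p ε' :=
    union_subset (hσb.trans (ball_subset_ball (min_le_right _ _)))
      (hB2.trans inter_subset_right)
  have hb : φ 0 ∉ ball p ε' := fun hb => by
    refine hηX ?_ hpX
    rw [mem_ball, dist_comm]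
    exact (mem_ball.1 hb).trans_le (min_le_right _ _)
  have ha' : a ∉ ball p ε' := fun h => hap (ball_subset_ball (min_le_left _ _) h)
  refine not_hasLogOn_div (K := (closure σ ∪ B) ∪ X) (O := O) (a := a) (b := φ 0)
    ((isClosed_closure.union hBc).union h.isClosed) (h.isBounded.subset hOU) hfr ha ?_ ?_ ?_
  · rintro ⟨z, hz, hz0⟩
    have := hp.left_inv.injOn hz.1 (mem_ball_self one_pos) hz0
    rw [this] at hz
    have h1 := mem_ball.1 hz.2
    rw [dist_zero_left, hζ] at h1
    linarith [hr.2]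
  · rintro (h1 | h1)
    · exact hb (hK₁ h1)
    · exact disjoint_left.1 h.disjoint h0 h1
  · refine HasLogOn.union ?_ (HasLogOn.div_of_isPreconnected h.isClosed h.isPreconnected_dom
      h.disjoint (hOU ha) h0) (isClosed_closure.union hBc) h.isClosed ?_
    · refine (HasLogOn.sub_of_subset_ball hK₁ ?_).div (HasLogOn.sub_of_subset_ball hK₁ ?_)
      · rw [mem_ball, dist_eq_norm] at ha'
        exact not_lt.1 ha'
      · rw [mem_ball, dist_eq_norm] at hb
        exact not_lt.1 hb
    · have : (closure σ ∪ B) ∩ X = B := by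
        ext x
        constructor
        · rintro ⟨hx | hx, hxX⟩
          · exact hB1 ⟨hxX, ball_subset_ball (min_le_left _ _) (hσb hx)⟩
          · exact hx
        · exact fun hx => ⟨Or.inr hx, (hB2 hx).1⟩
      rw [this]
      exact hBp

theorem exists_tendsto (h : IsTameDomain X U) (hp : IsDiscParam U φ ψ) {ζ : ℂ}
    (hζ : ζ ∈ closedBall (0 : ℂ) 1) : ∃ y, Tendsto φ (𝓝[ball 0 1] ζ) (𝓝 y) := by
  rcases (mem_closedBall_zero_iff.1 hζ).lt_or_eq with h1 | h1
  · exact ⟨φ ζ, (hp.continuousAt (mem_ball_zero_iff.2 h1)).mono_left nhdsWithin_le_nhds⟩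
  have : (𝓝[ball 0 1] ζ).NeBot := by
    rw [← mem_closure_iff_nhdsWithin_neBot, closure_ball _ one_ne_zero]
    exact hζ
  refine cauchy_map_iff_exists_tendsto.1 (Metric.cauchy_iff.2 ⟨map_neBot, fun ε hε => ?_⟩)
  obtain ⟨r, hr, p, hsub⟩ := h.exists_image_subset_ball hp h1 (half_pos hε)
  refine ⟨_, image_mem_map (inter_mem self_mem_nhdsWithin
    (nhdsWithin_le_nhds (ball_mem_nhds ζ hr))), fun x hx y hy => ?_⟩
  have h1 := mem_ball.1 (hsub hx)
  have h2 := mem_ball.1 (hsub hy)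
  have := dist_triangle_right x y p
  linarith

end IsTameDomain

/-- The side of `z` with respect to the oriented line through `u` and `v`. -/
def side (u v z : ℂ) : ℝ := ((starRingEnd ℂ) (v - u) * (z - u)).im

theorem continuous_side (u v : ℂ) : Continuous (side u v) := by
  unfold side
  fun_prop

theorem side_swap (u v z : ℂ) : side v u z = -side u v z := by
  simp [side]
  ring

theorem mem_openSegment_of_side_eq_zero {u v z : ℂ} (hu : ‖u‖ = 1) (hv : ‖v‖ = 1) (huv : u ≠ v)
    (hz : ‖z‖ < 1) (h : side u v z = 0) : z ∈ segment ℝ u v := by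
  have hd : v - u ≠ 0 := sub_ne_zero.2 huv.symm
  set d := v - u with hd'
  set t : ℝ := ((starRingEnd ℂ) d * (z - u)).re / Complex.normSq d with ht
  have hn : 0 < Complex.normSq d := Complex.normSq_pos.2 hd
  have hzt : z - u = t * d := by
    have h1 : (starRingEnd ℂ) d * (z - u) = (((starRingEnd ℂ) d * (z - u)).re : ℂ) := by
      apply Complex.ext
      · simp
      · rw [Complex.ofReal_im]; exact h
    have hc : (starRingEnd ℂ) d ≠ 0 := by simpa using hd
    apply mul_left_cancel₀ hc
    rw [h1, ht]
    push_cast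
    have h2 : (Complex.normSq d : ℂ) = (starRingEnd ℂ) d * d := Complex.normSq_eq_conj_mul_self
    have h3 : (Complex.normSq d : ℂ) ≠ 0 := by exact_mod_cast hn.ne'
    rw [show ∀ x y w v : ℂ, x * (y / v * w) = y * (x * w) / v by intros; ring, ← h2,
      mul_div_cancel_right₀ _ h3]
  have hz' : z = u + t * d := by rw [← hzt]; ring
  have hnu : Complex.normSq u = 1 := by rw [Complex.normSq_eq_norm_sq, hu, one_pow]
  have hnv : Complex.normSq v = 1 := by rw [Complex.normSq_eq_norm_sq, hv, one_pow]
  have hnz : Complex.normSq z < 1 := by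
    rw [Complex.normSq_eq_norm_sq]; nlinarith [norm_nonneg z]
  have hkey : Complex.normSq z = 1 - t * (1 - t) * Complex.normSq d := by
    have e1 : z.re = u.re + t * d.re := by rw [hz']; simp
    have e2 : z.im = u.im + t * d.im := by rw [hz']; simp
    have e3 : d.re = v.re - u.re := by simp [hd']
    have e4 : d.im = v.im - u.im := by simp [hd']
    rw [Complex.normSq_apply] at hnu hnv ⊢
    rw [Complex.normSq_apply, e1, e2, e3, e4]
    linear_combination (1 - t) * hnu + t * hnv
  have htt : 0 < t * (1 - t) := by
    by_contra! hle
    nlinarith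
  have h0 : 0 < t := by
    by_contra! hle
    nlinarith [mul_nonneg (neg_nonneg.2 hle) (by linarith : 0 ≤ 1 - t)]
  have h1 : t < 1 := by
    by_contra! hle
    nlinarith
  rw [segment_eq_image']
  exact ⟨t, ⟨h0.le, h1.le⟩, by rw [hz', ← hd']; simp⟩

theorem norm_lt_one_of_mem_segment {u v z : ℂ} (hu : ‖u‖ = 1) (hv : ‖v‖ = 1)
    (hz : z ∈ segment ℝ u v) (hzu : z ≠ u) (hzv : z ≠ v) : ‖z‖ < 1 := by
  have h1 : z ∈ openSegment ℝ u v := mem_openSegment_of_ne_left_right hzu.symm hzv.symm hz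
  have := (strictConvex_closedBall ℝ (0 : ℂ) 1).openSegment_subset
    (mem_closedBall_zero_iff.2 hu.le) (mem_closedBall_zero_iff.2 hv.le) (fun h => by
      subst h
      rw [openSegment_same] at h1
      exact hzu h1) h1
  rw [interior_closedBall _ one_ne_zero] at this
  exact mem_ball_zero_iff.1 this

theorem exists_side_pos {u v : ℂ} (hu : ‖u‖ = 1) (hv : ‖v‖ = 1) (huv : u ≠ v) :
    ∃ w : ℂ, ‖w‖ = 1 ∧ 0 < side u v w := by
  have hd : v - u ≠ 0 := sub_ne_zero.2 huv.symm
  have hn : 0 < ‖v - u‖ := norm_pos_iff.2 hd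
  refine ⟨Complex.I * ((v - u) / ‖v - u‖), ?_, ?_⟩
  · rw [norm_mul, Complex.norm_I, norm_div, Complex.norm_real, norm_norm, div_self hn.ne', one_mul]
  · have hre : ((starRingEnd ℂ) (v - u) * u).re ≠ 0 := by
      intro h0
      have hnu : Complex.normSq u = 1 := by rw [Complex.normSq_eq_norm_sq, hu, one_pow]
      have hnv : Complex.normSq v = 1 := by rw [Complex.normSq_eq_norm_sq, hv, one_pow]
      have h2 : Complex.normSq (v - u) = 0 := by
        rw [Complex.normSq_apply] at hnu hnv ⊢
        simp at h0 ⊢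
        nlinarith
      exact hd (Complex.normSq_eq_zero.1 h2)
    have h1 : ((starRingEnd ℂ) (v - u) * u).im ^ 2 < ‖v - u‖ ^ 2 := by
      have h3 : Complex.normSq ((starRingEnd ℂ) (v - u) * u) = ‖v - u‖ ^ 2 := by
        rw [Complex.normSq_eq_norm_sq, norm_mul, hu, mul_one, RCLike.norm_conj]
      rw [← h3, Complex.normSq_apply]
      nlinarith [sq_pos_of_ne_zero hre]
    have h2 := abs_lt_of_sq_lt_sq h1 hn.le
    have h4 : side u v (Complex.I * ((v - u) / ‖v - u‖)) =
        ‖v - u‖ - ((starRingEnd ℂ) (v - u) * u).im := by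
      rw [side, mul_sub, Complex.sub_im]
      congr 1
      have : (starRingEnd ℂ) (v - u) * (Complex.I * ((v - u) / ‖v - u‖)) =
          (‖v - u‖ : ℂ) * Complex.I := by
        have hn' : (‖v - u‖ : ℂ) ≠ 0 := by exact_mod_cast hn.ne'
        rw [show ∀ x y : ℂ, x * (Complex.I * (y / ‖v - u‖)) = x * y / ‖v - u‖ * Complex.I by
          intros; ring, Complex.conj_mul', sq, mul_div_cancel_right₀ _ hn']
      rw [this]
      simp
    rw [h4]
    linarith [(abs_lt.1 h2).2]

/-- A holomorphic function on the disc which takes a constant boundary value on an arc is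
constant. -/
theorem eq_of_eqOn_arc {F : ℂ → ℂ} (hF : DiffContOnCl ℂ F (ball 0 1)) {p w₀ : ℂ} {O : Set ℂ}
    (hO : IsOpen O) (hw₀ : ‖w₀‖ = 1) (hw₀O : w₀ ∈ O) (h : ∀ w ∈ O, ‖w‖ = 1 → F w = p) :
    F 0 = p := by
  have hcov : sphere (0 : ℂ) 1 ⊆ ⋃ c : sphere (0 : ℂ) 1, (fun z => (c : ℂ) * z) ⁻¹' O := by
    intro z hz
    rw [mem_sphere_zero_iff_norm] at hz
    have hz0 : z ≠ 0 := norm_pos_iff.1 (by rw [hz]; exact one_pos)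
    refine mem_iUnion.2 ⟨⟨w₀ / z, by rw [mem_sphere_zero_iff_norm, norm_div, hz, hw₀, div_one]⟩, ?_⟩
    simpa [hz0] using hw₀O
  obtain ⟨t, ht⟩ := (isCompact_sphere (0 : ℂ) 1).elim_finite_subcover _
    (fun c => hO.preimage (by fun_prop)) hcov
  have hc1 : ∀ c : sphere (0 : ℂ) 1, ‖(c : ℂ)‖ = 1 := fun c => mem_sphere_zero_iff_norm.1 c.2
  set P : ℂ → ℂ := fun z => ∏ c ∈ t, (F (c * z) - p) with hP
  have hball : ∀ c : sphere (0 : ℂ) 1, MapsTo (fun z => (c : ℂ) * z) (ball 0 1) (ball 0 1) :=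
    fun c z hz => by
      rw [mem_ball_zero_iff] at hz ⊢
      rwa [norm_mul, hc1, one_mul]
  have hcball : ∀ c : sphere (0 : ℂ) 1, MapsTo (fun z => (c : ℂ) * z) (closedBall 0 1)
      (closedBall 0 1) := fun c z hz => by
    rw [mem_closedBall_zero_iff] at hz ⊢
    rwa [norm_mul, hc1, one_mul]
  have hPd : DiffContOnCl ℂ P (ball 0 1) := by
    refine ⟨?_, ?_⟩
    · refine DifferentiableOn.fun_finsetProd fun c _ => ?_
      exact (hF.differentiableOn.comp (by fun_prop) (hball c)).sub_const p
    · rw [closure_ball _ one_ne_zero]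
      refine continuousOn_finsetProd _ fun c _ => ?_
      have := hF.continuousOn
      rw [closure_ball _ one_ne_zero] at this
      exact (this.comp (by fun_prop) (hcball c)).sub continuousOn_const
  have h0 : ‖P 0‖ ≤ 0 := by
    refine Complex.norm_le_of_forall_mem_frontier_norm_le isBounded_ball hPd (fun z hz => ?_)
      (subset_closure (mem_ball_self one_pos))
    rw [frontier_ball _ one_ne_zero] at hz
    obtain ⟨c, hc, hcz⟩ := mem_iUnion₂.1 (ht hz)
    have : P z = 0 := by
      refine Finset.prod_eq_zero hc ?_
      rw [h _ hcz (by rw [norm_mul, hc1, one_mul]; exact mem_sphere_zero_iff_norm.1 hz), sub_self]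
    rw [this, norm_zero]
  have h1 : P 0 = 0 := norm_le_zero_iff.1 h0
  obtain ⟨c, -, hc⟩ := Finset.prod_eq_zero_iff.1 h1
  rw [mul_zero] at hc
  exact sub_eq_zero.1 hc

namespace IsTameDomain

variable {X U : Set ℂ} {φ ψ F : ℂ → ℂ}

/-- Points outside of a crosscut that begins and ends at the same boundary point can be separated
from it on both sides. -/
theorem exists_hasLogOn_segment (h : IsTameDomain X U) (hp : IsDiscParam U φ ψ)
    (hFc : ContinuousOn F (closedBall 0 1)) (hFφ : EqOn F φ (ball 0 1))
    (hFX : MapsTo F (sphere 0 1) X) {u v : ℂ} (hu : ‖u‖ = 1) (hv : ‖v‖ = 1) (huv : u ≠ v)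
    (hFuv : F u = F v) :
    ∃ a ∈ φ '' (ball 0 1 ∩ {z | 0 < side u v z}),
      HasLogOn (F '' segment ℝ u v) fun z => z - a := by
  have hDc : DiffContOnCl ℂ F (ball 0 1) :=
    ⟨hp.diff.congr hFφ, by rwa [closure_ball _ one_ne_zero]⟩
  have hsegb : segment ℝ u v ⊆ closedBall 0 1 :=
    (convex_closedBall (0 : ℂ) 1).segment_subset (by simp [hu]) (by simp [hv])
  have hJ : IsCompact (F '' segment ℝ u v) := by
    refine IsCompact.image_of_continuousOn ?_ (hFc.mono hsegb)
    rw [segment_eq_image']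
    exact isCompact_Icc.image (by fun_prop)
  have hJX : ∀ x ∈ F '' segment ℝ u v, x ∈ X → x = F u := by
    rintro _ ⟨z, hz, rfl⟩ hzX
    by_contra hne
    have hzu : z ≠ u := fun e => hne (by rw [e])
    have hzv : z ≠ v := fun e => hne (by rw [e, hFuv])
    have hz1 : z ∈ ball (0 : ℂ) 1 :=
      mem_ball_zero_iff.2 (norm_lt_one_of_mem_segment hu hv hz hzu hzv)
    rw [hFφ hz1] at hzX
    exact disjoint_left.1 h.disjoint (hp.mapsTo hz1) hzX
  have hopen : IsOpen {z | 0 < side u v z} := isOpen_lt continuous_const (continuous_side u v)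
  obtain ⟨w, hw1, hws, hwF⟩ : ∃ w, ‖w‖ = 1 ∧ 0 < side u v w ∧ F w ≠ F u := by
    by_contra! hno
    obtain ⟨w₀, hw₀, hs₀⟩ := exists_side_pos hu hv huv
    have h0 := eq_of_eqOn_arc hDc hopen hw₀ hs₀ fun w hw hw1 => hno w hw1 hw
    rw [hFφ (mem_ball_self one_pos)] at h0
    exact disjoint_left.1 h.disjoint (hp.mapsTo (mem_ball_self one_pos))
      (h0 ▸ hFX (mem_sphere_zero_iff_norm.2 hu))
  have hwX : F w ∈ X := hFX (mem_sphere_zero_iff_norm.2 hw1)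
  have hwJ : F w ∉ F '' segment ℝ u v := fun hJ' => hwF (hJX _ hJ' hwX)
  have hlog : HasLogOn (F '' segment ℝ u v) fun z => z - F w := by
    obtain ⟨R, hR⟩ := hJ.isBounded.subset_ball 0
    obtain ⟨x, hx, hxR⟩ : ∃ x ∈ X, max R (‖F u‖ + 1) ≤ ‖x‖ := by
      by_contra! hno
      exact h.not_isBounded (Metric.isBounded_ball.subset fun x hx =>
        mem_ball_zero_iff.2 (hno x hx))
    have hx1 : x ∈ X \ {F u} := ⟨hx, fun e => by
      rw [mem_singleton_iff.1 e] at hxR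
      linarith [le_max_right R (‖F u‖ + 1)]⟩
    have := HasLogOn.of_isPreconnected hJ.isClosed (φ := fun _ => 1) (h.isPreconnected_diff (F u))
      (disjoint_left.2 fun y hy hyJ => hy.2 (hJX y hyJ hy.1)) hx1 ⟨hwX, hwF⟩ (by
        simp only [mul_one]
        exact HasLogOn.sub_of_subset_ball hR (by
          rw [sub_zero]; exact (le_max_left _ _).trans hxR))
    simpa only [mul_one] using this
  have hev := HasLogOn.eventually_iff hJ.isClosed (φ := fun _ => 1) hwJ
  simp only [mul_one] at hev
  have hwcl : w ∈ closure (ball (0 : ℂ) 1) := by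
    rw [closure_ball _ one_ne_zero]; simp [hw1]
  have hne : (𝓝[ball 0 1] w).NeBot := mem_closure_iff_nhdsWithin_neBot.1 hwcl
  have hlim : Tendsto F (𝓝[ball 0 1] w) (𝓝 (F w)) :=
    (hFc w (by simp [hw1])).mono_left (nhdsWithin_mono _ ball_subset_closedBall)
  have hev₂ : ∀ᶠ z in 𝓝[ball 0 1] w, z ∈ ball (0 : ℂ) 1 := self_mem_nhdsWithin
  have hev₃ : ∀ᶠ z in 𝓝[ball 0 1] w, 0 < side u v z := nhdsWithin_le_nhds (hopen.mem_nhds hws)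
  obtain ⟨z, hz, hz1, hzs⟩ := ((hlim.eventually hev).and (hev₂.and hev₃)).exists
  refine ⟨φ z, ⟨z, ⟨hz1, hzs⟩, rfl⟩, ?_⟩
  rw [← hFφ hz1]
  exact hz.2 hlog

theorem injOn_sphere (h : IsTameDomain X U) (hp : IsDiscParam U φ ψ)
    (hFc : ContinuousOn F (closedBall 0 1)) (hFφ : EqOn F φ (ball 0 1))
    (hFX : MapsTo F (sphere 0 1) X) : InjOn F (sphere 0 1) := by
  intro u hu v hv hFuv
  by_contra huv
  rw [mem_sphere_zero_iff_norm] at hu hv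
  obtain ⟨_, ⟨a, ha, rfl⟩, haJ⟩ := h.exists_hasLogOn_segment hp hFc hFφ hFX hu hv huv hFuv
  obtain ⟨_, ⟨b, hb, rfl⟩, hbJ⟩ := h.exists_hasLogOn_segment hp hFc hFφ hFX hv hu (Ne.symm huv)
    hFuv.symm
  rw [segment_symm] at hbJ
  have hopen : IsOpen {z | 0 < side u v z} := isOpen_lt continuous_const (continuous_side u v)
  have hbs : side u v b < 0 := by
    have := hb.2
    rw [mem_ofPred_eq, side_swap] at this
    linarith
  have hsegb : segment ℝ u v ⊆ closedBall 0 1 :=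
    (convex_closedBall (0 : ℂ) 1).segment_subset (by simp [hu]) (by simp [hv])
  have hJ : IsCompact (F '' segment ℝ u v) := by
    refine IsCompact.image_of_continuousOn ?_ (hFc.mono hsegb)
    rw [segment_eq_image']
    exact isCompact_Icc.image (by fun_prop)
  have hsegs : ∀ z ∈ segment ℝ u v, side u v z = 0 := by
    rw [segment_eq_image']
    rintro _ ⟨t, -, rfl⟩
    simp [side]
    ring
  have hcase : ∀ z ∈ segment ℝ u v, F z = F u ∧ F u ∈ X ∨ z ∈ ball (0 : ℂ) 1 := fun z hz => by
    have huX : F u ∈ X := hFX (mem_sphere_zero_iff_norm.2 hu)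
    by_cases hzu : z = u
    · exact Or.inl ⟨by rw [hzu], huX⟩
    by_cases hzv : z = v
    · exact Or.inl ⟨by rw [hzv, hFuv], huX⟩
    exact Or.inr (mem_ball_zero_iff.2 (norm_lt_one_of_mem_segment hu hv hz hzu hzv))
  have hJX : F '' segment ℝ u v ∩ X = {F u} := by
    refine Subset.antisymm ?_ ?_
    · rintro _ ⟨⟨z, hz, rfl⟩, hzX⟩
      rcases hcase z hz with h1 | h1
      · exact h1.1
      · rw [hFφ h1] at hzX
        exact absurd hzX (disjoint_left.1 h.disjoint (hp.mapsTo h1))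
    · rintro _ rfl
      exact ⟨⟨u, left_mem_segment ℝ u v, rfl⟩, hFX (mem_sphere_zero_iff_norm.2 hu)⟩
  set O := φ '' (ball 0 1 ∩ {z | 0 < side u v z}) with hO
  have hOU : O ⊆ U := by
    rintro _ ⟨z, hz, rfl⟩
    exact hp.mapsTo hz.1
  have hbU : φ b ∈ U := hp.mapsTo hb.1
  refine not_hasLogOn_div (K := F '' segment ℝ u v ∪ X) (O := O) (a := φ a) (b := φ b)
    (hJ.isClosed.union h.isClosed) (h.isBounded.subset hOU) ?_ ⟨a, ha, rfl⟩ ?_ ?_ ?_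
  · refine (hp.frontier_image_subset h.isOpen hopen).trans (union_subset
      (h.frontier_subset.trans subset_union_right) ?_)
    refine Subset.trans ?_ subset_union_left
    rintro _ ⟨z, ⟨hz, hzc, hzn⟩, rfl⟩
    have h1 : 0 ≤ side u v z :=
      (closure_lt_subset_le continuous_const (continuous_side u v) hzc : _)
    have h2 : side u v z = 0 := le_antisymm (not_lt.1 hzn) h1
    exact ⟨z, mem_openSegment_of_side_eq_zero hu hv huv (mem_ball_zero_iff.1 hz) h2, hFφ hz⟩
  · rintro ⟨z, hz, hzb⟩
    rw [hp.left_inv.injOn hz.1 hb.1 hzb] at hz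
    exact lt_asymm hbs hz.2
  · rintro (⟨z, hz, hzb⟩ | h1)
    · rcases hcase z hz with h2 | h2
      · rw [h2.1] at hzb
        exact disjoint_left.1 h.disjoint hbU (hzb ▸ h2.2)
      · rw [hFφ h2] at hzb
        rw [← hp.left_inv.injOn h2 hb.1 hzb] at hbs
        exact hbs.ne (hsegs z hz)
    · exact disjoint_left.1 h.disjoint hbU h1
  · refine HasLogOn.union (haJ.div hbJ) (HasLogOn.div_of_isPreconnected h.isClosed
      h.isPreconnected_dom h.disjoint (hp.mapsTo ha.1) hbU) hJ.isClosed h.isClosed ?_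
    rw [hJX]
    exact isPreconnected_singleton

/-- The closure of a tame domain is a disc. -/
theorem nonempty_homeomorph (h : IsTameDomain X U) (hne : U.Nonempty) :
    Nonempty (closure U ≃ₜ closedBall (0 : ℂ) 1) := by
  obtain ⟨φ, ψ, hp⟩ := h.exists_isDiscParam hne
  have hcl : closure (ball (0 : ℂ) 1) = closedBall 0 1 := closure_ball _ one_ne_zero
  set F := extendFrom (ball (0 : ℂ) 1) φ with hF
  have hlim : ∀ ζ ∈ closedBall (0 : ℂ) 1, Tendsto φ (𝓝[ball 0 1] ζ) (𝓝 (F ζ)) := fun ζ hζ =>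
    tendsto_extendFrom (h.exists_tendsto hp hζ)
  have hFc : ContinuousOn F (closedBall 0 1) :=
    continuousOn_extendFrom hcl.ge fun ζ hζ => h.exists_tendsto hp hζ
  have hFφ : EqOn F φ (ball 0 1) := fun z hz =>
    extendFrom_eq (subset_closure hz) ((hp.continuousAt hz).mono_left nhdsWithin_le_nhds)
  have hneb : ∀ ζ ∈ closedBall (0 : ℂ) 1, (𝓝[ball 0 1] ζ).NeBot := fun ζ hζ =>
    mem_closure_iff_nhdsWithin_neBot.1 (hcl.ge hζ)
  have hFcl : MapsTo F (closedBall 0 1) (closure U) := fun ζ hζ => by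
    have := hneb ζ hζ
    refine mem_closure_of_tendsto (hlim ζ hζ) ?_
    filter_upwards [self_mem_nhdsWithin] with z hz
    exact hp.mapsTo hz
  have hFU : ∀ ζ ∈ sphere (0 : ℂ) 1, F ζ ∉ U := fun ζ hζ => by
    have := hneb ζ (sphere_subset_closedBall hζ)
    refine hp.notMem_of_tendsto h.isOpen le_rfl ?_ (hlim ζ (sphere_subset_closedBall hζ))
    rw [mem_ball_zero_iff, mem_sphere_zero_iff_norm.1 hζ]
    exact lt_irrefl 1
  have hFX : MapsTo F (sphere 0 1) X := fun ζ hζ => by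
    refine h.frontier_subset ?_
    rw [h.isOpen.frontier_eq]
    exact ⟨hFcl (sphere_subset_closedBall hζ), hFU ζ hζ⟩
  have hinj : InjOn F (closedBall 0 1) := by
    intro x hx y hy hxy
    rw [← ball_union_sphere] at hx hy
    rcases hx with hx | hx <;> rcases hy with hy | hy
    · rw [hFφ hx, hFφ hy] at hxy
      exact hp.left_inv.injOn hx hy hxy
    · exact absurd (hxy ▸ hFφ hx ▸ hp.mapsTo hx) (hFU y hy)
    · exact absurd (hxy ▸ hFφ hy ▸ hp.mapsTo hy) (hFU x hx)
    · exact h.injOn_sphere hp hFc hFφ hFX hx hy hxy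
  have hsurj : SurjOn F (closedBall 0 1) (closure U) := by
    refine closure_minimal (fun y hy => ?_)
      ((isCompact_closedBall (0 : ℂ) 1).image_of_continuousOn hFc).isClosed
    have := hp.mapsTo_inv hy
    exact ⟨ψ y, ball_subset_closedBall this, by rw [hFφ this, hp.right_inv hy]⟩
  let e : closedBall (0 : ℂ) 1 ≃ closure U := BijOn.equiv F ⟨hFcl, hinj, hsurj⟩
  have hec : Continuous e := by
    refine Continuous.subtype_mk ?_ _
    exact continuousOn_iff_continuous_domRestrict.1 hFc
  have : CompactSpace (closedBall (0 : ℂ) 1) :=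
    isCompact_iff_compactSpace.1 (isCompact_closedBall _ _)
  exact ⟨(hec.homeoOfEquivCompactToT2).symm⟩

end IsTameDomain

section

/-- Multiplication by a root of `x² - A x + B`, written in the basis `1`, `α` of the plane. -/
def alpha (A B : ℤ) : Module.End ℝ ℂ where
  toFun z := ⟨-B * z.im, z.re + A * z.im⟩
  map_add' x y := by apply Complex.ext <;> simp <;> ring
  map_smul' r x := by apply Complex.ext <;> simp <;> ring

/-- The inverse of `alpha A B` for `B ≠ 0`. -/
def beta (A B : ℤ) : Module.End ℝ ℂ where
  toFun z := ⟨z.im + A / B * z.re, -z.re / B⟩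
  map_add' x y := by apply Complex.ext <;> simp <;> ring
  map_smul' r x := by apply Complex.ext <;> simp <;> ring

variable {A B : ℤ} {T : Set ℂ}

@[simp] theorem alpha_re (z : ℂ) : (alpha A B z).re = -B * z.im := rfl
@[simp] theorem alpha_im (z : ℂ) : (alpha A B z).im = z.re + A * z.im := rfl
@[simp] theorem beta_re (z : ℂ) : (beta A B z).re = z.im + A / B * z.re := rfl
@[simp] theorem beta_im (z : ℂ) : (beta A B z).im = -z.re / B := rfl

theorem alpha_beta (hB : B ≠ 0) (z : ℂ) : alpha A B (beta A B z) = z := by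
  have : (B : ℝ) ≠ 0 := by exact_mod_cast hB
  apply Complex.ext <;> simp <;> field_simp
  ring

theorem beta_alpha (hB : B ≠ 0) (z : ℂ) : beta A B (alpha A B z) = z := by
  have : (B : ℝ) ≠ 0 := by exact_mod_cast hB
  apply Complex.ext <;> simp <;> field_simp
  ring

theorem alpha_pow_beta_pow (hB : B ≠ 0) (n : ℕ) (z : ℂ) :
    (alpha A B ^ n) ((beta A B ^ n) z) = z := by
  induction n generalizing z with
  | zero => simp
  | succ n ih =>
    rw [pow_succ, pow_succ', Module.End.mul_apply, Module.End.mul_apply, alpha_beta hB, ih]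

theorem beta_pow_alpha_pow (hB : B ≠ 0) (n : ℕ) (z : ℂ) :
    (beta A B ^ n) ((alpha A B ^ n) z) = z := by
  induction n generalizing z with
  | zero => simp
  | succ n ih =>
    rw [pow_succ, pow_succ', Module.End.mul_apply, Module.End.mul_apply, beta_alpha hB, ih]

/-- Solutions of a Schur stable linear recurrence of order two tend to zero. -/
theorem tendsto_zero_of_recurrence {u : ℕ → ℝ} {τ δ : ℝ} (hδ : 0 < δ) (hδ1 : δ < 1)
    (hτ : |τ| ≤ 1) (hu : ∀ n, u (n + 2) = τ * u (n + 1) - δ * u n) :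
    Tendsto u atTop (𝓝 0) := by
  set V : ℕ → ℝ := fun n =>
    (1 + δ) * (u n ^ 2 + u (n + 1) ^ 2) - 2 * τ * (u n * u (n + 1)) with hV
  set s : ℕ → ℝ := fun n => u n - u (n + 2) with hs
  have hstep : ∀ n, V n - V (n + 1) = (1 - δ) * s n ^ 2 := fun n => by
    simp only [hV, hs, show n + 1 + 1 = n + 2 from rfl, hu n]
    ring
  have hτ2 : τ ^ 2 ≤ 1 := (sq_le_one_iff_abs_le_one τ).2 hτ
  have hV0 : ∀ n, 0 ≤ V n := fun n => by
    obtain ⟨h1, h2⟩ := abs_le.1 hτ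
    have : 0 ≤ (1 + τ) * (u n - u (n + 1)) ^ 2 + (1 - τ) * (u n + u (n + 1)) ^ 2 :=
      add_nonneg (mul_nonneg (by linarith) (sq_nonneg _)) (mul_nonneg (by linarith) (sq_nonneg _))
    simp only [hV]
    nlinarith [sq_nonneg (u n), sq_nonneg (u (n + 1))]
  have hanti : Antitone V := antitone_nat_of_succ_le fun n => by
    have := hstep n
    nlinarith [mul_nonneg (sub_nonneg.2 hδ1.le) (sq_nonneg (s n))]
  have hVlim : Tendsto V atTop (𝓝 (⨅ n, V n)) :=
    tendsto_atTop_ciInf hanti ⟨0, by rintro _ ⟨n, rfl⟩; exact hV0 n⟩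
  have hs2 : Tendsto (fun n => s n ^ 2) atTop (𝓝 0) := by
    have := (hVlim.sub (hVlim.comp (tendsto_add_atTop_nat 1))).div_const (1 - δ)
    rw [sub_self, zero_div] at this
    refine this.congr fun n => ?_
    have h1 : (1 - δ) ≠ 0 := by linarith
    simp only [Function.comp_apply, hstep]
    field_simp
  have hs0 : Tendsto s atTop (𝓝 0) := by
    have := hs2.sqrt
    simp only [Real.sqrt_sq_eq_abs, Real.sqrt_zero] at this
    exact tendsto_zero_iff_abs_tendsto_zero s |>.2 this
  have hdet : 0 < (1 + δ) ^ 2 - τ ^ 2 := by nlinarith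
  have hfin : Tendsto (fun n => ((1 + δ - τ ^ 2) * s n + τ * s (n + 1)) / ((1 + δ) ^ 2 - τ ^ 2))
      atTop (𝓝 0) := by
    have := ((hs0.const_mul (1 + δ - τ ^ 2)).add
      ((hs0.comp (tendsto_add_atTop_nat 1)).const_mul τ)).div_const ((1 + δ) ^ 2 - τ ^ 2)
    simpa using this
  refine hfin.congr fun n => ?_
  rw [div_eq_iff hdet.ne']
  simp only [hs, hu (n + 1), hu n, show n + 1 + 1 = n + 2 from rfl]
  ring

theorem tendsto_beta_pow (hB : 2 ≤ B) (hA : |A| ≤ B) (z : ℂ) :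
    Tendsto (fun n => (beta A B ^ n) z) atTop (𝓝 0) := by
  have hB' : (2 : ℝ) ≤ B := by exact_mod_cast hB
  have hA' : |(A : ℝ)| ≤ B := by exact_mod_cast hA
  have h0 : (B : ℝ) ≠ 0 := by linarith
  have hrec : ∀ n, (beta A B ^ (n + 2)) z =
      ((A / B : ℝ) : ℂ) * (beta A B ^ (n + 1)) z - ((1 / B : ℝ) : ℂ) * (beta A B ^ n) z := by
    intro n
    simp only [pow_succ', Module.End.mul_apply]
    generalize (beta A B ^ n) z = w
    apply Complex.ext
    · simp only [beta_re, beta_im, Complex.sub_re, Complex.re_ofReal_mul]; field_simp; ring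
    · simp only [beta_re, beta_im, Complex.sub_im, Complex.im_ofReal_mul]; field_simp; ring
  have hτ : |(A / B : ℝ)| ≤ 1 := by
    rw [abs_div, abs_of_pos (by linarith : (0:ℝ) < B), div_le_one (by linarith)]; exact hA'
  have hδ : (0 : ℝ) < 1 / B := by positivity
  have hδ1 : (1 / B : ℝ) < 1 := by rw [div_lt_one (by linarith)]; linarith
  have hre := tendsto_zero_of_recurrence (u := fun n => ((beta A B ^ n) z).re) hδ hδ1 hτ
    fun n => by
      simp only [hrec n, Complex.sub_re, Complex.re_ofReal_mul]
  have him := tendsto_zero_of_recurrence (u := fun n => ((beta A B ^ n) z).im) hδ hδ1 hτ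
    fun n => by
      simp only [hrec n, Complex.sub_im, Complex.im_ofReal_mul]
  have := (Complex.continuous_ofReal.tendsto 0).comp hre |>.add
    (((Complex.continuous_ofReal.tendsto 0).comp him).mul_const Complex.I)
  simpa [Function.comp_def, Complex.re_add_im] using this

theorem exists_norm_beta_pow_lt (hB : 2 ≤ B) (hA : |A| ≤ B) (R : ℝ) {ε : ℝ} (hε : 0 < ε) :
    ∃ n₀, ∀ n ≥ n₀, ∀ z : ℂ, ‖z‖ ≤ R → ‖(beta A B ^ n) z‖ < ε := by
  have h1 := (tendsto_beta_pow hB hA 1).norm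
  have h2 := (tendsto_beta_pow hB hA Complex.I).norm
  have h := ((h1.add h2).const_mul (|R| + 1))
  rw [norm_zero, add_zero, mul_zero] at h
  obtain ⟨n₀, hn₀⟩ := eventually_atTop.1 (h.eventually (gt_mem_nhds hε))
  refine ⟨n₀, fun n hn z hz => lt_of_le_of_lt ?_ (hn₀ n hn)⟩
  have hz' : z = z.re • (1 : ℂ) + z.im • Complex.I := by
    rw [Complex.real_smul, Complex.real_smul, mul_one, Complex.re_add_im]
  rw [hz', map_add, map_smul, map_smul, mul_add]
  refine (norm_add_le _ _).trans (add_le_add ?_ ?_) <;> rw [norm_smul] <;>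
    refine mul_le_mul_of_nonneg_right ?_ (norm_nonneg _)
  · exact (Complex.abs_re_le_norm z).trans (by linarith [le_abs_self R])
  · exact (Complex.abs_im_le_norm z).trans (by linarith [le_abs_self R])

/-- A bounded set each of whose points can be moved inside the set by `x ↦ ε • α x - j` with a
digit `j` is contained in every compact nonempty set with the reverse property. -/
theorem subset_of_forall_exists_digit (hB : 2 ≤ B) (hA : |A| ≤ B) {ε : ℝ} (hε : |ε| = 1)
    (hne : T.Nonempty) (hT : IsCompact T)
    (hmem : ∀ x, ∀ j : ℤ, 0 ≤ j → j < B → ε • alpha A B x - j ∈ T → x ∈ T)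
    {S : Set ℂ} (hS : Bornology.IsBounded S)
    (h : ∀ x ∈ S, ∃ j : ℤ, 0 ≤ j ∧ j < B ∧ ε • alpha A B x - j ∈ S) : S ⊆ T := by
  obtain ⟨t, ht⟩ := hne
  obtain ⟨R, hR⟩ := hS.exists_norm_le
  have hB0 : B ≠ 0 := by omega
  have hε2 : ε * ε = 1 := by rw [← abs_mul_abs_self, hε, one_mul]
  have key : ∀ n : ℕ, ∀ x ∈ S, ∃ y ∈ T, ∃ w : ℂ, ‖w‖ ≤ R + ‖t‖ ∧
      x = y + (beta A B ^ n) w := by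
    intro n
    induction n with
    | zero =>
      intro x hx
      refine ⟨t, ht, x - t, (norm_sub_le _ _).trans (by linarith [hR x hx]), by simp⟩
    | succ n ih =>
      intro x hx
      obtain ⟨j, hj, hjB, hjS⟩ := h x hx
      obtain ⟨y, hy, w, hw, hxy⟩ := ih _ hjS
      refine ⟨ε • beta A B (y + j), hmem _ j hj hjB ?_, ε • w, ?_, ?_⟩
      · rw [map_smul, alpha_beta hB0, smul_smul, hε2, one_smul, add_sub_cancel_right]
        exact hy
      · rwa [norm_smul, Real.norm_eq_abs, hε, one_mul]
      · rw [pow_succ', Module.End.mul_apply, map_smul, map_smul, ← smul_add, ← map_add,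
          add_right_comm, ← hxy, sub_add_cancel, map_smul, beta_alpha hB0, smul_smul, hε2, one_smul]
  intro x hx
  rw [← hT.isClosed.closure_eq, Metric.mem_closure_iff]
  intro e he
  obtain ⟨n, hn⟩ := exists_norm_beta_pow_lt hB hA (R + ‖t‖) he
  obtain ⟨y, hy, w, hw, hxy⟩ := key n x hx
  refine ⟨y, hy, ?_⟩
  rw [dist_eq_norm, hxy, add_sub_cancel_left]
  exact hn n le_rfl w hw

end

section
variable {A B : ℤ} {T : Set ℂ}

/-- The self-affine tile of `alpha A B` with digits `0, …, B - 1`, in the two cases under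
consideration. -/
structure IsTile (A B : ℤ) (T : Set ℂ) : Prop where
  three_le : 3 ≤ A
  le : A ≤ B
  two_mul_sub : 2 * A - B = 3 ∨ 2 * A - B = 4
  nonempty : T.Nonempty
  isCompact : IsCompact T
  mem_iff : ∀ x, x ∈ T ↔ ∃ j : ℤ, 0 ≤ j ∧ j < B ∧ alpha A B x - j ∈ T

/-- The point all of whose digits are equal to `j`. -/
def fixedPt (A B j : ℤ) : ℂ := ⟨j * (A - 1) / (B - A + 1), -j / (B - A + 1)⟩

/-- The translates `T` and `T + s` share at least two points. -/
def Touch (T : Set ℂ) (s : ℂ) : Prop :=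
  ∃ p q, p ≠ q ∧ (p ∈ T ∧ p - s ∈ T) ∧ q ∈ T ∧ q - s ∈ T

/-- The piece of `T` with first digit `i` and the translate `T + s` share at least two points. -/
def TouchAt (A B : ℤ) (T : Set ℂ) (i : ℤ) (s : ℂ) : Prop :=
  ∃ p q, p ≠ q ∧ (alpha A B p - i ∈ T ∧ p - s ∈ T) ∧ alpha A B q - i ∈ T ∧ q - s ∈ T

theorem Touch.neg {s : ℂ} (h : Touch T s) : Touch T (-s) := by
  obtain ⟨p, q, hpq, ⟨hp, hp'⟩, hq, hq'⟩ := h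
  refine ⟨p - s, q - s, fun e => hpq (sub_left_injective e), ⟨hp', by simpa⟩, hq', by simpa⟩

namespace IsTile

variable (h : IsTile A B T)
include h

theorem two_le : 2 ≤ B := by have := h.three_le; have := h.le; omega

theorem ne_zero : B ≠ 0 := by have := h.two_le; omega

theorem abs_le : |A| ≤ B := by
  rw [abs_of_nonneg (by have := h.three_le; omega)]; exact h.le

theorem pos_real : (0 : ℝ) < B - A + 1 := by
  have : (A : ℝ) ≤ B := by exact_mod_cast h.le
  linarith

theorem mem_of_digit {x : ℂ} {j : ℤ} (h0 : 0 ≤ j) (hj : j < B) (hx : alpha A B x - j ∈ T) :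
    x ∈ T :=
  (h.mem_iff x).2 ⟨j, h0, hj, hx⟩

theorem subset_of_forall {S : Set ℂ} (hS : Bornology.IsBounded S)
    (hj : ∀ x ∈ S, ∃ j : ℤ, 0 ≤ j ∧ j < B ∧ alpha A B x - j ∈ S) : S ⊆ T :=
  subset_of_forall_exists_digit h.two_le h.abs_le (ε := 1) abs_one h.nonempty h.isCompact
    (fun x j h0 h1 hx => h.mem_of_digit h0 h1 (by simpa using hx)) hS (by simpa using hj)

theorem alpha_fixedPt (j : ℤ) : alpha A B (fixedPt A B j) - j = fixedPt A B j := by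
  have := h.pos_real.ne'
  apply Complex.ext <;> simp [fixedPt] <;> (field_simp; ring)

theorem fixedPt_mem {j : ℤ} (h0 : 0 ≤ j) (hj : j < B) : fixedPt A B j ∈ T :=
  h.subset_of_forall (S := {fixedPt A B j}) Bornology.isBounded_singleton
    (fun x hx => ⟨j, h0, hj, by rw [mem_singleton_iff.1 hx, h.alpha_fixedPt]; rfl⟩) rfl

theorem fixedPt_injective : Function.Injective (fixedPt A B) := fun i j hij => by
  have := h.pos_real.ne'
  have h2 := congrArg Complex.im hij
  simp only [fixedPt, div_left_inj' this, neg_inj] at h2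
  exact_mod_cast h2

theorem sub_mem {x : ℂ} (hx : x ∈ T) : fixedPt A B (B - 1) - x ∈ T := by
  refine h.subset_of_forall (S := (fun y => fixedPt A B (B - 1) - y) '' T)
    ((h.isCompact.image (by fun_prop)).isBounded) ?_ ⟨x, hx, rfl⟩
  rintro _ ⟨y, hy, rfl⟩
  obtain ⟨j, hj, hjB, hyj⟩ := (h.mem_iff y).1 hy
  refine ⟨B - 1 - j, by omega, by omega, _, hyj, ?_⟩
  have := h.alpha_fixedPt (B - 1)
  simp only [map_sub]
  push_cast at this ⊢
  linear_combination -this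

theorem touch_c : Touch T ⟨1 - A, 1⟩ := by
  have h3 := h.three_le
  have hle := h.le
  have hpos := h.pos_real.ne'
  have key : ∀ j : ℤ, fixedPt A B j - ⟨1 - A, 1⟩ = fixedPt A B (j + (B - A + 1)) := fun j => by
    apply Complex.ext <;> simp [fixedPt] <;> field_simp <;> ring
  refine ⟨fixedPt A B 0, fixedPt A B 1, fun e => by simpa using h.fixedPt_injective e,
    ⟨h.fixedPt_mem le_rfl (by omega), ?_⟩, h.fixedPt_mem (by omega) (by omega), ?_⟩ <;>
  · rw [key]
    exact h.fixedPt_mem (by omega) (by omega)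

theorem touchAt_of_eq {s s' : ℂ} {i j : ℤ} (hs : Touch T s') (hj : 0 ≤ j) (hjB : j < B)
    (hss : alpha A B s + j - i = s') : TouchAt A B T i s := by
  obtain ⟨p, q, hpq, ⟨hp, hp'⟩, hq, hq'⟩ := hs
  have key : ∀ y, y - s' ∈ T → beta A B (y + i) - s ∈ T := fun y hy => by
    refine h.mem_of_digit hj hjB ?_
    rw [map_sub, alpha_beta h.ne_zero]
    rwa [← hss, show y - (alpha A B s + j - i) = y + i - alpha A B s - j by ring] at hy
  refine ⟨beta A B (p + i), beta A B (q + i), fun e => hpq ?_, ⟨?_, key p hp'⟩, ?_, key q hq'⟩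
  · have := congrArg (alpha A B) e
    rw [alpha_beta h.ne_zero, alpha_beta h.ne_zero] at this
    exact add_right_cancel this
  · rwa [alpha_beta h.ne_zero, add_sub_cancel_right]
  · rwa [alpha_beta h.ne_zero, add_sub_cancel_right]

theorem touch_of_touchAt {s : ℂ} {i : ℤ} (hi : 0 ≤ i) (hiB : i < B) (hs : TouchAt A B T i s) :
    Touch T s := by
  obtain ⟨p, q, hpq, ⟨hp, hp'⟩, hq, hq'⟩ := hs
  exact ⟨p, q, hpq, ⟨h.mem_of_digit hi hiB hp, hp'⟩, h.mem_of_digit hi hiB hq, hq'⟩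

/-- The translates `T` and `T + 2 * c` meet in `0`. -/
theorem neg_two_c_mem : -(⟨2 * (1 - A), 2⟩ : ℂ) ∈ T := by
  have h3 := h.three_le
  have hle := h.le
  have h34 := h.two_mul_sub
  have hpos := h.pos_real.ne'
  have key : -(⟨2 * (1 - A), 2⟩ : ℂ) = fixedPt A B (2 * (B - A + 1)) := by
    apply Complex.ext <;> simp [fixedPt] <;> field_simp
    ring
  rw [key]
  exact h.fixedPt_mem (by omega) (by omega)

theorem zero_mem : (0 : ℂ) ∈ T := by
  have := h.fixedPt_mem le_rfl (by have := h.two_le; omega)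
  rwa [show fixedPt A B 0 = 0 by apply Complex.ext <;> simp [fixedPt]] at this

theorem touch_one_add_c : Touch T ⟨2 - A, 1⟩ := by
  have h3 := h.three_le
  have hle := h.le
  have h34 := h.two_mul_sub
  have hdig : ∀ i : ℤ, 2 * A - 2 - B ≤ i → i < B →
      beta A B i ∈ T ∧ beta A B i - ⟨2 - A, 1⟩ ∈ T := fun i hi hiB => by
    constructor
    · refine h.mem_of_digit (j := i) (by omega) hiB ?_
      rw [alpha_beta h.ne_zero, sub_self]
      exact h.zero_mem
    · refine h.mem_of_digit (j := i - (2 * A - 2 - B)) (by omega) (by omega) ?_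
      rw [map_sub, alpha_beta h.ne_zero]
      convert h.neg_two_c_mem using 1
      apply Complex.ext <;> simp
      ring
  refine ⟨_, _, fun e => ?_, hdig (2 * A - 2 - B) le_rfl (by omega),
    hdig (2 * A - 2 - B + 1) (by omega) (by omega)⟩
  have := congrArg (alpha A B) e
  rw [alpha_beta h.ne_zero, alpha_beta h.ne_zero] at this
  have : (2 * A - 2 - B : ℤ) = 2 * A - 2 - B + 1 := by exact_mod_cast this
  omega

theorem touchAt_one {i : ℤ} (hi : A - 2 ≤ i) (hiB : i < B) : TouchAt A B T i 1 := by
  have h3 := h.three_le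
  rcases hi.eq_or_lt with rfl | hi
  · refine h.touchAt_of_eq (j := 0) h.touch_one_add_c le_rfl (by omega) ?_
    apply Complex.ext <;> simp
  · refine h.touchAt_of_eq (j := i - (A - 1)) h.touch_c (by omega) (by omega) ?_
    apply Complex.ext <;> simp

theorem touchAt_neg_one {i : ℤ} (hi : 0 ≤ i) (hiB : i ≤ B - A + 1) : TouchAt A B T i (-1) := by
  have h3 := h.three_le
  obtain ⟨p, q, hpq, ⟨hp, hp'⟩, hq, hq'⟩ :=
    h.touchAt_one (i := B - 1 - i) (by omega) (by omega)
  have key : ∀ x, alpha A B x - (B - 1 - i : ℤ) ∈ T → x - 1 ∈ T →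
      alpha A B (fixedPt A B (B - 1) - x) - i ∈ T ∧ fixedPt A B (B - 1) - x - -1 ∈ T := by
    intro x hx hx'
    have hκ := h.alpha_fixedPt (B - 1)
    constructor
    · convert h.sub_mem hx using 1
      simp only [map_sub]
      push_cast at hκ ⊢
      linear_combination hκ
    · convert h.sub_mem hx' using 1
      ring
  exact ⟨_, _, fun e => hpq (sub_right_injective e), key p hp hp', key q hq hq'⟩

theorem touch_one : Touch T 1 :=
  h.touch_of_touchAt (i := B - 1) (by have := h.two_le; omega) (by omega)
    (h.touchAt_one (by have := h.le; omega) (by omega))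

theorem touch_b : Touch T ⟨-A, 1⟩ := by
  have h2 := h.two_le
  refine h.touch_of_touchAt (i := 0) le_rfl (by omega)
    (h.touchAt_of_eq (j := B - 1) h.touch_one.neg (by omega) (by omega) ?_)
  apply Complex.ext
  · simp; ring
  · simp

omit h in
/-- Both points of `T` and sharing their first `n` digits. -/
def _root_.SameDigits (A B : ℤ) (T : Set ℂ) : ℕ → ℂ → ℂ → Prop
  | 0, z, w => z ∈ T ∧ w ∈ T
  | n + 1, z, w => ∃ j : ℤ, 0 ≤ j ∧ j < B ∧
      SameDigits A B T n (alpha A B z - j) (alpha A B w - j)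

theorem exists_of_sameDigits (n : ℕ) {z w : ℂ} (hzw : SameDigits A B T n z w) :
    z ∈ T ∧ w ∈ T ∧ ∃ x ∈ T, ∃ y ∈ T, z - w = (beta A B ^ n) (x - y) := by
  induction n generalizing z w with
  | zero => exact ⟨hzw.1, hzw.2, z, hzw.1, w, hzw.2, by simp⟩
  | succ n ih =>
    obtain ⟨j, h0, hj, hn⟩ := hzw
    obtain ⟨hz, hw, x, hx, y, hy, hxy⟩ := ih hn
    refine ⟨h.mem_of_digit h0 hj hz, h.mem_of_digit h0 hj hw, x, hx, y, hy, ?_⟩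
    rw [pow_succ', Module.End.mul_apply, ← hxy, sub_sub_sub_cancel_right, ← map_sub,
      beta_alpha h.ne_zero]

/-- A function that is constant on each piece away from a point is constant away from the point. -/
theorem eq_of_forall_digit {β : Type*} {f : ℂ → β} {x : ℂ} {m M : ℤ}
    (hf : ∀ j : ℤ, m ≤ j → j < M → ∀ z w, alpha A B z - j ∈ T → alpha A B w - j ∈ T →
      z ≠ x → w ≠ x → f z = f w) {i j : ℤ} (hi : m ≤ i) (hiM : i < M) (hj : m ≤ j) (hjM : j < M)
    {z w : ℂ} (hz : alpha A B z - i ∈ T) (hw : alpha A B w - j ∈ T) (hzx : z ≠ x) (hwx : w ≠ x) :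
    f z = f w := by
  have key : ∀ n : ℕ, ∀ i j : ℤ, m ≤ i → j < M → j = i + n → ∀ z w, alpha A B z - i ∈ T →
      alpha A B w - j ∈ T → z ≠ x → w ≠ x → f z = f w := by
    intro n
    induction n with
    | zero =>
      intro i j hi hj hij z w hz hw hzx hwx
      obtain rfl : j = i := by simpa using hij
      exact hf j hi hj z w hz hw hzx hwx
    | succ n ih =>
      intro i j hi hj hij z w hz hw hzx hwx
      push_cast at hij
      obtain ⟨p, q, hpq, ⟨hp, hp'⟩, hq, hq'⟩ := h.touch_one
      have hα : ∀ y, y - 1 ∈ T → alpha A B (beta A B (y + (j - 1 : ℤ))) - j ∈ T := fun y hy => by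
        rw [alpha_beta h.ne_zero]
        convert hy using 1
        push_cast; ring
      have hα' : ∀ y, y ∈ T → alpha A B (beta A B (y + (j - 1 : ℤ))) - (j - 1 : ℤ) ∈ T :=
        fun y hy => by rwa [alpha_beta h.ne_zero, add_sub_cancel_right]
      have hmain : ∀ y, y ∈ T → y - 1 ∈ T → beta A B (y + (j - 1 : ℤ)) ≠ x → f z = f w := by
        intro y hy hy' hyx
        exact (ih i (j - 1) hi (by omega) (by omega) z _ hz (hα' y hy) hzx hyx).trans
          (hf j (by omega) hj _ w (hα y hy') hw hyx hwx)
      by_cases hpx : beta A B (p + (j - 1 : ℤ)) = x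
      · refine hmain q hq hq' fun hqx => hpq ?_
        have := congrArg (alpha A B) (hpx.trans hqx.symm)
        rw [alpha_beta h.ne_zero, alpha_beta h.ne_zero] at this
        exact add_right_cancel this
      · exact hmain p hp hp' hpx
  rcases le_total i j with hij | hij
  · exact key (j - i).toNat i j hi hjM (by omega) z w hz hw hzx hwx
  · exact (key (i - j).toNat j i hj hiM (by omega) w z hw hz hwx hzx).symm

theorem isPreconnected : IsPreconnected T := by
  refine isPreconnected_of_forall_constant fun f hf => ?_
  have hu := h.isCompact.uniformContinuousOn_of_continuous hf
  have hdis : {p : Bool × Bool | p.1 = p.2} ∈ uniformity Bool := by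
    rw [discreteUniformity_iff_eq_principal_setRelId.1 inferInstance]
    exact fun p hp => hp
  obtain ⟨δ, hδ, hδf⟩ := Metric.mem_uniformity_dist.1
    (Filter.mem_inf_principal.1 (hu hdis))
  obtain ⟨R, hR⟩ := h.isCompact.isBounded.exists_norm_le
  obtain ⟨n, hn⟩ := exists_norm_beta_pow_lt h.two_le h.abs_le (R + R) hδ
  have key : ∀ n : ℕ, ∀ g : ℂ → Bool, (∀ z w, SameDigits A B T n z w → g z = g w) →
      ∀ z ∈ T, ∀ w ∈ T, g z = g w := by
    intro n
    induction n with
    | zero => exact fun g hg z hz w hw => hg z w ⟨hz, hw⟩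
    | succ n ih =>
      intro g hg z hz w hw
      have hgood : ∀ j : ℤ, 0 ≤ j → j < B → ∀ z w, alpha A B z - j ∈ T → alpha A B w - j ∈ T →
          g z = g w := by
        intro j h0 hj z w hz hw
        have := ih (fun y => g (beta A B (y + j))) (fun z w hzw => hg _ _ ⟨j, h0, hj, by
          simpa only [alpha_beta h.ne_zero, add_sub_cancel_right] using hzw⟩) _ hz _ hw
        simpa only [sub_add_cancel, beta_alpha h.ne_zero] using this
      obtain ⟨i, hi, hiB, hz'⟩ := (h.mem_iff z).1 hz
      obtain ⟨j, hj, hjB, hw'⟩ := (h.mem_iff w).1 hw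
      obtain ⟨x, hx, hxz, hxw⟩ : ∃ x : ℂ, True ∧ z ≠ x ∧ w ≠ x := by
        obtain ⟨x, hx⟩ := Set.Infinite.exists_notMem_finset (infinite_univ (α := ℂ)) {z, w}
        exact ⟨x, trivial, fun e => hx.2 (by simp [e]), fun e => hx.2 (by simp [e])⟩
      exact h.eq_of_forall_digit
        (fun j h0 hj z w hz hw _ _ => hgood j h0 hj z w hz hw) hi hiB hj hjB hz' hw' hxz hxw
  refine key n f fun z w hzw => ?_
  obtain ⟨hz, hw, x, hx, y, hy, hxy⟩ := h.exists_of_sameDigits n hzw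
  refine hδf (a := z) (b := w) ?_ ⟨hz, hw⟩
  rw [dist_eq_norm, hxy]
  exact hn n le_rfl _ ((norm_sub_le _ _).trans (add_le_add (hR x hx) (hR y hy)))

end IsTile

end

section
variable {A B : ℤ} {T : Set ℂ}

/-- The lattice point with coordinates `s`. -/
def lat (s : ℤ × ℤ) : ℂ := ⟨s.1, s.2⟩

/-- The action of `alpha A B` on lattice points. -/
def latAlpha (A B : ℤ) (s : ℤ × ℤ) : ℤ × ℤ := (-B * s.2, s.1 + A * s.2)

/-- The lattice points with an expansion of length `n` in the digits `0, …, B - 1`. -/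
def digitSet (A B : ℤ) : ℕ → Finset (ℤ × ℤ)
  | 0 => {0}
  | n + 1 => (digitSet A B n ×ˢ Finset.Ico 0 B).image fun p => latAlpha A B p.1 + (p.2, 0)

theorem lat_zero : lat 0 = 0 := by apply Complex.ext <;> simp [lat]

theorem lat_add (s t : ℤ × ℤ) : lat (s + t) = lat s + lat t := by
  apply Complex.ext <;> simp [lat]

theorem lat_sub (s t : ℤ × ℤ) : lat (s - t) = lat s - lat t := by
  apply Complex.ext <;> simp [lat]

theorem lat_int (j : ℤ) : lat (j, 0) = j := by
  apply Complex.ext <;> simp [lat]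

theorem lat_latAlpha (s : ℤ × ℤ) : lat (latAlpha A B s) = alpha A B (lat s) := by
  apply Complex.ext <;> simp [lat, latAlpha]

theorem finite_norm_lat_le (R : ℝ) : {s : ℤ × ℤ | ‖lat s‖ ≤ R}.Finite := by
  refine (((finite_Icc (-⌈R⌉) ⌈R⌉).prod (finite_Icc (-⌈R⌉) ⌈R⌉))).subset ?_
  rintro ⟨i, j⟩ hs
  have hs' : ‖lat (i, j)‖ ≤ R := hs
  have h1 := (Complex.abs_re_le_norm _).trans (hs'.trans (Int.le_ceil R))
  have h2 := (Complex.abs_im_le_norm _).trans (hs'.trans (Int.le_ceil R))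
  simp only [lat] at h1 h2
  exact ⟨abs_le.1 (by exact_mod_cast h1), abs_le.1 (by exact_mod_cast h2)⟩

theorem latAlpha_add_inj (hB : 0 < B) {s t : ℤ × ℤ} {i j : ℤ} (hi : 0 ≤ i) (hiB : i < B)
    (hj : 0 ≤ j) (hjB : j < B) (hst : latAlpha A B s + (i, 0) = latAlpha A B t + (j, 0)) :
    s = t ∧ i = j := by
  simp only [latAlpha, Prod.mk_add_mk, Prod.mk.injEq, add_zero] at hst
  obtain ⟨h1, h2⟩ := hst
  have h3 : s.2 = t.2 := by
    rcases lt_trichotomy s.2 t.2 with hlt | heq | hlt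
    · nlinarith
    · exact heq
    · nlinarith
  have h4 : s.1 = t.1 := by rw [h3] at h2; linarith
  exact ⟨Prod.ext h4 h3, by rw [h3] at h1; linarith⟩

theorem mem_digitSet_succ {n : ℕ} {t : ℤ × ℤ} :
    t ∈ digitSet A B (n + 1) ↔
      ∃ s ∈ digitSet A B n, ∃ j : ℤ, 0 ≤ j ∧ j < B ∧ latAlpha A B s + (j, 0) = t := by
  simp only [digitSet, Finset.mem_image, Finset.mem_product, Finset.mem_Ico]
  constructor
  · rintro ⟨⟨s, j⟩, ⟨hs, h0, hj⟩, rfl⟩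
    exact ⟨s, hs, j, h0, hj, rfl⟩
  · rintro ⟨s, hs, j, h0, hj, rfl⟩
    exact ⟨(s, j), ⟨hs, h0, hj⟩, rfl⟩

/-- The blow-ups of a function along the digits of the only point at which it can jump. -/
structure IsLineage (A B : ℤ) (T : Set ℂ) (x : ℕ → ℂ) (d : ℕ → ℤ) (f : ℕ → ℂ → Bool) : Prop where
  nonneg : ∀ k, 0 ≤ d k
  lt : ∀ k, d k < B
  mem : ∀ k, x k ∈ T
  x_succ : ∀ k, x (k + 1) = alpha A B (x k) - d k
  f_succ : ∀ k z, f (k + 1) (alpha A B z - d k) = f k z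
  const : ∀ k, ∀ j : ℤ, 0 ≤ j → j < B → j ≠ d k → ∀ z w, alpha A B z - j ∈ T →
    alpha A B w - j ∈ T → z ≠ x k → w ≠ x k → f k z = f k w

namespace IsTile

variable (h : IsTile A B T)
include h

theorem mem_of_mem_digitSet {n : ℕ} {t : ℤ × ℤ} (ht : t ∈ digitSet A B n) {z : ℂ}
    (hz : (alpha A B ^ n) z - lat t ∈ T) : z ∈ T := by
  induction n generalizing t with
  | zero =>
    simp only [digitSet, Finset.mem_singleton] at ht
    simpa [ht, lat_zero] using hz
  | succ n ih =>
    obtain ⟨s, hs, j, h0, hj, rfl⟩ := mem_digitSet_succ.1 ht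
    refine ih hs (h.mem_of_digit h0 hj ?_)
    rwa [map_sub, ← Module.End.mul_apply, ← pow_succ', sub_sub, ← lat_latAlpha, ← lat_int,
      ← lat_add]

open Classical in
/-- The level `n` pieces of the tile on which `f` is not constant away from `x`. -/
def _root_.badSet (A B : ℤ) (T : Set ℂ) (x : ℂ) (f : ℂ → Bool) (n : ℕ) : Finset (ℤ × ℤ) :=
  (digitSet A B n).filter fun t => ∃ z w, (alpha A B ^ n) z - lat t ∈ T ∧
    (alpha A B ^ n) w - lat t ∈ T ∧ z ≠ x ∧ w ≠ x ∧ f z ≠ f w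

variable {x : ℂ} {f : ℂ → Bool}

theorem isPreconnected_cell (n : ℕ) (t : ℂ) : IsPreconnected {z | (alpha A B ^ n) z - t ∈ T} := by
  have : {z | (alpha A B ^ n) z - t ∈ T} = (fun z => (beta A B ^ n) (z + t)) '' T := by
    ext z
    constructor
    · intro hz
      exact ⟨_, hz, by simp only [sub_add_cancel]; exact beta_pow_alpha_pow h.ne_zero n z⟩
    · rintro ⟨y, hy, rfl⟩
      simpa [alpha_pow_beta_pow h.ne_zero] using hy
  rw [this]
  refine h.isPreconnected.image _ (Continuous.continuousOn ?_)
  exact ((beta A B ^ n).continuous_of_finiteDimensional).comp (by fun_prop)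

theorem mem_of_mem_badSet (hf : ContinuousOn f (T \ {x})) {n : ℕ} {t : ℤ × ℤ}
    (ht : t ∈ badSet A B T x f n) : (alpha A B ^ n) x - lat t ∈ T := by
  classical
  obtain ⟨ht, z, w, hz, hw, hzx, hwx, hzw⟩ := Finset.mem_filter.1 ht
  by_contra hx
  refine hzw ((h.isPreconnected_cell n (lat t)).constant (f := f) ?_ hz hw)
  exact hf.mono fun y hy => ⟨h.mem_of_mem_digitSet ht hy, fun e => hx (e ▸ hy)⟩

theorem exists_child_mem_badSet {n : ℕ} {t : ℤ × ℤ} (ht : t ∈ badSet A B T x f n) :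
    ∃ j : ℤ, 0 ≤ j ∧ j < B ∧ latAlpha A B t + (j, 0) ∈ badSet A B T x f (n + 1) := by
  classical
  obtain ⟨ht, z, w, hz, hw, hzx, hwx, hzw⟩ := Finset.mem_filter.1 ht
  by_contra! hno
  obtain ⟨i, hi, hiB, hzi⟩ := (h.mem_iff _).1 hz
  obtain ⟨j, hj, hjB, hwj⟩ := (h.mem_iff _).1 hw
  have hne : ∀ y, y ≠ x → (alpha A B ^ n) y - lat t ≠ (alpha A B ^ n) x - lat t := by
    intro y hy e
    have := congrArg (beta A B ^ n) (sub_left_injective e)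
    rw [beta_pow_alpha_pow h.ne_zero, beta_pow_alpha_pow h.ne_zero] at this
    exact hy this
  have := h.eq_of_forall_digit (f := fun y => f ((beta A B ^ n) (y + lat t)))
    (x := (alpha A B ^ n) x - lat t) (m := 0) (M := B) ?_ hi hiB hj hjB hzi hwj
    (hne z hzx) (hne w hwx)
  · simp only [sub_add_cancel, beta_pow_alpha_pow h.ne_zero] at this
    exact hzw this
  · intro k hk hkB u v hu hv hux hvx
    by_contra hfuv
    have key : ∀ u, alpha A B u - k ∈ T → (alpha A B ^ (n + 1)) ((beta A B ^ n) (u + lat t)) -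
        lat (latAlpha A B t + (k, 0)) ∈ T := by
      intro u hu
      rw [pow_succ', Module.End.mul_apply, alpha_pow_beta_pow h.ne_zero, map_add, lat_add,
        lat_latAlpha, lat_int]
      convert hu using 1
      ring
    have key2 : ∀ u, u ≠ (alpha A B ^ n) x - lat t → (beta A B ^ n) (u + lat t) ≠ x := by
      rintro u hu rfl
      apply hu
      rw [alpha_pow_beta_pow h.ne_zero, add_sub_cancel_right]
    exact hno k hk hkB (Finset.mem_filter.2 ⟨mem_digitSet_succ.2 ⟨t, ht, k, hk, hkB, rfl⟩, _, _,
      key u hu, key v hv, key2 u hux, key2 v hvx, hfuv⟩)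

theorem exists_lineage (hx : x ∈ T) (hf : ContinuousOn f (T \ {x})) {z w : ℂ} (hz : z ∈ T)
    (hw : w ∈ T) (hzx : z ≠ x) (hwx : w ≠ x) (hzw : f z ≠ f w) :
    ∃ X d F, IsLineage A B T X d F ∧ ∃ z ∈ T, ∃ w ∈ T, z ≠ X 0 ∧ w ≠ X 0 ∧ F 0 z ≠ F 0 w := by
  classical
  have hBpos : 0 < B := by have := h.two_le; omega
  choose! J hJ0 hJB hJ using
    fun n t => h.exists_child_mem_badSet (x := x) (f := f) (n := n) (t := t)
  have hinj : ∀ n, Set.InjOn (fun t => latAlpha A B t + (J n t, 0)) (badSet A B T x f n) := by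
    intro n s hs t ht hst
    exact (latAlpha_add_inj hBpos (hJ0 n s hs) (hJB n s hs) (hJ0 n t ht) (hJB n t ht) hst).1
  have hsub : ∀ n, (badSet A B T x f n).image (fun t => latAlpha A B t + (J n t, 0)) ⊆
      badSet A B T x f (n + 1) := by
    intro n s hs
    obtain ⟨t, ht, rfl⟩ := Finset.mem_image.1 hs
    exact hJ n t ht
  have hmono : Monotone fun n => (badSet A B T x f n).card := by
    refine monotone_nat_of_le_succ fun n => ?_
    rw [← Finset.card_image_of_injOn (hinj n)]
    exact Finset.card_le_card (hsub n)
  obtain ⟨R, hR⟩ := h.isCompact.isBounded.exists_norm_le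
  set P := (finite_norm_lat_le (R + R)).toFinset with hP
  have hbdd : BddAbove (range fun n => (badSet A B T x f n).card) := by
    refine ⟨P.card, ?_⟩
    rintro _ ⟨n, rfl⟩
    rcases (badSet A B T x f n).eq_empty_or_nonempty with he | ⟨t₀, ht₀⟩
    · simp [he]
    · refine Finset.card_le_card_of_injOn (fun t => t - t₀) (fun t ht => ?_)
        (fun _ _ _ _ e => sub_left_injective e)
      rw [hP, Finite.coe_toFinset, mem_ofPred_eq, lat_sub,
        show lat t - lat t₀ = ((alpha A B ^ n) x - lat t₀) - ((alpha A B ^ n) x - lat t) by ring]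
      exact (norm_sub_le _ _).trans (add_le_add (hR _ (h.mem_of_mem_badSet hf ht₀))
        (hR _ (h.mem_of_mem_badSet hf ht)))
  obtain ⟨n₀, hn₀⟩ := Nat.sSup_mem (range_nonempty _) hbdd
  have hmax : ∀ n, (badSet A B T x f n).card ≤ (badSet A B T x f n₀).card := fun n => by
    simp only at hn₀
    rw [hn₀]
    exact le_csSup hbdd ⟨n, rfl⟩
  have huniq : ∀ n ≥ n₀, ∀ t ∈ badSet A B T x f n, ∀ j : ℤ, 0 ≤ j → j < B →
      latAlpha A B t + (j, 0) ∈ badSet A B T x f (n + 1) → j = J n t := by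
    intro n hn t ht j hj hjB hmem
    have himg := Finset.eq_of_subset_of_card_le (hsub n) (by
      rw [Finset.card_image_of_injOn (hinj n)]
      exact (hmax _).trans (hmono hn))
    rw [← himg] at hmem
    obtain ⟨s, hs, hst⟩ := Finset.mem_image.1 hmem
    obtain ⟨rfl, h2⟩ := latAlpha_add_inj hBpos (hJ0 n s hs) (hJB n s hs) hj hjB hst
    exact h2.symm
  have hbad0 : (0 : ℤ × ℤ) ∈ badSet A B T x f 0 :=
    Finset.mem_filter.2 ⟨by simp [digitSet], z, w, by simpa [lat_zero], by simpa [lat_zero], hzx,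
      hwx, hzw⟩
  obtain ⟨t₀, ht₀⟩ : (badSet A B T x f n₀).Nonempty := by
    rw [← Finset.card_pos]
    exact lt_of_lt_of_le (Finset.card_pos.2 ⟨0, hbad0⟩) (hmax 0)
  let t : ℕ → ℤ × ℤ := fun k =>
    Nat.rec t₀ (fun k s => latAlpha A B s + (J (n₀ + k) s, 0)) k
  have htsucc : ∀ k, t (k + 1) = latAlpha A B (t k) + (J (n₀ + k) (t k), 0) := fun k => rfl
  have htbad : ∀ k, t k ∈ badSet A B T x f (n₀ + k) := by
    intro k
    induction k with
    | zero => exact ht₀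
    | succ k ih => rw [htsucc]; exact hJ _ _ ih
  have hinv : ∀ k z, (alpha A B ^ (n₀ + k)) ((beta A B ^ (n₀ + k)) z) = z :=
    fun k => alpha_pow_beta_pow h.ne_zero _
  have hinv' : ∀ k z, (beta A B ^ (n₀ + k)) ((alpha A B ^ (n₀ + k)) z) = z :=
    fun k => beta_pow_alpha_pow h.ne_zero _
  have hne : ∀ k u, u ≠ (alpha A B ^ (n₀ + k)) x - lat (t k) →
      (beta A B ^ (n₀ + k)) (u + lat (t k)) ≠ x := by
    rintro k u hu rfl
    apply hu
    rw [hinv, add_sub_cancel_right]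
  refine ⟨fun k => (alpha A B ^ (n₀ + k)) x - lat (t k), fun k => J (n₀ + k) (t k),
    fun k z => f ((beta A B ^ (n₀ + k)) (z + lat (t k))), ⟨fun k => hJ0 _ _ (htbad k),
    fun k => hJB _ _ (htbad k), fun k => h.mem_of_mem_badSet hf (htbad k), fun k => ?_,
    fun k z => ?_, fun k j hj hjB hjd u v hu hv hux hvx => ?_⟩, ?_⟩
  · rw [htsucc, lat_add, lat_int, lat_latAlpha, ← add_assoc n₀, pow_succ', Module.End.mul_apply,
      map_sub]
    ring
  · rw [htsucc, lat_add, lat_int, lat_latAlpha, ← add_assoc n₀, pow_succ, Module.End.mul_apply,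
      sub_add_add_cancel, ← map_add, beta_alpha h.ne_zero]
  · by_contra hfuv
    refine hjd (huniq (n₀ + k) (by omega) (t k) (htbad k) j hj hjB (Finset.mem_filter.2
      ⟨mem_digitSet_succ.2 ⟨t k, (Finset.mem_filter.1 (htbad k)).1, j, hj, hjB, rfl⟩, _, _,
      ?_, ?_, hne k u hux, hne k v hvx, hfuv⟩))
    · rw [pow_succ', Module.End.mul_apply, hinv, map_add, lat_add, lat_latAlpha, lat_int]
      convert hu using 1; ring
    · rw [pow_succ', Module.End.mul_apply, hinv, map_add, lat_add, lat_latAlpha, lat_int]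
      convert hv using 1; ring
  · obtain ⟨-, z, w, hz, hw, hzx, hwx, hzw⟩ := Finset.mem_filter.1 (htbad 0)
    have hne' : ∀ y, y ≠ x → (alpha A B ^ (n₀ + 0)) y - lat (t 0) ≠
        (alpha A B ^ (n₀ + 0)) x - lat (t 0) := by
      intro y hy e
      have := congrArg (beta A B ^ (n₀ + 0)) (sub_left_injective e)
      rw [hinv', hinv'] at this
      exact hy this
    exact ⟨_, hz, _, hw, hne' z hzx, hne' w hwx, by simpa only [sub_add_cancel, hinv'] using hzw⟩

end IsTile

end

section
variable {A B : ℤ} {T : Set ℂ}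

/-- Away from `x`, the function `f` is equal to `v` on the pieces with first digit in `[m, M)`. -/
def ValOn (A B : ℤ) (T : Set ℂ) (x : ℂ) (f : ℂ → Bool) (m M : ℤ) (v : Bool) : Prop :=
  ∀ j : ℤ, m ≤ j → j < M → ∀ z, alpha A B z - j ∈ T → z ≠ x → f z = v

variable {x : ℕ → ℂ} {d : ℕ → ℤ} {f : ℕ → ℂ → Bool}

/-- The piece number `k` of the lineage is neither the first nor the last of its siblings, which
take the value `l` on its left and `r` on its right. -/
structure IsSplit (A B : ℤ) (T : Set ℂ) (x : ℕ → ℂ) (d : ℕ → ℤ) (f : ℕ → ℂ → Bool)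
    (l r : Bool) (k : ℕ) : Prop where
  one_le : 1 ≤ d k
  le : d k ≤ B - 2
  left : ValOn A B T (x k) (f k) 0 (d k) l
  right : ValOn A B T (x k) (f k) (d k + 1) B r

namespace IsLineage

variable (h : IsTile A B T) (L : IsLineage A B T x d f) {k : ℕ} {l r : Bool}
include h L

theorem exists_valOn {m M : ℤ} (hm : 0 ≤ m) (hM : M ≤ B) (hd : d k < m ∨ M ≤ d k) :
    ∃ v, ValOn A B T (x k) (f k) m M v := by
  by_cases hex : ∃ j : ℤ, m ≤ j ∧ j < M ∧ ∃ z, alpha A B z - j ∈ T ∧ z ≠ x k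
  · obtain ⟨j, hj, hjM, z, hz, hzx⟩ := hex
    refine ⟨f k z, fun i hi hiM w hw hwx => h.eq_of_forall_digit ?_ hi hiM hj hjM hw hz hwx hzx⟩
    exact fun i hi hiM => L.const k i (by omega) (by omega) (by omega)
  · push Not at hex
    exact ⟨true, fun j hj hjM z hz hzx => absurd (hex j hj hjM z hz) hzx⟩

theorem f_beta (q : ℂ) : f k (beta A B (q + d k)) = f (k + 1) q := by
  rw [← L.f_succ, alpha_beta h.ne_zero, add_sub_cancel_right]

theorem beta_ne {q : ℂ} (hq : q ≠ x (k + 1)) : beta A B (q + d k) ≠ x k := fun e => hq <| by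
  rw [L.x_succ, ← e, alpha_beta h.ne_zero, add_sub_cancel_right]

theorem f_eq {m M s : ℤ} {v : Bool} (hv : ValOn A B T (x k) (f k) m M v) (hm : m ≤ d k + s)
    (hM : d k + s < M) {q : ℂ} (hq : q - s ∈ T) (hqx : q ≠ x (k + 1)) : f (k + 1) q = v := by
  rw [← L.f_beta h]
  refine hv _ hm hM _ ?_ (L.beta_ne h hqx)
  rw [alpha_beta h.ne_zero]
  convert hq using 1
  push_cast; ring

theorem val_eq {m M m' M' s i : ℤ} {v v' : Bool} (hi : TouchAt A B T i s)
    (hv : ValOn A B T (x k) (f k) m M v) (hm : m ≤ d k + s) (hM : d k + s < M)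
    (hv' : ValOn A B T (x (k + 1)) (f (k + 1)) m' M' v') (hm' : m' ≤ i) (hM' : i < M') :
    v' = v := by
  obtain ⟨p, q, hpq, ⟨hp, hp'⟩, hq, hq'⟩ := hi
  by_cases hpx : p = x (k + 1)
  · have hqx : q ≠ x (k + 1) := fun e => hpq (hpx.trans e.symm)
    rw [← hv' i hm' hM' q hq hqx, L.f_eq h hv hm hM hq' hqx]
  · rw [← hv' i hm' hM' p hp hpx, L.f_eq h hv hm hM hp' hpx]

theorem val_eq_right {m' M' i : ℤ} {v v' : Bool} (hi : A - 2 ≤ i) (hiB : i < B)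
    (hv : ValOn A B T (x k) (f k) (d k + 1) B v) (hd : d k ≤ B - 2)
    (hv' : ValOn A B T (x (k + 1)) (f (k + 1)) m' M' v') (hm' : m' ≤ i) (hM' : i < M') :
    v' = v :=
  L.val_eq h (s := 1) (by simpa using h.touchAt_one hi hiB) hv le_rfl (by omega) hv' hm' hM'

theorem val_eq_left {m' M' i : ℤ} {v v' : Bool} (hi : 0 ≤ i) (hiB : i ≤ B - A + 1)
    (hv : ValOn A B T (x k) (f k) 0 (d k) v) (hd : 1 ≤ d k)
    (hv' : ValOn A B T (x (k + 1)) (f (k + 1)) m' M' v') (hm' : m' ≤ i) (hM' : i < M') :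
    v' = v :=
  L.val_eq h (s := -1) (by simpa using h.touchAt_neg_one hi hiB) hv (by omega) (by omega)
    hv' hm' hM'

theorem mirror : IsLineage A B T (fun k => fixedPt A B (B - 1) - x k) (fun k => B - 1 - d k)
    (fun k z => f k (fixedPt A B (B - 1) - z)) := by
  have hκ := h.alpha_fixedPt (B - 1)
  push_cast at hκ
  refine ⟨fun k => by have := L.lt k; omega, fun k => by have := L.nonneg k; omega,
    fun k => h.sub_mem (L.mem k), fun k => ?_, fun k z => ?_,
    fun k j hj hjB hjd z w hz hw hzx hwx =>
    L.const k (B - 1 - j) (by omega) (by omega) (by omega) _ _ ?_ ?_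
      (fun e => hzx (by rw [← e]; ring)) (fun e => hwx (by rw [← e]; ring))⟩
  · rw [L.x_succ, map_sub]; push_cast; linear_combination -hκ
  · rw [← L.f_succ k, map_sub]; push_cast; congr 1; linear_combination -hκ
  · convert h.sub_mem hz using 1
    rw [map_sub]; push_cast; linear_combination hκ
  · convert h.sub_mem hw using 1
    rw [map_sub]; push_cast; linear_combination hκ

omit L in
theorem _root_.ValOn.mirror {x : ℂ} {f : ℂ → Bool} {m M : ℤ} {v : Bool}
    (hv : ValOn A B T x f m M v) :
    ValOn A B T (fixedPt A B (B - 1) - x) (fun z => f (fixedPt A B (B - 1) - z)) (B - M) (B - m)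
      v := by
  have hκ := h.alpha_fixedPt (B - 1)
  push_cast at hκ
  refine fun j hj hjM z hz hzx => hv (B - 1 - j) (by omega) (by omega) _ ?_
    (fun e => hzx (by rw [← e]; ring))
  convert h.sub_mem hz using 1
  rw [map_sub]; push_cast; linear_combination hκ

omit L in
theorem _root_.IsSplit.mirror (hs : IsSplit A B T x d f l r k) :
    IsSplit A B T (fun k => fixedPt A B (B - 1) - x k) (fun k => B - 1 - d k)
      (fun k z => f k (fixedPt A B (B - 1) - z)) r l k := by
  have h1 := hs.one_le
  have h2 := hs.le
  refine ⟨by omega, by omega, ?_, ?_⟩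
  · convert hs.right.mirror h using 1 <;> omega
  · convert hs.left.mirror h using 1 <;> omega

theorem split_succ (hs : IsSplit A B T x d f l r k) (hlr : l ≠ r) :
    B - A + 1 ≤ d (k + 1) ∧ d (k + 1) ≤ A - 2 ∧ IsSplit A B T x d f l r (k + 1) := by
  have h3 := h.three_le
  have hle := h.le
  have h34 := h.two_mul_sub
  have hd0 := L.nonneg (k + 1)
  have hdB := L.lt (k + 1)
  obtain ⟨l', hl'⟩ := L.exists_valOn h (k := k + 1) le_rfl (by omega : d (k + 1) ≤ B)
    (Or.inr le_rfl)
  obtain ⟨r', hr'⟩ := L.exists_valOn h (k := k + 1) (by omega : 0 ≤ d (k + 1) + 1) le_rfl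
    (Or.inl (by omega))
  have hlow : B - A + 1 ≤ d (k + 1) := by
    by_contra hlt
    have e1 := L.val_eq_left h (i := B - A + 1) (by omega) le_rfl hs.left hs.one_le hr' (by omega)
      (by omega)
    have e2 := L.val_eq_right h (i := B - 1) (by omega) (by omega) hs.right hs.le hr' (by omega)
      (by omega)
    exact hlr (e1.symm.trans e2)
  have hhigh : d (k + 1) ≤ A - 2 := by
    by_contra hlt
    have e1 := L.val_eq_left h (i := 0) le_rfl (by omega) hs.left hs.one_le hl' (by omega)
      (by omega)
    have e2 := L.val_eq_right h (i := A - 2) le_rfl (by omega) hs.right hs.le hl' (by omega)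
      (by omega)
    exact hlr (e1.symm.trans e2)
  have e1 := L.val_eq_left h (i := 0) le_rfl (by omega) hs.left hs.one_le hl' (by omega)
      (by omega)
  have e2 := L.val_eq_right h (i := B - 1) (by omega) (by omega) hs.right hs.le hr' (by omega)
      (by omega)
  exact ⟨hlow, hhigh, by omega, by omega, e1 ▸ hl', e2 ▸ hr'⟩

/-- A point of the left siblings of `x (k + 3)` that also lies in the right sibling of `x k`. -/
theorem eq_of_split_of_mem (hs : IsSplit A B T x d f l r k) (hlr : l ≠ r) {p : ℂ}
    (hp : alpha A B p ∈ T)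
    (hp' : beta A B (beta A B (p + d (k + 2)) + d (k + 1)) - 1 ∈ T) : p = x (k + 3) := by
  by_contra hpx
  obtain ⟨-, -, hs₁⟩ := L.split_succ h hs hlr
  obtain ⟨-, -, hs₂⟩ := L.split_succ h hs₁ hlr
  obtain ⟨-, -, hs₃⟩ := L.split_succ h hs₂ hlr
  have h1 := L.f_eq h (s := 1) hs.right le_rfl (by have := hs.le; omega) (by simpa using hp')
    (L.beta_ne h (L.beta_ne h hpx))
  rw [L.f_beta h, L.f_beta h, hs₃.left 0 le_rfl (by have := hs₃.one_le; omega) p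
    (by simpa using hp) hpx] at h1
  exact hlr h1

theorem eq_zero_of_split_of_three (hB : 2 * A - B = 3) (hs : IsSplit A B T x d f l r k)
    (hlr : l ≠ r) : x (k + 3) = 0 := by
  have h3 := h.three_le
  obtain ⟨h1, h1', hs₁⟩ := L.split_succ h hs hlr
  obtain ⟨h2, h2', -⟩ := L.split_succ h hs₁ hlr
  have e1 : d (k + 1) = A - 2 := by omega
  have e2 : d (k + 2) = A - 2 := by change d (k + 1 + 1) = _; omega
  refine (L.eq_of_split_of_mem h hs hlr (p := 0) (by simpa using h.zero_mem) ?_).symm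
  refine h.mem_of_digit (j := 0) le_rfl (by omega) (h.mem_of_digit (j := A - 3) (by omega)
    (by omega) ?_)
  convert h.neg_two_c_mem using 1
  have hB' : (B : ℝ) = 2 * A - 3 := by have : B = 2 * A - 3 := by omega
                                       exact_mod_cast this
  simp only [map_sub, map_add, alpha_beta h.ne_zero, e1, e2]
  apply Complex.ext <;> simp [hB']; ring

theorem not_split_of_four_of_eq (hB : 2 * A - B = 4) (hs : IsSplit A B T x d f l r k)
    (hlr : l ≠ r) (he : d (k + 1) = A - 2) : False := by
  have h3 := h.three_le
  have hle := h.le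
  obtain ⟨h1, h1', hs₁⟩ := L.split_succ h hs hlr
  obtain ⟨h2, h2', hs₂⟩ := L.split_succ h hs₁ hlr
  obtain ⟨h3, h3', hs₃⟩ := L.split_succ h hs₂ hlr
  obtain ⟨h4, h4', hs₄⟩ := L.split_succ h hs₃ hlr
  change _ ≤ d (k + 2) at h2
  change d (k + 2) ≤ _ at h2'
  have hB₁ : B = 2 * A - 4 := by omega
  have hB' : (B : ℝ) = 2 * A - 4 := by exact_mod_cast hB₁
  rcases le_or_gt 2 (d (k + 2)) with hg | hg
  · have hpos := h.pos_real.ne'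
    have key : ∀ τ : ℤ, 0 ≤ τ → τ < 2 → beta A B (fixedPt A B τ) = x (k + 3) := by
      intro τ hτ hτ'
      refine L.eq_of_split_of_mem h hs hlr ?_ ?_
      · rw [alpha_beta h.ne_zero]
        exact h.fixedPt_mem hτ (by omega)
      · refine h.mem_of_digit (j := 0) le_rfl (by omega) (h.mem_of_digit (j := d (k + 2) - 2)
          (by omega) (by omega) (h.mem_of_digit (j := B - 2) (by omega) (by omega) ?_))
        convert h.fixedPt_mem (j := τ + (B - 2)) (by omega) (by omega) using 1
        simp only [map_sub, map_add, alpha_beta h.ne_zero, he]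
        rw [hB', show (2 * A - 4 - A + 1 : ℝ) = A - 3 by ring] at hpos
        have hfix : ∀ j : ℤ, fixedPt A B j = ⟨j * (A - 1) / (A - 3), -j / (A - 3)⟩ := by
          intro j
          rw [fixedPt, hB', show (2 * A - 4 - A + 1 : ℝ) = A - 3 by ring]
        rw [hfix, hfix]
        apply Complex.ext <;> simp [hB'] <;> field_simp <;> ring
    have := congrArg (alpha A B) ((key 0 le_rfl (by norm_num)).trans
      (key 1 (by norm_num) (by norm_num)).symm)
    rw [alpha_beta h.ne_zero, alpha_beta h.ne_zero] at this
    simpa using h.fixedPt_injective this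
  · obtain rfl : A = 4 := by omega
    obtain rfl : B = 4 := by omega
    have e2 : d (k + 2) = 1 := by omega
    have hφ : ∀ z ∈ T, 0 ≤ z.re + 2 * z.im := by
      obtain ⟨z₀, hz₀, hmin⟩ := h.isCompact.exists_isMinOn h.nonempty
        (f := fun z : ℂ => z.re + 2 * z.im) (by fun_prop)
      obtain ⟨j, hj, -, hjT⟩ := (h.mem_iff z₀).1 hz₀
      have h5 := hmin hjT
      have hj' : (0 : ℝ) ≤ j := by exact_mod_cast hj
      simp at h5
      intro z hz
      have h6 := hmin hz
      simp only [mem_ofPred_eq] at h6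
      linarith
    have hx : (0 : ℂ) ≠ x (k + 4) := by
      intro e
      have h5 := hφ _ (L.mem (k + 5))
      rw [L.x_succ, ← e] at h5
      simp at h5
      have : d (k + 4) ≤ 0 := by exact_mod_cast h5
      have := hs₄.one_le
      change 1 ≤ d (k + 4) at this
      omega
    have h6 := L.f_eq h (s := 1) hs.right le_rfl (by have := hs.le; omega)
      (q := beta 4 4 (beta 4 4 (beta 4 4 (0 + d (k + 3)) + d (k + 2)) + d (k + 1))) ?_
      (L.beta_ne h (L.beta_ne h (L.beta_ne h hx)))
    · rw [L.f_beta h, L.f_beta h, L.f_beta h, hs₄.left 0 le_rfl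
        (by have := hs₄.one_le; omega) 0 (by simpa using h.zero_mem) hx] at h6
      exact hlr h6
    · have h7 := hs₃.one_le
      change 1 ≤ d (k + 3) at h7
      change d (k + 3) ≤ _ at h3'
      refine h.mem_of_digit (j := 0) le_rfl (by omega) (h.mem_of_digit (j := 0) (by omega)
        (by omega) (h.mem_of_digit (j := d (k + 3) - 1) (by omega) (by omega) ?_))
      convert h.fixedPt_mem (j := 3) (by omega) (by omega) using 1
      simp only [map_sub, map_add, alpha_beta h.ne_zero, he, e2]
      apply Complex.ext <;> simp [fixedPt] <;> ring

theorem not_split (hs : IsSplit A B T x d f l r k) (hlr : l ≠ r) : False := by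
  have h3 := h.three_le
  rcases h.two_mul_sub with hB | hB
  · have e1 := L.eq_zero_of_split_of_three h hB hs hlr
    have e2 := (L.mirror h).eq_zero_of_split_of_three h hB (hs.mirror h) hlr.symm
    simp only [e1, sub_zero] at e2
    have e3 : fixedPt A B 0 = 0 := by apply Complex.ext <;> simp [fixedPt]
    have := h.fixedPt_injective (e2.trans e3.symm)
    omega
  · obtain ⟨h1, h1', -⟩ := L.split_succ h hs hlr
    by_cases he : d (k + 1) = A - 2
    · exact L.not_split_of_four_of_eq h hB hs hlr he
    · exact (L.mirror h).not_split_of_four_of_eq h hB (hs.mirror h) hlr.symm (by omega)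

theorem exists_val (k : ℕ) : ∃ v, ∀ j : ℤ, 0 ≤ j → j < B → j ≠ d k → ∀ z, alpha A B z - j ∈ T →
    z ≠ x k → f k z = v := by
  have h2 := h.two_le
  have hd0 := L.nonneg k
  have hdB := L.lt k
  obtain ⟨l, hl⟩ := L.exists_valOn h (k := k) le_rfl hdB.le (Or.inr le_rfl)
  obtain ⟨r, hr⟩ := L.exists_valOn h (k := k) (by omega : 0 ≤ d k + 1) le_rfl
    (Or.inl (by omega))
  rcases hd0.eq_or_lt with h0 | h0
  · exact ⟨r, fun j hj hjB hjd => hr j (by omega) hjB⟩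
  · rcases (Int.le_sub_one_of_lt hdB).eq_or_lt with h1 | h1
    · exact ⟨l, fun j hj hjB hjd => hl j (by omega) (by omega)⟩
    · have hlr : l = r := by
        by_contra hlr
        exact L.not_split h ⟨by omega, by omega, hl, hr⟩ hlr
      refine ⟨l, fun j hj hjB hjd => ?_⟩
      rcases lt_or_gt_of_ne hjd with hlt | hlt
      · exact hl j hj hlt
      · exact hlr ▸ hr j (by omega) hjB

theorem eq_of_ne {z w : ℂ} (hz : z ∈ T) (hw : w ∈ T) (hzx : z ≠ x 0) (hwx : w ≠ x 0) :
    f 0 z = f 0 w := by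
  have h3 := h.three_le
  have hle := h.le
  choose v hv using L.exists_val h
  have hvs : ∀ k, v (k + 1) = v k := by
    intro k
    have hd0 := L.nonneg k
    have hdB := L.lt k
    by_cases hd : 1 ≤ d k
    · obtain ⟨i, hi, hi1, hid⟩ : ∃ i : ℤ, 0 ≤ i ∧ i ≤ 1 ∧ i ≠ d (k + 1) := by
        by_cases h0 : d (k + 1) = 0
        · exact ⟨1, by omega, by omega, by omega⟩
        · exact ⟨0, by omega, by omega, Ne.symm h0⟩
      refine L.val_eq_left h (m' := i) (M' := i + 1) hi (by omega)
        (fun j hj hjd => hv k j hj (by omega) (by omega)) hd (fun j hj hjd =>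
          hv (k + 1) j (by omega) (by omega) (by omega)) le_rfl (by omega)
    · obtain ⟨i, hi, hi1, hid⟩ : ∃ i : ℤ, B - 2 ≤ i ∧ i < B ∧ i ≠ d (k + 1) := by
        by_cases h0 : d (k + 1) = B - 1
        · exact ⟨B - 2, by omega, by omega, by omega⟩
        · exact ⟨B - 1, by omega, by omega, Ne.symm h0⟩
      refine L.val_eq_right h (m' := i) (M' := i + 1) (by omega) hi1
        (fun j hj hjd => hv k j (by omega) hjd (by omega)) (by omega) (fun j hj hjd =>
          hv (k + 1) j (by omega) (by omega) (by omega)) le_rfl (by omega)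
  obtain ⟨R, hR⟩ := h.isCompact.isBounded.exists_norm_le
  have key : ∀ n k : ℕ, ∀ z ∈ T, z ≠ x k →
      f k z = v k ∨ ∃ y ∈ T, z - x k = (beta A B ^ n) (y - x (k + n)) := by
    intro n
    induction n with
    | zero => exact fun k z hz _ => Or.inr ⟨z, hz, by simp⟩
    | succ n ih =>
      intro k z hz hzx
      obtain ⟨j, hj, hjB, hzj⟩ := (h.mem_iff z).1 hz
      by_cases hjd : j = d k
      · subst hjd
        have hne : alpha A B z - d k ≠ x (k + 1) := by
          rw [L.x_succ]
          intro e
          have := congrArg (beta A B) (sub_left_injective e)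
          rw [beta_alpha h.ne_zero, beta_alpha h.ne_zero] at this
          exact hzx this
        rcases ih (k + 1) _ hzj hne with h1 | ⟨y, hy, hyx⟩
        · left
          rw [← L.f_succ, h1, hvs]
        · right
          refine ⟨y, hy, ?_⟩
          rw [pow_succ', Module.End.mul_apply, show k + (n + 1) = k + 1 + n by ring, ← hyx,
            L.x_succ, sub_sub_sub_cancel_right, ← map_sub, beta_alpha h.ne_zero]
      · exact Or.inl (hv k j hj hjB hjd z hzj hzx)
  have hall : ∀ z ∈ T, z ≠ x 0 → f 0 z = v 0 := by
    intro z hz hzx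
    obtain ⟨n, hn⟩ := exists_norm_beta_pow_lt h.two_le h.abs_le (R + R)
      (norm_pos_iff.2 (sub_ne_zero.2 hzx))
    rcases key n 0 z hz hzx with h1 | ⟨y, hy, hyx⟩
    · exact h1
    · have := hn n le_rfl (y - x (0 + n)) ((norm_sub_le _ _).trans
        (add_le_add (hR y hy) (hR _ (L.mem _))))
      rw [← hyx] at this
      exact absurd this (lt_irrefl _)
  rw [hall z hz hzx, hall w hw hwx]

end IsLineage

theorem IsTile.isPreconnected_diff (h : IsTile A B T) (x : ℂ) : IsPreconnected (T \ {x}) := by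
  by_cases hx : x ∈ T
  · refine isPreconnected_of_forall_constant fun f hf z hz w hw => ?_
    by_contra hzw
    obtain ⟨X, d, F, L, z, hz, w, hw, hzx, hwx, hzw⟩ :=
      h.exists_lineage hx hf hz.1 hw.1 hz.2 hw.2 hzw
    exact hzw (L.eq_of_ne h hz hw hzx hwx)
  · rw [sdiff_singleton_eq_self hx]
    exact h.isPreconnected

end

section
variable {A B : ℤ} {T : Set ℂ}

/-- The translate of `T` by a lattice point. -/
def tile (T : Set ℂ) (s : ℤ × ℤ) : Set ℂ := {z | z - lat s ∈ T}

theorem latAlpha_add (s t : ℤ × ℤ) : latAlpha A B (s + t) = latAlpha A B s + latAlpha A B t := by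
  ext <;> simp [latAlpha] <;> ring

theorem latAlpha_zero : latAlpha A B 0 = 0 := by simp [latAlpha]

theorem lat_iterate_latAlpha (n : ℕ) (s : ℤ × ℤ) :
    lat ((latAlpha A B)^[n] s) = (alpha A B ^ n) (lat s) := by
  induction n with
  | zero => rfl
  | succ n ih => rw [Function.iterate_succ_apply', lat_latAlpha, ih, pow_succ',
      Module.End.mul_apply]

theorem exists_latAlpha_add (hB : 0 < B) (s : ℤ × ℤ) :
    ∃ t : ℤ × ℤ, ∃ j : ℤ, 0 ≤ j ∧ j < B ∧ latAlpha A B t + (j, 0) = s := by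
  refine ⟨(s.2 + A * (s.1 / B), -(s.1 / B)), s.1 % B, Int.emod_nonneg _ hB.ne',
    Int.emod_lt_of_pos _ hB, ?_⟩
  ext
  · simp [latAlpha, Int.mul_ediv_add_emod]
  · simp [latAlpha]

theorem norm_lat_floor_sub_le (z : ℂ) : ‖z - lat (⌊z.re⌋, ⌊z.im⌋)‖ ≤ 2 := by
  refine (Complex.norm_le_abs_re_add_abs_im _).trans ?_
  have h1 := Int.floor_le z.re
  have h2 := Int.lt_floor_add_one z.re
  have h3 := Int.floor_le z.im
  have h4 := Int.lt_floor_add_one z.im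
  simp only [lat, Complex.sub_re, Complex.sub_im]
  rw [abs_of_nonneg (by linarith), abs_of_nonneg (by linarith)]
  linarith

theorem card_digitSet (hB : 0 < B) (n : ℕ) : ((digitSet A B n).card : ℤ) = B ^ n := by
  induction n with
  | zero => simp [digitSet]
  | succ n ih =>
    rw [digitSet, Finset.card_image_of_injOn, Finset.card_product, pow_succ]
    · push_cast
      rw [ih, Int.card_Ico, sub_zero, Int.toNat_of_nonneg hB.le]
    · rintro ⟨s, i⟩ hs ⟨t, j⟩ ht hst
      simp only [Finset.coe_product, Finset.coe_Ico, mem_prod, mem_Ico] at hs ht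
      obtain ⟨h1, h2⟩ := latAlpha_add_inj hB hs.2.1 hs.2.2 ht.2.1 ht.2.2 hst
      exact Prod.ext h1 h2

theorem iterate_latAlpha_add_mem_digitSet {k : ℕ} {t : ℤ × ℤ} (ht : t ∈ digitSet A B k) {m : ℕ}
    {u : ℤ × ℤ} (hu : u ∈ digitSet A B m) :
    (latAlpha A B)^[m] t + u ∈ digitSet A B (k + m) := by
  induction m generalizing u with
  | zero =>
    simp only [digitSet, Finset.mem_singleton] at hu
    simpa [hu] using ht
  | succ m ih =>
    obtain ⟨s, hs, j, h0, hj, rfl⟩ := mem_digitSet_succ.1 hu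
    refine mem_digitSet_succ.2 ⟨_, ih hs, j, h0, hj, ?_⟩
    rw [latAlpha_add, Function.iterate_succ_apply', add_assoc]

theorem eq_zero_of_mem_digitSet (hB : 0 < B) {n : ℕ} {s t : ℤ × ℤ} (ht : t ∈ digitSet A B n)
    (hst : (latAlpha A B)^[n] s + t ∈ digitSet A B n) : s = 0 := by
  induction n generalizing t with
  | zero =>
    simp only [digitSet, Finset.mem_singleton] at ht hst
    simpa [ht] using hst
  | succ n ih =>
    obtain ⟨u, hu, j, h0, hj, rfl⟩ := mem_digitSet_succ.1 ht
    obtain ⟨w, hw, i, hi0, hi, hwi⟩ := mem_digitSet_succ.1 hst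
    rw [Function.iterate_succ_apply', ← add_assoc, ← latAlpha_add] at hwi
    obtain ⟨rfl, -⟩ := latAlpha_add_inj hB hi0 hi h0 hj hwi
    exact ih hu hw

open Classical in
/-- The elements of `digitSet A B n` which leave it when translated by `g`. -/
def exitSet (A B : ℤ) (n : ℕ) (g : ℤ × ℤ) : Finset (ℤ × ℤ) :=
  (digitSet A B n).filter fun t => t + g ∉ digitSet A B n

theorem mem_exitSet {n : ℕ} {g t : ℤ × ℤ} :
    t ∈ exitSet A B n g ↔ t ∈ digitSet A B n ∧ t + g ∉ digitSet A B n := by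
  simp [exitSet]

theorem card_exitSet_add_le (n : ℕ) (f g : ℤ × ℤ) :
    (exitSet A B n (f + g)).card ≤ (exitSet A B n f).card + (exitSet A B n g).card := by
  classical
  have : exitSet A B n (f + g) ⊆
      exitSet A B n f ∪ (exitSet A B n g).image fun t => t - f := by
    intro t ht
    rw [mem_exitSet] at ht
    by_cases hf : t + f ∈ digitSet A B n
    · refine Finset.mem_union_right _ (Finset.mem_image.2 ⟨t + f, ?_, by simp⟩)
      exact mem_exitSet.2 ⟨hf, by rw [add_assoc]; exact ht.2⟩
    · exact Finset.mem_union_left _ (mem_exitSet.2 ⟨ht.1, hf⟩)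
  exact (Finset.card_le_card this).trans ((Finset.card_union_le _ _).trans
    (Nat.add_le_add_left Finset.card_image_le _))

theorem card_exitSet_succ_le (n : ℕ) {s s' r : ℤ × ℤ} {k : ℤ} (hk : 0 ≤ k) (hkB : k ≤ B)
    (hs : latAlpha A B s' + (k, 0) = s) (hr : r = s' - (-A, 1)) :
    ((exitSet A B (n + 1) s).card : ℤ) ≤
      (B - k) * (exitSet A B n s').card + k * (exitSet A B n r).card := by
  classical
  have hsub : exitSet A B (n + 1) s ⊆
      (exitSet A B n s' ×ˢ Finset.Ico 0 (B - k) ∪ exitSet A B n r ×ˢ Finset.Ico (B - k) B).image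
        fun p => latAlpha A B p.1 + (p.2, 0) := by
    intro t ht
    obtain ⟨ht, hts⟩ := mem_exitSet.1 ht
    obtain ⟨u, hu, j, h0, hj, rfl⟩ := mem_digitSet_succ.1 ht
    refine Finset.mem_image.2 ⟨(u, j), ?_, rfl⟩
    simp only [Finset.mem_union, Finset.mem_product, Finset.mem_Ico, mem_exitSet]
    rcases lt_or_ge j (B - k) with hjk | hjk
    · refine Or.inl ⟨⟨hu, fun hmem => hts (mem_digitSet_succ.2 ⟨_, hmem, j + k, by omega, by omega,
        ?_⟩)⟩, h0, hjk⟩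
      rw [← hs]
      ext <;> simp [latAlpha] <;> ring
    · refine Or.inr ⟨⟨hu, fun hmem => hts (mem_digitSet_succ.2 ⟨_, hmem, j + k - B, by omega,
        by omega, ?_⟩)⟩, hjk, hj⟩
      rw [← hs, hr]
      ext <;> simp [latAlpha] <;> ring
  have hcard := (Finset.card_le_card hsub).trans (Finset.card_image_le.trans
    (Finset.card_union_le _ _))
  rw [Finset.card_product, Finset.card_product, Int.card_Ico, Int.card_Ico] at hcard
  have hcard' : ((exitSet A B (n + 1) s).card : ℤ) ≤ (exitSet A B n s').card * (B - k - 0).toNat +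
      (exitSet A B n r).card * (B - (B - k)).toNat := by exact_mod_cast hcard
  rw [Int.toNat_of_nonneg (by omega), Int.toNat_of_nonneg (by omega)] at hcard'
  linarith

theorem card_exitSet_zero (n : ℕ) : (exitSet A B n 0).card = 0 := by
  simp [exitSet]

theorem card_exitSet_le_one (g : ℤ × ℤ) : (exitSet A B 0 g).card ≤ 1 :=
  (Finset.card_filter_le _ _).trans (by simp [digitSet])

namespace IsTile

variable (h : IsTile A B T)
include h

theorem card_exitSet_le (n : ℕ) {σ : ℤ} (hσ : σ = 1 ∨ σ = -1) :
    ((exitSet A B n (σ, 0)).card : ℝ) ≤ (B - 1 / 2) ^ n ∧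
    ((exitSet A B n (-(σ * A), σ)).card : ℝ) ≤ (B - 1 / 2) ^ (n + 1) ∧
    ((exitSet A B n (σ * (1 - A), σ)).card : ℝ) ≤ 2 * (B - 1 / 2) ^ n := by
  have h3 := h.three_le
  have hle := h.le
  have hA' : (3 : ℝ) ≤ A := by exact_mod_cast h3
  have hle' : (A : ℝ) ≤ B := by exact_mod_cast hle
  have hone : ∀ g : ℤ × ℤ, ((exitSet A B 0 g).card : ℝ) ≤ 1 := fun g => by
    exact_mod_cast card_exitSet_le_one g
  induction n generalizing σ with
  | zero =>
    refine ⟨(hone _).trans (by simp), (hone _).trans (by simp; linarith),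
      (hone _).trans (by norm_num)⟩
  | succ n ih =>
    obtain ⟨a1, b1, c1⟩ := ih (σ := 1) (Or.inl rfl)
    obtain ⟨a2, b2, c2⟩ := ih (σ := -1) (Or.inr rfl)
    have hρ : (0 : ℝ) ≤ (B - 1 / 2) ^ n := pow_nonneg (by linarith) n
    have hA0 : (0 : ℝ) ≤ A := by linarith
    have hA1 : (0 : ℝ) ≤ A - 1 := by linarith
    have hBA : (0 : ℝ) ≤ B - A := by linarith
    have hBA1 : (0 : ℝ) ≤ B - A + 1 := by linarith
    have hb : ∀ {p q : ℝ}, p ≤ 2 * (B - 1 / 2) ^ n → q ≤ (B - 1 / 2) ^ n →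
        A * p + (B - A) * q ≤ (B - 1 / 2) ^ (n + 1 + 1) := by
      intro p q hp hq
      rw [pow_succ, pow_succ]
      nlinarith [mul_le_mul_of_nonneg_left hp hA0, mul_le_mul_of_nonneg_left hq hBA,
        mul_nonneg hρ (show (0 : ℝ) ≤ (B - 1 / 2) * (B - 1 / 2) - (A + B) by nlinarith)]
    have hc : ∀ {p q : ℝ}, p ≤ 2 * (B - 1 / 2) ^ n → q ≤ (B - 1 / 2) ^ n →
        (A - 1) * p + (B - A + 1) * q ≤ 2 * (B - 1 / 2) ^ (n + 1) := by
      intro p q hp hq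
      rw [pow_succ]
      nlinarith [mul_le_mul_of_nonneg_left hp hA1, mul_le_mul_of_nonneg_left hq hBA1,
        mul_nonneg hρ (show (0 : ℝ) ≤ B - A by linarith)]
    rcases hσ with rfl | rfl
    · have e1 := card_exitSet_succ_le (A := A) (B := B) n (s := (1, 0)) (s' := 0)
        (r := (A, -1)) (k := 1) (by omega) (by omega) (by ext <;> simp [latAlpha])
        (by ext <;> simp)
      have e2 := card_exitSet_succ_le (A := A) (B := B) n (s := (-A, 1)) (s' := (1 - A, 1))
        (r := (1, 0)) (k := B - A) (by omega) (by omega)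
        (by ext <;> simp [latAlpha]; ring) (by ext <;> simp)
      have e3 := card_exitSet_succ_le (A := A) (B := B) n (s := (1 - A, 1)) (s' := (1 - A, 1))
        (r := (1, 0)) (k := B - A + 1) (by omega) (by omega)
        (by ext <;> simp [latAlpha]; ring) (by ext <;> simp)
      rw [card_exitSet_zero] at e1
      have f1 := (Int.cast_le (R := ℝ)).2 e1
      have f2 := (Int.cast_le (R := ℝ)).2 e2
      have f3 := (Int.cast_le (R := ℝ)).2 e3
      push_cast at f1 f2 f3
      simp only [one_mul, neg_mul, neg_neg] at *
      refine ⟨by linarith, le_trans ?_ (hb c1 a1), le_trans ?_ (hc c1 a1)⟩ <;> linarith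
    · have e1 := card_exitSet_succ_le (A := A) (B := B) n (s := (-1, 0)) (s' := (-A, 1))
        (r := 0) (k := B - 1) (by omega) (by omega)
        (by ext <;> simp [latAlpha]; ring) (by ext <;> simp)
      have e2 := card_exitSet_succ_le (A := A) (B := B) n (s := (A, -1)) (s' := (-1, 0))
        (r := (A - 1, -1)) (k := A) (by omega) (by omega) (by ext <;> simp [latAlpha])
        (by ext <;> simp; ring)
      have e3 := card_exitSet_succ_le (A := A) (B := B) n (s := (A - 1, -1)) (s' := (-1, 0))
        (r := (A - 1, -1)) (k := A - 1) (by omega) (by omega)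
        (by ext <;> simp [latAlpha]) (by ext <;> simp; ring)
      rw [card_exitSet_zero] at e1
      have f1 := (Int.cast_le (R := ℝ)).2 e1
      have f2 := (Int.cast_le (R := ℝ)).2 e2
      have f3 := (Int.cast_le (R := ℝ)).2 e3
      push_cast at f1 f2 f3
      simp only [one_mul, neg_mul, neg_neg, neg_sub] at *
      refine ⟨by linarith, le_trans ?_ (hb c2 a2), le_trans ?_ (hc c2 a2)⟩ <;> linarith

theorem exists_card_exitSet_le (g : ℤ × ℤ) :
    ∃ K : ℝ, ∀ n, ((exitSet A B n g).card : ℝ) ≤ K * (B - 1 / 2) ^ n := by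
  let S : AddSubmonoid (ℤ × ℤ) :=
    { carrier := {g | ∃ K : ℝ, ∀ n, ((exitSet A B n g).card : ℝ) ≤ K * (B - 1 / 2) ^ n}
      zero_mem' := ⟨0, fun n => by rw [card_exitSet_zero]; simp⟩
      add_mem' := by
        rintro f g ⟨K, hK⟩ ⟨K', hK'⟩
        refine ⟨K + K', fun n => ?_⟩
        have : ((exitSet A B n (f + g)).card : ℝ) ≤
            (exitSet A B n f).card + (exitSet A B n g).card := by
          exact_mod_cast card_exitSet_add_le n f g
        linarith [hK n, hK' n] }
  have hzsmul : ∀ s ∈ S, -s ∈ S → ∀ i : ℤ, i • s ∈ S := by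
    intro s hs hs' i
    obtain ⟨n, rfl | rfl⟩ := i.eq_nat_or_neg
    · simpa using S.nsmul_mem hs n
    · simpa using S.nsmul_mem hs' n
  have ha : ∀ σ : ℤ, σ = 1 ∨ σ = -1 → (σ, (0 : ℤ)) ∈ S := fun σ hσ =>
    ⟨1, fun n => by simpa using (h.card_exitSet_le n hσ).1⟩
  have hb : ∀ σ : ℤ, σ = 1 ∨ σ = -1 → (-(σ * A), σ) ∈ S := fun σ hσ =>
    ⟨B - 1 / 2, fun n => by simpa [pow_succ'] using (h.card_exitSet_le n hσ).2.1⟩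
  have := S.add_mem (hzsmul _ (ha 1 (Or.inl rfl)) (by simpa using ha (-1) (Or.inr rfl))
    (g.1 + A * g.2)) (hzsmul _ (hb 1 (Or.inl rfl)) (by simpa using hb (-1) (Or.inr rfl)) g.2)
  have hg : (g.1 + A * g.2) • ((1 : ℤ), (0 : ℤ)) + g.2 • (-(1 * A), (1 : ℤ)) = g := by
    ext
    · simp; ring
    · simp
  rwa [hg] at this

theorem exists_mem_digitSet {x : ℂ} (hx : x ∈ T) (n : ℕ) :
    ∃ t ∈ digitSet A B n, (alpha A B ^ n) x - lat t ∈ T := by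
  induction n with
  | zero => exact ⟨0, by simp [digitSet], by simpa [lat_zero] using hx⟩
  | succ n ih =>
    obtain ⟨t, ht, htT⟩ := ih
    obtain ⟨j, h0, hj, hjT⟩ := (h.mem_iff _).1 htT
    refine ⟨_, mem_digitSet_succ.2 ⟨t, ht, j, h0, hj, rfl⟩, ?_⟩
    rwa [pow_succ', Module.End.mul_apply, lat_add, lat_latAlpha, lat_int, ← sub_sub, ← map_sub]

theorem locallyFinite_tile : LocallyFinite (tile T) := by
  obtain ⟨R, hR⟩ := h.isCompact.isBounded.exists_norm_le
  intro x
  refine ⟨ball x 1, ball_mem_nhds x one_pos, (finite_norm_lat_le (R + (‖x‖ + 1))).subset ?_⟩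
  rintro s ⟨z, hz, hzx⟩
  have h1 := hR _ hz
  rw [mem_ball_iff_norm] at hzx
  have h2 : ‖lat s‖ ≤ ‖z - x‖ + ‖x‖ + ‖z - lat s‖ := by
    have h3 := norm_sub_le ((z - x) + x) (z - lat s)
    rw [sub_add_cancel, sub_sub_cancel] at h3
    have h4 := norm_add_le (z - x) x
    rw [sub_add_cancel] at h4
    linarith
  simp only [mem_ofPred_eq]
  linarith

theorem isClosed_tile (s : ℤ × ℤ) : IsClosed (tile T s) :=
  h.isCompact.isClosed.preimage (f := fun z => z - lat s) (by fun_prop)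

theorem isClosed_biUnion_tile (S : Set (ℤ × ℤ)) : IsClosed (⋃ s ∈ S, tile T s) := by
  rw [biUnion_eq_iUnion]
  exact (h.locallyFinite_tile.comp_injective Subtype.val_injective).isClosed_iUnion
    fun s => h.isClosed_tile s

theorem exists_mem_tile (z : ℂ) : ∃ s, z ∈ tile T s := by
  have hpos : 0 < B := by have := h.two_le; omega
  obtain ⟨τ, hτ⟩ := h.nonempty
  have hcl : IsClosed (⋃ s, tile T s) := by
    simpa using h.isClosed_biUnion_tile univ
  have hβ : ∀ n, ∀ z ∈ ⋃ s, tile T s, (beta A B ^ n) z ∈ ⋃ s, tile T s := by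
    intro n
    induction n with
    | zero => intro z hz; exact hz
    | succ n ih =>
      intro z hz
      rw [pow_succ, Module.End.mul_apply]
      refine ih _ ?_
      obtain ⟨s, hs⟩ := mem_iUnion.1 hz
      obtain ⟨t, j, h0, hj, rfl⟩ := exists_latAlpha_add (A := A) hpos s
      refine mem_iUnion.2 ⟨t, h.mem_of_digit h0 hj ?_⟩
      have hs' : z - lat (latAlpha A B t + (j, 0)) ∈ T := hs
      rwa [map_sub, alpha_beta h.ne_zero, sub_sub, ← lat_latAlpha, ← lat_int, ← lat_add]
  rw [← mem_iUnion, ← hcl.closure_eq, Metric.mem_closure_iff]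
  intro ε hε
  obtain ⟨n, hn⟩ := exists_norm_beta_pow_lt h.two_le h.abs_le (2 + ‖τ‖) hε
  set w := (alpha A B ^ n) z with hw
  refine ⟨(beta A B ^ n) (τ + lat (⌊w.re⌋, ⌊w.im⌋)), hβ n _ (mem_iUnion.2
    ⟨(⌊w.re⌋, ⌊w.im⌋), by simpa [tile] using hτ⟩), ?_⟩
  have := hn n le_rfl (w - lat (⌊w.re⌋, ⌊w.im⌋) - τ)
    ((norm_sub_le _ _).trans (by gcongr; exact norm_lat_floor_sub_le w))
  rwa [sub_sub, map_sub, hw, beta_pow_alpha_pow h.ne_zero, ← hw, add_comm, ← dist_eq_norm] at this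

theorem interior_nonempty : (interior T).Nonempty := by
  obtain ⟨s, z, hz⟩ := nonempty_interior_of_iUnion_of_closed h.isClosed_tile
    (eq_univ_of_forall fun z => mem_iUnion.2 (h.exists_mem_tile z))
  refine ⟨z - lat s, mem_interior.2 ⟨(fun y => y + lat s) ⁻¹' interior (tile T s), ?_,
    isOpen_interior.preimage (by fun_prop), by simpa using hz⟩⟩
  intro y hy
  have : y + lat s ∈ tile T s := interior_subset hy
  simpa [tile] using this

theorem subset_closure_interior : T ⊆ closure (interior T) := by
  intro x hx
  obtain ⟨w, hw⟩ := h.interior_nonempty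
  obtain ⟨R, hR⟩ := h.isCompact.isBounded.exists_norm_le
  rw [Metric.mem_closure_iff]
  intro ε hε
  obtain ⟨n, hn⟩ := exists_norm_beta_pow_lt h.two_le h.abs_le (R + R) hε
  obtain ⟨t, ht, htT⟩ := h.exists_mem_digitSet hx n
  refine ⟨(beta A B ^ n) (w + lat t), mem_interior.2
    ⟨(fun z => (alpha A B ^ n) z - lat t) ⁻¹' interior T, fun z hz =>
      h.mem_of_mem_digitSet ht (interior_subset hz), isOpen_interior.preimage ?_, ?_⟩, ?_⟩
  · exact ((alpha A B ^ n).continuous_of_finiteDimensional).sub continuous_const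
  · simpa [alpha_pow_beta_pow h.ne_zero] using hw
  · have := hn n le_rfl ((alpha A B ^ n) x - lat t - w)
      ((norm_sub_le _ _).trans (add_le_add (hR _ htT) (hR _ (interior_subset hw))))
    rwa [sub_sub, map_sub, beta_pow_alpha_pow h.ne_zero, add_comm, ← dist_eq_norm] at this

theorem eq_zero_of_mem_interior {z : ℂ} (hz : z ∈ interior T) {s : ℤ × ℤ} (hs : z ∈ tile T s) :
    s = 0 := by
  classical
  by_contra hs0
  have hpos : 0 < B := by have := h.two_le; omega
  obtain ⟨R, hR⟩ := h.isCompact.isBounded.exists_norm_le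
  obtain ⟨ε, hε, hball⟩ := Metric.mem_nhds_iff.1 (mem_interior_iff_mem_nhds.1 hz)
  obtain ⟨k, hk⟩ := exists_norm_beta_pow_lt h.two_le h.abs_le (R + R) hε
  obtain ⟨d, hd, hdT⟩ := h.exists_mem_digitSet hs k
  set F := (finite_norm_lat_le R).toFinset with hF
  choose K hK using h.exists_card_exitSet_le
  have key : ∀ m, (digitSet A B m).card ≤ ∑ f ∈ F, (exitSet A B (k + m) f).card := by
    intro m
    set v := (latAlpha A B)^[k] s + d with hv
    have hsub : (digitSet A B m).image (fun e => (latAlpha A B)^[m] v + e) ⊆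
        F.biUnion fun f => (exitSet A B (k + m) f).image fun t => t + f := by
      intro u hu
      obtain ⟨e, he, rfl⟩ := Finset.mem_image.1 hu
      set u := (latAlpha A B)^[m] v + e with hudef
      have hadd : ∀ n s t, (latAlpha A B)^[n] (s + t) =
          (latAlpha A B)^[n] s + (latAlpha A B)^[n] t := by
        intro n s t
        induction n with
        | zero => rfl
        | succ n ih => simp only [Function.iterate_succ_apply', ih, latAlpha_add]
      have hu' : u = (latAlpha A B)^[k + m] s + ((latAlpha A B)^[m] d + e) := by
        rw [hudef, hv, hadd, ← Function.iterate_add_apply, add_comm m k, add_assoc]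
      have huD : u ∉ digitSet A B (k + m) := fun hmem => hs0 (eq_zero_of_mem_digitSet hpos
        (iterate_latAlpha_add_mem_digitSet hd he) (hu' ▸ hmem))
      have he' : (beta A B ^ m) (lat e) ∈ T := h.mem_of_mem_digitSet he (by
        rw [alpha_pow_beta_pow h.ne_zero, sub_self]; exact h.zero_mem)
      have huT : (beta A B ^ k) ((beta A B ^ m) (lat u)) ∈ T := by
        apply hball
        rw [mem_ball_iff_norm]
        have h1 : (beta A B ^ m) (lat u) = lat v + (beta A B ^ m) (lat e) := by
          rw [hudef, lat_add, lat_iterate_latAlpha, map_add, beta_pow_alpha_pow h.ne_zero]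
        have h2 := hk k le_rfl ((beta A B ^ m) (lat e) - ((alpha A B ^ k) (z - lat s) - lat d))
          ((norm_sub_le _ _).trans (add_le_add (hR _ he') (hR _ hdT)))
        have h3 : (beta A B ^ m) (lat u) - (alpha A B ^ k) z =
            (beta A B ^ m) (lat e) - ((alpha A B ^ k) (z - lat s) - lat d) := by
          rw [h1, hv, lat_add, lat_iterate_latAlpha, map_sub (alpha A B ^ k)]
          ring
        rwa [← h3, map_sub, beta_pow_alpha_pow h.ne_zero] at h2
      obtain ⟨t, ht, htT⟩ := h.exists_mem_digitSet huT (k + m)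
      rw [add_comm k m, pow_add, Module.End.mul_apply, alpha_pow_beta_pow h.ne_zero,
        alpha_pow_beta_pow h.ne_zero, ← lat_sub] at htT
      refine Finset.mem_biUnion.2 ⟨u - t, ?_, Finset.mem_image.2 ⟨t, mem_exitSet.2 ⟨ht, ?_⟩, ?_⟩⟩
      · rw [hF, Finite.mem_toFinset]
        exact hR _ htT
      · rwa [add_sub_cancel]
      · rw [add_sub_cancel]
    rw [← Finset.card_image_of_injective (digitSet A B m) (add_right_injective _)]
    refine (Finset.card_le_card hsub).trans (Finset.card_biUnion_le.trans ?_)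
    exact Finset.sum_le_sum fun f _ => Finset.card_image_le
  have hBpos : (2 : ℝ) ≤ B := by exact_mod_cast h.two_le
  have key2 : ∀ m : ℕ, 1 ≤ (∑ f ∈ F, K f) * (B - 1 / 2) ^ k * ((B - 1 / 2) / B) ^ m := by
    intro m
    have h1 : (B : ℝ) ^ m ≤ ∑ f ∈ F, ((exitSet A B (k + m) f).card : ℝ) := by
      have h2 : ((digitSet A B m).card : ℝ) = B ^ m := by
        exact_mod_cast card_digitSet (A := A) hpos m
      rw [← h2]
      exact_mod_cast key m
    have h2 := h1.trans (Finset.sum_le_sum fun f _ => hK f (k + m))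
    rw [← Finset.sum_mul, pow_add] at h2
    rw [div_pow, mul_div_assoc', le_div_iff₀ (by positivity)]
    linarith
  have hlim : Tendsto (fun m : ℕ => (∑ f ∈ F, K f) * (B - 1 / 2 : ℝ) ^ k *
      ((B - 1 / 2 : ℝ) / B) ^ m) atTop (𝓝 0) := by
    have := (tendsto_pow_atTop_nhds_zero_of_lt_one (r := (B - 1 / 2 : ℝ) / B)
      (div_nonneg (by linarith) (by linarith)) (by rw [div_lt_one (by linarith)]; linarith))
    simpa using this.const_mul ((∑ f ∈ F, K f) * (B - 1 / 2 : ℝ) ^ k)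
  have := ge_of_tendsto' hlim key2
  norm_num at this

theorem interior_eq_compl : interior T = (⋃ s ∈ ({0}ᶜ : Set (ℤ × ℤ)), tile T s)ᶜ := by
  apply Subset.antisymm
  · intro z hz hmem
    obtain ⟨s, hs, hzs⟩ := mem_iUnion₂.1 hmem
    exact hs (h.eq_zero_of_mem_interior hz hzs)
  · refine interior_maximal (fun z hz => ?_) (h.isClosed_biUnion_tile _).isOpen_compl
    obtain ⟨s, hs⟩ := h.exists_mem_tile z
    by_cases hs0 : s = 0
    · simpa [tile, hs0, lat_zero] using hs
    · exact absurd (mem_iUnion₂.2 ⟨s, hs0, hs⟩) hz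

end IsTile

end

section
variable {A B : ℤ} {T : Set ℂ}

/-- The union of the translates of `T` by the nonzero lattice points. -/
def outerTiles (T : Set ℂ) : Set ℂ := ⋃ s ∈ ({0}ᶜ : Set (ℤ × ℤ)), tile T s

/-- Neighbouring lattice points in the coordinates attached to `(1, 0)` and `(-A, 1)`. -/
def latAdj (A : ℤ) (s t : ℤ × ℤ) : Prop :=
  t - s = (1, 0) ∨ s - t = (1, 0) ∨ t - s = (-A, 1) ∨ s - t = (-A, 1)

theorem latAdj_reflTransGen (A : ℤ) {s : ℤ × ℤ} (hs : s ≠ 0) :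
    Relation.ReflTransGen (fun s t => latAdj A s t ∧ s ≠ 0 ∧ t ≠ 0) (1, 0) s := by
  let P : ℤ → ℤ → ℤ × ℤ := fun m n => (m - n * A, n)
  let r := fun s t => latAdj A s t ∧ s ≠ 0 ∧ t ≠ 0
  have hP : ∀ m n, m ≠ 0 ∨ n ≠ 0 → P m n ≠ 0 := by
    intro m n hmn he
    simp only [P, Prod.mk_eq_zero] at he
    obtain ⟨h1, rfl⟩ := he
    simp_all
  have hrow : ∀ n m m' : ℤ, (n ≠ 0 ∨ 0 < m ∧ 0 < m') →
      Relation.ReflTransGen r (P m n) (P m' n) := by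
    intro n m m' hn
    refine Relation.ReflTransGen.lift (r := fun i j => r (P i n) (P j n)) (fun i => P i n)
      (fun _ _ h => h) _ _ (reflTransGen_of_succ _ (fun i hi => ?_) (fun i hi => ?_))
    all_goals
      have h1 := hi.1
      refine ⟨by simp [latAdj, P], hP _ _ ?_, hP _ _ ?_⟩ <;>
      · rcases hn with hn | hn
        · exact Or.inr hn
        · refine Or.inl ?_
          simp only [Order.succ_eq_add_one, ne_eq]
          omega
  have hcol : ∀ m n n' : ℤ, m ≠ 0 → Relation.ReflTransGen r (P m n) (P m n') := by
    intro m n n' hm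
    refine Relation.ReflTransGen.lift (r := fun i j => r (P m i) (P m j)) (fun i => P m i)
      (fun _ _ h => h) _ _ (reflTransGen_of_succ _ (fun i hi => ?_) (fun i hi => ?_))
    all_goals
      refine ⟨?_, hP _ _ (Or.inl hm), hP _ _ (Or.inl hm)⟩
      simp only [latAdj, P, Prod.ext_iff, Order.succ_eq_add_one, Prod.fst_sub, Prod.snd_sub]
      have : (i + 1) * A = i * A + A := by ring
      omega
  have hs' : s = P (s.1 + s.2 * A) s.2 := by simp [P]
  have h10 : ((1 : ℤ), (0 : ℤ)) = P 1 0 := by simp [P]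
  rw [hs', h10]
  rcases eq_or_ne s.2 0 with h0 | h0
  · rw [h0, zero_mul, add_zero]
    have hm : s.1 ≠ 0 := fun e => hs (Prod.ext e h0)
    exact ((hcol 1 0 1 one_ne_zero).trans (hrow 1 1 s.1 (Or.inl one_ne_zero))).trans
      (hcol s.1 1 0 hm)
  · exact (hcol 1 0 s.2 one_ne_zero).trans (hrow _ _ _ (Or.inl h0))

namespace IsTile

variable (h : IsTile A B T)
include h

theorem isPreconnected_tile_diff (s : ℤ × ℤ) (p : ℂ) : IsPreconnected (tile T s \ {p}) := by
  have : tile T s \ {p} = (fun z => z + lat s) '' (T \ {p - lat s}) := by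
    ext z
    constructor
    · rintro ⟨hz, hzp⟩
      refine ⟨z - lat s, ⟨hz, fun e => hzp ?_⟩, by simp⟩
      exact sub_left_injective e
    · rintro ⟨y, ⟨hy, hyp⟩, rfl⟩
      refine ⟨by simpa [tile] using hy, fun e => hyp ?_⟩
      rw [← (e : y + lat s = p), add_sub_cancel_right]
      rfl
  rw [this]
  exact (h.isPreconnected_diff _).image _ (by fun_prop)

theorem tile_inter_diff_nonempty {s t : ℤ × ℤ} (hst : latAdj A s t) (p : ℂ) :
    ((tile T s \ {p}) ∩ (tile T t \ {p})).Nonempty := by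
  have key : ∀ s t : ℤ × ℤ, Touch T (lat (t - s)) →
      ((tile T s \ {p}) ∩ (tile T t \ {p})).Nonempty := by
    rintro s t ⟨u, w, huw, ⟨hu, hus⟩, hw, hws⟩
    have hmem : ∀ u, u ∈ T → u - lat (t - s) ∈ T → u + lat s ≠ p →
        ((tile T s \ {p}) ∩ (tile T t \ {p})).Nonempty := by
      intro u hu hus hup
      refine ⟨u + lat s, ⟨by simpa [tile] using hu, hup⟩, ?_, hup⟩
      rw [lat_sub] at hus
      simp only [tile, mem_ofPred_eq]
      convert hus using 1
      ring
    by_cases hup : u + lat s = p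
    · exact hmem w hw hws fun e => huw (add_right_cancel (hup.trans e.symm))
    · exact hmem u hu hus hup
  have h1 : Touch T (lat (1, 0)) := by simpa [lat_int] using h.touch_one
  have h2 : Touch T (lat (-A, 1)) := by simpa [lat] using h.touch_b
  rcases hst with e | e | e | e
  · exact key s t (e ▸ h1)
  · rw [inter_comm]
    exact key t s (e ▸ h1)
  · exact key s t (e ▸ h2)
  · rw [inter_comm]
    exact key t s (e ▸ h2)

theorem isPreconnected_outerTiles_diff (p : ℂ) : IsPreconnected (outerTiles T \ {p}) := by
  simp only [outerTiles, iUnion_sdiff]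
  refine IsPreconnected.biUnion_of_reflTransGen (fun s _ => h.isPreconnected_tile_diff s p) ?_
  have key : ∀ s : ℤ × ℤ, s ≠ 0 → Relation.ReflTransGen (fun i j => ((tile T i \ {p}) ∩
      (tile T j \ {p})).Nonempty ∧ i ∈ ({0}ᶜ : Set (ℤ × ℤ)) ∧ j ∈ ({0}ᶜ : Set (ℤ × ℤ))) (1, 0) s :=
    fun s hs => Relation.ReflTransGen.mono (fun i j hij =>
      ⟨h.tile_inter_diff_nonempty hij.1 p, hij.2.1, hij.2.2⟩) _ _ (latAdj_reflTransGen A hs)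
  intro i hi j hj
  refine (Relation.ReflTransGen.mono ?_ _ _ (Relation.ReflTransGen.swap _ _ (key i hi))).trans
    (Relation.ReflTransGen.mono ?_ _ _ (key j hj))
  · exact fun _ _ h => ⟨by rw [inter_comm]; exact h.1, h.2.2⟩
  · exact fun _ _ h => ⟨h.1, h.2.1⟩

theorem interior_eq_compl_outerTiles : interior T = (outerTiles T)ᶜ := h.interior_eq_compl

theorem exists_dist_lt_tile : ∃ δ > 0, ∀ s : ℤ × ℤ, ∀ z ∈ T, ∀ w ∈ tile T s, dist z w < δ →
    (T ∩ tile T s).Nonempty := by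
  obtain ⟨r, hr, hlt⟩ := Metric.exists_pos_forall_lt_edist h.isCompact
    (h.isClosed_biUnion_tile {s | T ∩ tile T s = ∅}) (by
      rw [disjoint_iUnion₂_right]
      exact fun s hs => disjoint_iff_inter_eq_empty.2 hs)
  refine ⟨r, hr, fun s z hz w hw hzw => ?_⟩
  by_contra hne
  have := hlt z hz w (mem_iUnion₂.2 ⟨s, not_nonempty_iff_eq_empty.1 hne, hw⟩)
  rw [edist_dist, ← ENNReal.ofReal_coe_nnreal] at this
  exact lt_asymm ((ENNReal.ofReal_lt_ofReal_iff_of_nonneg r.coe_nonneg).1 this) hzw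

theorem exists_isPreconnected_outerTiles {ε : ℝ} (hε : 0 < ε) : ∃ δ > 0, ∀ p ∈ outerTiles T,
    ∃ Q, IsClosed Q ∧ IsPreconnected Q ∧ outerTiles T ∩ ball p δ ⊆ Q ∧
      Q ⊆ outerTiles T ∩ ball p ε := by
  obtain ⟨δ', hδ', htouch⟩ := h.exists_dist_lt_tile
  obtain ⟨R, hR⟩ := h.isCompact.isBounded.exists_norm_le
  obtain ⟨n, hn⟩ := exists_norm_beta_pow_lt h.two_le h.abs_le (R + R) (half_pos hε)
  have hcont : Continuous (alpha A B ^ n) := (alpha A B ^ n).continuous_of_finiteDimensional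
  obtain ⟨δ, hδ, hαδ⟩ := Metric.continuousAt_iff.1 (hcont.continuousAt (x := 0)) δ' hδ'
  set I : Set (ℤ × ℤ) := {t | ∃ s ≠ 0, ∃ d ∈ digitSet A B n, t = (latAlpha A B)^[n] s + d} with hI
  have hsub : ∀ t ∈ I, ∀ z, (alpha A B ^ n) z - lat t ∈ T → z ∈ outerTiles T := by
    rintro _ ⟨s, hs, d, hd, rfl⟩ z hz
    refine mem_iUnion₂.2 ⟨s, hs, h.mem_of_mem_digitSet hd ?_⟩
    rwa [map_sub, sub_sub, ← lat_iterate_latAlpha, ← lat_add]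
  have hcov : ∀ z ∈ outerTiles T, ∃ t ∈ I, (alpha A B ^ n) z - lat t ∈ T := by
    intro z hz
    obtain ⟨s, hs, hzs⟩ := mem_iUnion₂.1 hz
    obtain ⟨d, hd, hdT⟩ := h.exists_mem_digitSet hzs n
    refine ⟨_, ⟨s, hs, d, hd, rfl⟩, ?_⟩
    rwa [lat_add, lat_iterate_latAlpha, ← sub_sub, ← map_sub]
  have hdiam : ∀ t : ℤ × ℤ, ∀ z w, (alpha A B ^ n) z - lat t ∈ T →
      (alpha A B ^ n) w - lat t ∈ T → dist z w < ε / 2 := by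
    intro t z w hz hw
    have := hn n le_rfl _ ((norm_sub_le _ _).trans (add_le_add (hR _ hz) (hR _ hw)))
    rwa [sub_sub_sub_cancel_right, ← map_sub, beta_pow_alpha_pow h.ne_zero, ← dist_eq_norm] at this
  refine ⟨δ, hδ, fun p hp => ?_⟩
  obtain ⟨t₀, ht₀, hpt₀⟩ := hcov p hp
  set J : Set (ℤ × ℤ) := {t | t ∈ I ∧ ∃ z, (alpha A B ^ n) z - lat t ∈ T ∧
    (alpha A B ^ n) z - lat t₀ ∈ T} with hJ
  refine ⟨(alpha A B ^ n) ⁻¹' ⋃ t ∈ J, tile T t, (h.isClosed_biUnion_tile J).preimage hcont,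
    ?_, ?_, ?_⟩
  · refine isPreconnected_of_forall p fun y hy => ?_
    obtain ⟨t, ht, hyt⟩ := mem_iUnion₂.1 hy
    obtain ⟨z, hzt, hzt₀⟩ := ht.2
    refine ⟨{z | (alpha A B ^ n) z - lat t ∈ T} ∪ {z | (alpha A B ^ n) z - lat t₀ ∈ T}, ?_,
      Or.inr hpt₀, Or.inl hyt, (h.isPreconnected_cell n _).union' ⟨z, hzt, hzt₀⟩
        (h.isPreconnected_cell n _)⟩
    rintro w (hw | hw)
    · exact mem_iUnion₂.2 ⟨t, ht, hw⟩
    · exact mem_iUnion₂.2 ⟨t₀, ⟨ht₀, p, hpt₀, hpt₀⟩, hw⟩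
  · rintro z ⟨hz, hzp⟩
    obtain ⟨t, ht, hzt⟩ := hcov z hz
    obtain ⟨y, hy, hyt⟩ := htouch (t - t₀) ((alpha A B ^ n) p - lat t₀) hpt₀
      ((alpha A B ^ n) z - lat t₀) (by
        simp only [tile, mem_ofPred_eq, lat_sub]
        rwa [sub_sub_sub_cancel_right]) (by
        have := hαδ (x := z - p) (by rwa [dist_zero_right, ← mem_ball_iff_norm])
        rwa [map_zero, dist_zero_right, ← norm_neg, ← map_neg, neg_sub, map_sub,
          ← sub_sub_sub_cancel_right _ _ (lat t₀), ← dist_eq_norm] at this)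
    refine mem_iUnion₂.2 ⟨t, ⟨ht, (beta A B ^ n) (y + lat t₀), ?_, ?_⟩, hzt⟩
    · rw [alpha_pow_beta_pow h.ne_zero]
      have hyt' : y - lat (t - t₀) ∈ T := hyt
      rw [lat_sub] at hyt'
      convert hyt' using 1
      ring
    · rwa [alpha_pow_beta_pow h.ne_zero, add_sub_cancel_right]
  · intro z hz
    obtain ⟨t, ⟨ht, y, hyt, hyt₀⟩, hzt⟩ := mem_iUnion₂.1 hz
    refine ⟨hsub t ht z hzt, ?_⟩
    rw [mem_ball]
    linarith [dist_triangle z y p, hdiam t z y hzt hyt, hdiam t₀ y p hyt₀ hpt₀]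

theorem not_isBounded_outerTiles : ¬ Bornology.IsBounded (outerTiles T) := by
  intro hb
  obtain ⟨R, hR⟩ := hb.exists_norm_le
  obtain ⟨w, hw⟩ := h.nonempty
  obtain ⟨n, hn⟩ := exists_nat_gt (max 0 (R + ‖w‖))
  rw [max_lt_iff] at hn
  have h1 := hR (w + lat (n, 0)) (mem_iUnion₂.2 ⟨(n, 0), ?_, by simpa [tile] using hw⟩)
  · have h2 := norm_sub_le (w + lat (n, 0)) w
    rw [add_sub_cancel_left, lat_int] at h2
    simp only [Int.cast_natCast, Complex.norm_natCast] at h2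
    rw [lat_int, Int.cast_natCast] at h1
    linarith
  · have : n ≠ 0 := by rintro rfl; simp at hn
    simpa using this

theorem isTameDomain {x : ℂ} :
    IsTameDomain (outerTiles T) (connectedComponentIn (interior T) x) where
  isClosed := h.isClosed_biUnion_tile _
  isPreconnected := by
    obtain ⟨p, hp⟩ := h.interior_nonempty
    rw [h.interior_eq_compl_outerTiles] at hp
    have := h.isPreconnected_outerTiles_diff p
    rwa [sdiff_singleton_eq_self hp] at this
  not_isBounded := h.not_isBounded_outerTiles
  isPreconnected_diff := h.isPreconnected_outerTiles_diff
  exists_isPreconnected := fun ε hε => h.exists_isPreconnected_outerTiles hε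
  isOpen := isOpen_interior.connectedComponentIn
  isPreconnected_dom := isPreconnected_connectedComponentIn
  isBounded := h.isCompact.isBounded.subset
    ((connectedComponentIn_subset _ _).trans interior_subset)
  disjoint := disjoint_left.2 fun z hz => by
    have := connectedComponentIn_subset _ _ hz
    rwa [h.interior_eq_compl_outerTiles] at this
  frontier_subset := by
    intro z hz
    by_contra hzX
    have hzI : z ∈ interior T := by rwa [h.interior_eq_compl_outerTiles]
    obtain ⟨w, hwz, hwx⟩ := mem_closure_iff.1 hz.1 _ isOpen_interior.connectedComponentIn
      (mem_connectedComponentIn hzI)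
    refine hz.2 ?_
    rw [isOpen_interior.connectedComponentIn.interior_eq, connectedComponentIn_eq hwx,
      ← connectedComponentIn_eq hwz]
    exact mem_connectedComponentIn hzI

theorem nonempty_homeomorph {x : ℂ} (hx : x ∈ interior T) :
    Nonempty (closure (connectedComponentIn (interior T) x) ≃ₜ closedBall (0 : ℂ) 1) :=
  h.isTameDomain.nonempty_homeomorph ⟨x, mem_connectedComponentIn hx⟩

end IsTile

end

section
variable {A B : ℤ} {T : Set ℂ}

/-- A closed connected set invariant under integer translations and contained in a horizontal strip
separates the two sides of the strip. -/
theorem IsPreconnected.false_of_strip {L U : Set ℂ} (hL : IsPreconnected L) (hcl : IsClosed L)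
    (hne : L.Nonempty) (hper : ∀ z ∈ L, ∀ n : ℤ, z + n ∈ L) {m M : ℝ}
    (hmM : ∀ z ∈ L, m ≤ z.im ∧ z.im ≤ M) (hU : IsPreconnected U) (hUL : Disjoint U L)
    {a b : ℂ} (ha : a ∈ U) (hb : b ∈ U) (haM : M < a.im) (hbm : b.im < m) : False := by
  let e : ℂ → ℂ := fun z => Complex.exp (2 * Real.pi * Complex.I * z)
  have hpi := Real.two_pi_pos
  have hpi0 : (2 * Real.pi * Complex.I : ℂ) ≠ 0 := Complex.two_pi_I_ne_zero
  have he : Continuous e := by fun_prop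
  have hnorm : ∀ z, ‖e z‖ = Real.exp (-(2 * Real.pi * z.im)) := fun z => by
    simp [e, Complex.norm_exp]
  have hadd : ∀ z (n : ℤ), e (z + n) = e z := fun z n =>
    Complex.exp_eq_exp_iff_exists_int.2 ⟨n, by ring⟩
  have heq : ∀ z w, e z = e w → ∃ n : ℤ, z = w + n := fun z w hzw => by
    obtain ⟨n, hn⟩ := Complex.exp_eq_exp_iff_exists_int.1 hzw
    exact ⟨n, mul_left_cancel₀ hpi0 (by rw [hn]; ring)⟩
  have hcompact : IsCompact (e '' L) := by
    have : e '' L = e '' (L ∩ (Icc 0 1 ×ℂ Icc m M)) := by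
      refine Subset.antisymm ?_ (image_mono inter_subset_left)
      rintro _ ⟨z, hz, rfl⟩
      obtain ⟨h1, h2⟩ := hmM z hz
      refine ⟨z + (-⌊z.re⌋ : ℤ), ⟨hper z hz _, ?_⟩, hadd z _⟩
      rw [Complex.mem_reProdIm]
      have h3 := Int.floor_le z.re
      have h4 := Int.lt_floor_add_one z.re
      exact ⟨⟨by simp; linarith, by simp; linarith⟩, by simpa using ⟨h1, h2⟩⟩
    rw [this]
    exact ((isCompact_Icc.reProdIm isCompact_Icc).inter_left hcl).image he
  set C : Set ℂ := e '' U ∪ ball 0 (Real.exp (-(2 * Real.pi * M))) ∪ e '' {z | z.im < m} with hC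
  have hCpre : IsPreconnected C := by
    refine ((hU.image e he.continuousOn).union' ⟨e a, mem_image_of_mem e ha, ?_⟩
      (convex_ball _ _).isPreconnected).union' ⟨e b, Or.inl (mem_image_of_mem e hb),
      mem_image_of_mem e hbm⟩ ((convex_halfSpace_im_lt m).isPreconnected.image e he.continuousOn)
    rw [mem_ball_zero_iff, hnorm, Real.exp_lt_exp]
    nlinarith
  have hCL : Disjoint C (e '' L) := by
    rw [disjoint_left]
    rintro _ hz ⟨w, hw, rfl⟩
    obtain ⟨h1, h2⟩ := hmM w hw
    rcases hz with (⟨z, hz, hzw⟩ | hz) | ⟨z, hz, hzw⟩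
    · obtain ⟨n, rfl⟩ := heq z w hzw
      exact disjoint_left.1 hUL hz (hper w hw n)
    · rw [mem_ball_zero_iff, hnorm, Real.exp_lt_exp] at hz
      nlinarith
    · obtain ⟨n, rfl⟩ := heq z w hzw
      simp at hz
      linarith
  obtain ⟨R, hR⟩ := hcompact.isBounded.exists_norm_le
  obtain ⟨w, hwR, hw⟩ : ∃ w, R + 1 ≤ ‖w‖ ∧ w ∈ C := by
    obtain ⟨t, ht⟩ := (Real.tendsto_exp_atTop.eventually_ge_atTop (R + 1)).and
      (eventually_gt_atTop (-(2 * Real.pi * m))) |>.exists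
    refine ⟨_, ?_, Or.inr (mem_image_of_mem e
      (show (⟨0, -t / (2 * Real.pi)⟩ : ℂ) ∈ {z | z.im < m} from ?_))⟩
    · rw [hnorm]
      simp only
      rw [mul_div_cancel₀ _ hpi.ne', neg_neg]
      exact ht.1
    · simp only [mem_ofPred_eq]
      rw [div_lt_iff₀ hpi]
      linarith [ht.2]
  have hlog : HasLogOn (e '' L) fun z => (z - w) * 1 := by
    simpa using HasLogOn.sub_of_subset_ball (p := 0) (ρ := R + 1) (fun z hz => by
      rw [mem_ball_zero_iff]; linarith [hR z hz]) (by simpa using hwR)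
  obtain ⟨g, hg, hge⟩ := HasLogOn.of_isPreconnected hcompact.isClosed (φ := fun _ => 1) hCpre hCL hw
    (w' := 0) (Or.inl (Or.inr (mem_ball_self (Real.exp_pos _)))) hlog
  obtain ⟨z, hz⟩ := hne
  have hz1 : z + 1 ∈ L := by simpa using hper z hz 1
  have hconst := hL.eq_of_forall_exists_int (f := fun z => g (e z) / (2 * Real.pi * Complex.I) - z)
    (((hg.comp he.continuousOn (mapsTo_image e L)).div_const _).sub continuousOn_id)
    (fun y hy => by
      have h1 : Complex.exp (g (e y)) = e y := by
        simpa using hge (e y) (mem_image_of_mem e hy)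
      obtain ⟨n, hn⟩ := Complex.exp_eq_exp_iff_exists_int.1 h1
      refine ⟨n, ?_⟩
      rw [hn]
      field_simp
      ring) hz hz1
  have h2 : e (z + 1) = e z := by simpa using hadd z 1
  simp [h2] at hconst

namespace IsTile

variable (h : IsTile A B T)
include h

theorem not_isPreconnected_interior : ¬ IsPreconnected (interior T) := by
  intro hpre
  have h3 := h.three_le
  have hle := h.le
  set c : ℂ := ⟨1 - A, 1⟩ with hc
  have hc0 : 2 * c ≠ 0 := fun e => by simpa [hc] using congrArg Complex.im e
  let s : ℤ → ℤ × ℤ := fun k => (1 + (2 * k + 1) * (1 - A), 2 * k + 1)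
  have hs : ∀ k, lat (s k) = 1 + c + k * (2 * c) := fun k => by
    apply Complex.ext <;> simp [lat, s, hc] <;> ring
  let L : Set ℂ := ⋃ k, tile T (s k)
  have hLpre : IsPreconnected L := by
    refine IsPreconnected.iUnion_of_chain (fun k => ?_) (fun k => ?_)
    · exact h.isPreconnected_cell 0 (lat (s k))
    · refine ⟨lat (s k), by simpa [tile] using h.zero_mem, ?_⟩
      simp only [tile, mem_ofPred_eq, hs, Order.succ_eq_add_one]
      convert h.neg_two_c_mem using 1
      have : (⟨2 * (1 - A), 2⟩ : ℂ) = 2 * c := by apply Complex.ext <;> simp [hc]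
      rw [this]
      push_cast
      ring
  have hLcl : IsClosed L := by
    have := h.isClosed_biUnion_tile (range s)
    rwa [biUnion_range] at this
  have hcont : Continuous fun z : ℂ => z / (2 * c) := by fun_prop
  have hαc : Continuous (alpha A B) := (alpha A B).continuous_of_finiteDimensional
  have hβc : Continuous (beta A B) := (beta A B).continuous_of_finiteDimensional
  obtain ⟨p, hp, hpmin⟩ := h.isCompact.exists_isMinOn h.nonempty
    (f := fun z : ℂ => (z / (2 * c)).im) (Complex.continuous_im.comp hcont).continuousOn
  obtain ⟨q, hq, hqmax⟩ := h.isCompact.exists_isMaxOn h.nonempty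
    (f := fun z : ℂ => (z / (2 * c)).im) (Complex.continuous_im.comp hcont).continuousOn
  have hneg : (1 / (2 * c)).im < 0 := by
    rw [one_div, Complex.inv_im]
    refine div_neg_of_neg_of_pos (by simp [hc]) (Complex.normSq_pos.2 hc0)
  have hsk : ∀ k, (lat (s k) / (2 * c)).im = (1 / (2 * c)).im := fun k => by
    have : lat (s k) / (2 * c) = 1 / (2 * c) + ((k : ℝ) + 1 / 2 : ℝ) := by
      have hc1 : c ≠ 0 := right_ne_zero_of_mul hc0
      rw [hs]
      push_cast
      field_simp
      ring
    rw [this, Complex.add_im, Complex.ofReal_im, add_zero]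
  have hdigit : ∀ j : ℤ, 0 ≤ j → j < B → ∀ w ∈ interior T, w + j ∈ alpha A B '' interior T := by
    intro j h0 hj w hw
    refine ⟨beta A B (w + j), mem_interior.2 ⟨(fun z => alpha A B z - j) ⁻¹' interior T,
      fun z hz => h.mem_of_digit h0 hj (interior_subset hz),
      isOpen_interior.preimage (hαc.sub continuous_const), ?_⟩, alpha_beta h.ne_zero _⟩
    simpa [alpha_beta h.ne_zero] using hw
  have hdense : ∀ y ∈ T, ∀ ε > 0, ∃ w ∈ interior T, |(w / (2 * c)).im - (y / (2 * c)).im| < ε := by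
    intro y hy ε hε
    obtain ⟨w, hw, hwI⟩ := mem_closure_iff.1 (h.subset_closure_interior hy)
      ((fun z : ℂ => (z / (2 * c)).im) ⁻¹' ball (y / (2 * c)).im ε)
      (isOpen_ball.preimage (Complex.continuous_im.comp hcont)) (mem_ball_self hε)
    exact ⟨w, hwI, hw⟩
  obtain ⟨u, hu, huq⟩ := hdense q hq _ (neg_pos.2 hneg)
  obtain ⟨v, hv, hvp⟩ := hdense p hp _ (neg_pos.2 hneg)
  rw [abs_lt] at huq hvp
  refine IsPreconnected.false_of_strip (L := (fun z => z / (2 * c)) '' L)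
    (U := (fun z => z / (2 * c)) '' (alpha A B '' interior T))
    (hLpre.image _ hcont.continuousOn) ?_ ?_ ?_
    (m := (p / (2 * c)).im + (1 / (2 * c)).im) (M := (q / (2 * c)).im + (1 / (2 * c)).im) ?_
    ((hpre.image _ hαc.continuousOn).image _ hcont.continuousOn) ?_
    (mem_image_of_mem _ (hdigit 0 le_rfl (by omega) u hu))
    (mem_image_of_mem _ (hdigit 2 (by norm_num) (by omega) v hv)) ?_ ?_
  · simpa [div_eq_mul_inv] using
      (Homeomorph.mulRight₀ _ (inv_ne_zero hc0)).isClosedMap _ hLcl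
  · exact ⟨_, mem_image_of_mem _ (mem_iUnion.2 ⟨0, show lat (s 0) ∈ tile T (s 0) by
      simpa [tile] using h.zero_mem⟩)⟩
  · rintro _ ⟨z, hz, rfl⟩ n
    obtain ⟨k, hk⟩ := mem_iUnion.1 hz
    refine ⟨z + n * (2 * c), mem_iUnion.2 ⟨k + n, ?_⟩, by
      have hc1 : c ≠ 0 := right_ne_zero_of_mul hc0
      field_simp⟩
    simp only [tile, mem_ofPred_eq, hs] at hk ⊢
    convert hk using 1
    push_cast
    ring
  · rintro _ ⟨z, hz, rfl⟩
    obtain ⟨k, hk⟩ := mem_iUnion.1 hz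
    have h1 := hpmin hk
    have h2 := hqmax hk
    simp only [mem_ofPred_eq, sub_div, Complex.sub_im, hsk] at h1 h2
    constructor <;> linarith
  · rw [disjoint_left]
    rintro _ ⟨_, ⟨w, hw, rfl⟩, rfl⟩ ⟨z, hz, hzw⟩
    rw [div_left_inj' hc0] at hzw
    subst hzw
    obtain ⟨k, hk⟩ := mem_iUnion.1 hz
    obtain ⟨t, j, h0, hj, htj⟩ := exists_latAlpha_add (A := A) (B := B) (by omega) (s k)
    have hwt : w ∈ tile T t := by
      refine h.mem_of_digit h0 hj ?_
      have hk' : alpha A B w - lat (s k) ∈ T := hk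
      rwa [← htj, lat_add, lat_latAlpha, lat_int, ← sub_sub, ← map_sub] at hk'
    have ht := h.eq_zero_of_mem_interior hw hwt
    rw [ht, latAlpha_zero, zero_add] at htj
    have := congrArg Prod.snd htj
    simp only [s] at this
    omega
  · simp only [Int.cast_zero, add_zero]
    linarith
  · simp only [add_div, Complex.add_im]
    have : (((2 : ℤ) : ℂ) / (2 * c)).im = 2 * (1 / (2 * c)).im := by
      rw [show ((2 : ℤ) : ℂ) / (2 * c) = (2 : ℝ) * (1 / (2 * c)) by push_cast; ring,
        Complex.im_ofReal_mul]
    linarith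

end IsTile

end

section
variable {A B : ℤ} {T : Set ℂ}

theorem exists_alpha_add_smul_eq {e : ℝ} (he : e ^ 2 = 1) (hd : 1 + e * A + B ≠ 0) (y : ℂ) :
    ∃ x, alpha A B x + e • x = y := by
  obtain ⟨d, hd'⟩ : ∃ d, d = 1 + e * A + B := ⟨_, rfl⟩
  rw [← hd'] at hd
  refine ⟨⟨((A + e) * y.re + B * y.im) / d, (e * y.im - y.re) / d⟩, ?_⟩
  apply Complex.ext <;> simp <;> field_simp
  · linear_combination y.re * he - y.re * hd'
  · linear_combination y.im * he - y.im * hd'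

/-- A set that satisfies the equation of the tile up to sign is a translate of the tile. -/
theorem exists_isTile_preimage_add (h3 : 3 ≤ A) (hAB : A ≤ B) (h34 : 2 * A - B = 3 ∨ 2 * A - B = 4)
    (hne : T.Nonempty) (hT : IsCompact T) {ε : ℝ} (hε : ε = 1 ∨ ε = -1)
    (hmem : ∀ x, x ∈ T ↔ ∃ j : ℤ, 0 ≤ j ∧ j < B ∧ ε • alpha A B x - j ∈ T) :
    ∃ s : ℂ, IsTile A B ((· + s) ⁻¹' T) := by
  rcases hε with rfl | rfl
  · exact ⟨0, by simpa using ⟨h3, hAB, h34, hne, hT, by simpa using hmem⟩⟩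
  have hAB' : (A : ℝ) ≤ B := by exact_mod_cast hAB
  have h3' : (3 : ℝ) ≤ A := by exact_mod_cast h3
  obtain ⟨κ, hκ⟩ := exists_alpha_add_smul_eq (A := A) (B := B) (e := 1) (by norm_num)
    (by linarith) (-(B - 1))
  obtain ⟨s, hs⟩ := exists_alpha_add_smul_eq (A := A) (B := B) (e := -1) (by norm_num)
    (by linarith) (-(κ + (B - 1)))
  rw [one_smul] at hκ
  rw [neg_one_smul] at hs
  have hsymm : ∀ x ∈ T, κ - x ∈ T := by
    have hb : Bornology.IsBounded ((fun x => κ - x) '' T) :=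
      (hT.image (by fun_prop)).isBounded
    have := subset_of_forall_exists_digit (by omega) (abs_le.2 ⟨by omega, hAB⟩) (ε := -1)
      (by norm_num) hne hT (fun x j h0 hj hx => (hmem x).2 ⟨j, h0, hj, hx⟩) hb (by
        rintro _ ⟨x, hx, rfl⟩
        obtain ⟨j, h0, hj, hx⟩ := (hmem x).1 hx
        refine ⟨B - 1 - j, by omega, by omega, _, hx, ?_⟩
        push_cast
        rw [map_sub, neg_one_smul, neg_one_smul]
        linear_combination hκ)
    exact fun x hx => this ⟨x, hx, rfl⟩
  have hsymm' : ∀ x, κ - x ∈ T ↔ x ∈ T :=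
    fun x => ⟨fun h => by simpa using hsymm _ h, hsymm x⟩
  refine ⟨s, h3, hAB, h34, ?_, ?_, fun x => ?_⟩
  · exact hne.preimage (Homeomorph.addRight s).surjective
  · exact (Homeomorph.addRight s).isCompact_preimage.2 hT
  · simp only [mem_preimage]
    rw [hmem]
    constructor <;> rintro ⟨j, h0, hj, h⟩ <;> refine ⟨B - 1 - j, by omega, by omega, ?_⟩ <;>
      rw [← hsymm'] <;> convert h using 1 <;> push_cast <;>
      rw [map_add, neg_one_smul] <;> linear_combination hs

theorem LinearIndependent.exists_homeomorph_complex {v w : Fin 2 → ℝ}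
    (h : LinearIndependent ℝ ![v, w]) : ∃ Φ : ℂ ≃ₜ (Fin 2 → ℝ), ∀ z, Φ z = z.re • v + z.im • w := by
  let b := basisOfLinearIndependentOfCardEqFinrank h (by simp)
  refine ⟨(Complex.basisOneI.equiv b (Equiv.refl _)).toContinuousLinearEquiv.toHomeomorph,
    fun z => ?_⟩
  change Complex.basisOneI.equiv b (Equiv.refl _) z = _
  rw [← Complex.basisOneI.sum_repr z, map_sum]
  simp only [map_smul, Module.Basis.equiv_apply]
  simp [b, Fin.sum_univ_two]

/-- Homeomorphic sets have the topological properties of the tile. -/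
theorem IsTile.image_homeomorph (h : IsTile A B T) {X : Type*} [TopologicalSpace X] (Ψ : ℂ ≃ₜ X) :
    IsConnected (Ψ '' T) ∧ (∀ x ∈ Ψ '' T, IsPreconnected (Ψ '' T \ {x})) ∧
      ¬ IsPreconnected (interior (Ψ '' T)) ∧
      ∀ x ∈ interior (Ψ '' T),
        Nonempty (closure (connectedComponentIn (interior (Ψ '' T)) x) ≃ₜ
          closedBall (0 : EuclideanSpace ℝ (Fin 2)) 1) := by
  refine ⟨⟨h.nonempty.image _, h.isPreconnected.image _ Ψ.continuous.continuousOn⟩, ?_, ?_, ?_⟩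
  · rintro _ ⟨x, -, rfl⟩
    rw [← image_singleton, ← image_sdiff Ψ.injective]
    exact (h.isPreconnected_diff x).image _ Ψ.continuous.continuousOn
  · rw [← Ψ.image_interior, Ψ.isPreconnected_image]
    exact h.not_isPreconnected_interior
  · rw [← Ψ.image_interior]
    rintro _ ⟨x, hx, rfl⟩
    rw [← Ψ.image_connectedComponentIn hx, ← Ψ.image_closure]
    obtain ⟨e⟩ := h.nonempty_homeomorph hx
    have hball : Complex.orthonormalBasisOneI.repr.toHomeomorph '' closedBall (0 : ℂ) 1 =
        closedBall (0 : EuclideanSpace ℝ (Fin 2)) 1 := by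
      simp
    exact ⟨(Ψ.image _).symm.trans <| e.trans <|
      (Complex.orthonormalBasisOneI.repr.toHomeomorph.image _).trans (Homeomorph.setCongr hball)⟩

open Polynomial in
theorem mulVec_mulVec_of_charpoly {M : Matrix (Fin 2) (Fin 2) ℤ}
    (hchar : M.charpoly = X ^ 2 + C A * X + C B) (v : Fin 2 → ℝ) :
    (M.map (Int.cast : ℤ → ℝ)).mulVec ((M.map (Int.cast : ℤ → ℝ)).mulVec v) =
      -(A : ℝ) • (M.map (Int.cast : ℤ → ℝ)).mulVec v - (B : ℝ) • v := by
  have h := Matrix.aeval_self_charpoly M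
  rw [hchar] at h
  simp only [map_add, map_mul, map_pow, aeval_X, aeval_C] at h
  ext i
  have h0 := congrFun (congrFun h i) 0
  have h1 := congrFun (congrFun h i) 1
  simp only [sq, Matrix.add_apply, Matrix.mul_apply, Fin.sum_univ_two,
    Matrix.algebraMap_matrix_apply, Matrix.zero_apply] at h0 h1
  have h0' := congrArg (Int.cast : ℤ → ℝ) h0
  have h1' := congrArg (Int.cast : ℤ → ℝ) h1
  fin_cases i <;> simp [Matrix.mulVec, dotProduct, Fin.sum_univ_two] at h0' h1' ⊢ <;>
    linear_combination v 0 * h0' + v 1 * h1'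

end

end

open Polynomial

/-- If `2|A| - B ∈ {3, 4}`, the self-affine tile `T` with collinear
digit set is connected, has no cut point, its interior is disconnected, and the
closure of each connected component of its interior is homeomorphic to the
closed unit disk. -/
theorem tile_no_cutPoint_of_three_four
    (A B : ℤ) (hAB : |A| ≤ B) (hB : 2 ≤ B)
    (M : Matrix (Fin 2) (Fin 2) ℤ)
    (hchar : M.charpoly = X ^ 2 + C A * X + C B)
    (v : Fin 2 → ℤ)
    (hindep : LinearIndependent ℝ
      ![(fun i => (v i : ℝ)), (M.map (Int.cast : ℤ → ℝ)).mulVec fun i => (v i : ℝ)])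
    (T : Set (Fin 2 → ℝ)) (hTne : T.Nonempty) (hTcp : IsCompact T)
    (hT : (M.map (Int.cast : ℤ → ℝ)).mulVec '' T =
      ⋃ j ∈ Set.Icc (0 : ℤ) (B - 1),
        (fun x => x + (j : ℝ) • fun i => (v i : ℝ)) '' T)
    (h34 : 2 * |A| - B = 3 ∨ 2 * |A| - B = 4) :
    IsConnected T ∧ (∀ x ∈ T, IsPreconnected (T \ {x})) ∧
      ¬ IsPreconnected (interior T) ∧
      ∀ x ∈ interior T,
        Nonempty (↥(closure (connectedComponentIn (interior T) x)) ≃ₜ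
          ↥(Metric.closedBall (0 : EuclideanSpace ℝ (Fin 2)) 1)) := by
  obtain ⟨σ, hσ, hσA⟩ : ∃ σ : ℝ, (σ = 1 ∨ σ = -1) ∧ ((|A| : ℤ) : ℝ) = -σ * A := by
    rcases le_total A 0 with h | h
    · exact ⟨1, Or.inl rfl, by rw [abs_of_nonpos h]; simp⟩
    · exact ⟨-1, Or.inr rfl, by rw [abs_of_nonneg h]; simp⟩
  have hσ2 : σ * σ = 1 := by rcases hσ with rfl | rfl <;> norm_num
  set f := (M.map (Int.cast : ℤ → ℝ)).mulVec with hf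
  set v' : Fin 2 → ℝ := fun i => (v i : ℝ) with hv'
  have hff : f (f v') = -(A : ℝ) • f v' - (B : ℝ) • v' := mulVec_mulVec_of_charpoly hchar v'
  have hindep' : LinearIndependent ℝ ![v', σ • f v'] := by
    rw [LinearIndependent.pair_iff] at hindep ⊢
    intro s t hst
    rw [smul_smul] at hst
    obtain ⟨hs, ht⟩ := hindep s (t * σ) hst
    exact ⟨hs, by linear_combination σ * ht - t * hσ2⟩
  obtain ⟨Φ, hΦ⟩ := hindep'.exists_homeomorph_complex
  have hfΦ (z : ℂ) : f (Φ z) = Φ (σ • alpha |A| B z) := by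
    rw [hΦ, hΦ, hf, Matrix.mulVec_add, Matrix.mulVec_smul, Matrix.mulVec_smul, Matrix.mulVec_smul,
      ← hf, hff]
    ext i
    simp [hσA]
    linear_combination (f v' i * z.im * σ * A - z.re * f v' i) * hσ2
  have hB0 : (B : ℝ) ≠ 0 := by exact_mod_cast (by omega : B ≠ 0)
  have hinj : Function.Injective f := by
    intro x y hxy
    obtain ⟨x, rfl⟩ := Φ.surjective x
    obtain ⟨y, rfl⟩ := Φ.surjective y
    rw [hfΦ, hfΦ] at hxy
    have h1 := congrArg (fun z => σ • z) (Φ.injective hxy)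
    simp only [smul_smul, hσ2, one_smul] at h1
    rw [← beta_alpha (A := |A|) (by omega : B ≠ 0) x, h1, beta_alpha (by omega)]
  have hmem (z : ℂ) : z ∈ Φ ⁻¹' T ↔ ∃ j : ℤ, 0 ≤ j ∧ j < B ∧ σ • alpha |A| B z - j ∈ Φ ⁻¹' T := by
    have hsub (z : ℂ) (j : ℤ) : Φ (z - j) = Φ z - (j : ℝ) • v' := by
      rw [hΦ, hΦ]
      simp only [Complex.sub_re, Complex.intCast_re, Complex.sub_im, Complex.intCast_im, sub_zero]
      module
    rw [Set.mem_preimage, ← hinj.mem_set_image, hT]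
    simp only [Set.mem_iUnion, Set.mem_image, Set.mem_Icc, Set.mem_preimage, hsub, ← hfΦ,
      exists_prop]
    refine exists_congr fun j => ?_
    rw [and_assoc, Int.le_sub_one_iff]
    refine and_congr_right fun _ => and_congr_right fun _ => ⟨?_, fun h => ⟨_, h, by simp⟩⟩
    rintro ⟨x, hx, hxj⟩
    rwa [← hxj, add_sub_cancel_right]
  obtain ⟨s, hs⟩ := exists_isTile_preimage_add (by omega) hAB h34 (hTne.preimage Φ.surjective)
    (Φ.isCompact_preimage.2 hTcp) hσ hmem
  have := hs.image_homeomorph ((Homeomorph.addRight s).trans Φ)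
  rwa [show ((Homeomorph.addRight s).trans Φ) '' ((· + s) ⁻¹' (Φ ⁻¹' T)) = T from
    Set.image_preimage_eq T ((Homeomorph.addRight s).trans Φ).surjective] at this
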